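/- Let H be a division ring of finite dimension over its center k, and suppose there is a ring homomorphism from the real numbers ℝ into k. Let F be a division ring that is a classical right quotient ring of the ring H[X] of polynomial functions on H (via an injective ring homomorphism φ : H[X] → F). Then for every finite group G there exist a division ring M and an injective ring homomorphism ι : F → M such that the extension M/F is Galois with Galois group isomorphic to G. -/

import Mathlib

universe u v w x

/-- The subgroup of ring automorphisms of `M` fixing the image of `ι` pointwise
(the Galois group of the extension `M/F` given by `ι`). -/
def fixingAut {F M : Type*} [DivisionRing F] [DivisionRing M] (ι : F →+* M) :
    Subgroup (RingAut M) where
  carrier := {σ | ∀ x : F, σ (ι x) = ι x}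
  one_mem' := fun _ => rfl
  mul_mem' := by
    intro a b ha hb x
    show a (b (ι x)) = ι x
    rw [hb x, ha x]
  inv_mem' := by
    intro a ha x
    show a.symm (ι x) = ι x
    conv_lhs => rw [← ha x]
    exact a.symm_apply_apply _

/-- The extension `M/F` given by `ι : F →+* M` is Galois: every element of `M` fixed by all
ring automorphisms of `M` fixing `ι(F)` pointwise lies in `ι(F)`. -/
def IsGaloisExt {F M : Type*} [DivisionRing F] [DivisionRing M] (ι : F →+* M) : Prop :=
  ∀ m : M, (∀ σ ∈ fixingAut ι, σ m = m) → m ∈ Set.range ι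

/-- The ring `H[X]` of polynomial functions on a division ring `H`: the subring of `H → H`
(with pointwise operations) generated by the constant functions and the identity function. -/
def polyFunRing (H : Type*) [DivisionRing H] : Subring (H → H) :=
  Subring.closure ({f | ∃ c : H, f = Function.const H c} ∪ {id})

/-- `F` is a classical right quotient ring of `R` via the injective ring homomorphism `φ`:
every element of `F` is of the form `φ a * (φ b)⁻¹` with `b ≠ 0`. -/
def IsClassicalRightQuotient {R F : Type*} [Ring R] [DivisionRing F] (φ : R →+* F) : Prop :=
  Function.Injective φ ∧ ∀ x : F, ∃ a b : R, b ≠ 0 ∧ x = φ a * (φ b)⁻¹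

/-- Auxiliary construction for the iterated polynomial ring. -/
noncomputable def IterPolyAux (H : Type u) [Ring H] : ℕ → ((T : Type u) × Ring T)
  | 0 => ⟨H, inferInstance⟩
  | n + 1 =>
    letI := (IterPolyAux H n).2
    ⟨Polynomial (IterPolyAux H n).1, inferInstance⟩

/-- The iterated polynomial ring `H_c[t₁, …, t_n]` in `n` central variables over `H`:
`IterPoly H 0 = H` and `IterPoly H (n + 1) = Polynomial (IterPoly H n)`. -/
def IterPoly (H : Type u) [Ring H] (n : ℕ) : Type u := (IterPolyAux H n).1

noncomputable instance (H : Type u) [Ring H] (n : ℕ) : Ring (IterPoly H n) :=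
  (IterPolyAux H n).2

open Polynomial TensorProduct

/-- A family `θ` indexed by a finite group `G` of elements of a field `K` is a *Galois family* over
the subfield `E` if `E(θ 1)` is a Galois extension of `E` whose conjugates of `θ 1` are the `θ g`,
and left translations act through polynomials over `E`. -/
structure GaloisFamily {K : Type*} [Field K] (E : Subfield K) {G : Type*} [Group G]
    (θ : G → K) : Prop where
  injective : Function.Injective θ
  translate : ∀ k, ∃ p : E[X], ∀ g, θ (k * g) = aeval (θ g) p
  conj : ∀ p : E[X], aeval (θ 1) p = 0 → ∀ g, aeval (θ g) p = 0
  charpoly : ∃ q : E[X], q.Monic ∧ q.natDegree = Nat.card G ∧ ∀ g, aeval (θ g) q = 0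

theorem mem_of_aeval_eq_const {K : Type*} [Field K] (E : Subfield K) {G : Type*} [Nonempty G]
    [Finite G] {θ : G → K} (hθ : Function.Injective θ) {q : E[X]} (hq : q.Monic)
    (hdeg : q.natDegree = Nat.card G) (hroot : ∀ g, aeval (θ g) q = 0) {v : K} (p : E[X])
    (hp : ∀ g, aeval (θ g) p = v) : v ∈ E := by
  have := Fintype.ofFinite G
  have hpos : 0 < q.natDegree := hdeg ▸ Nat.card_pos
  have hr : ∀ g, aeval (θ g) (p %ₘ q) = v := fun g => by
    rw [← hp g, aeval_modByMonic_eq_self_of_root (hroot g)]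
  have hlt : (p %ₘ q).natDegree < Nat.card G := hdeg ▸ natDegree_modByMonic_lt _ hq (by
    rintro rfl; simp at hpos)
  have hzero : (p %ₘ q).map (algebraMap E K) - C v = 0 := by
    refine eq_zero_of_natDegree_lt_card_of_eval_eq_zero _ hθ (fun g => ?_) ?_
    · rw [eval_sub, eval_map_algebraMap, hr, eval_C, sub_self]
    · rw [natDegree_sub_C, natDegree_map, ← Nat.card_eq_fintype_card]
      exact hlt
  have h0 := congrArg (fun P => P.coeff 0) hzero
  simp only [coeff_sub, coeff_map, coeff_C_zero, coeff_zero, sub_eq_zero] at h0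
  rw [← h0]
  exact ((p %ₘ q).coeff 0).2

theorem Subring.aeval_mem {K : Type*} [Field K] {E : Subfield K} {G : Type*}
    (F : Subring (G → K)) (hE : ∀ e ∈ E, (fun _ => e) ∈ F) {θ : G → K} (hθ : θ ∈ F) (p : E[X]) :
    (fun g => aeval (θ g) p) ∈ F := by
  have : (fun g => aeval (θ g) p) = ∑ n ∈ Finset.range (p.natDegree + 1),
      (fun _ => ((p.coeff n : E) : K)) * θ ^ n := by
    funext g
    rw [aeval_eq_sum_range, Finset.sum_apply]
    rfl
  rw [this]
  exact F.sum_mem fun n _ => F.mul_mem (hE _ (p.coeff n).2) (F.pow_mem hθ n)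

section SubringFamily

variable {K : Type*} [Field K] {E : Subfield K} {G : Type*} [Group G]
  {F : Subring (G → K)}

theorem Subring.inv_mem_of_translate [Finite G] (hE : ∀ e ∈ E, (fun _ => e) ∈ F)
    (htr : ∀ k, ∀ b ∈ F, (fun h => b (k * h)) ∈ F)
    (hz : ∀ b ∈ F, b 1 = 0 → b = 0)
    (hc : ∀ b ∈ F, (∀ g, b g = b 1) → b 1 ∈ E) {b : G → K} (hb : b ∈ F) : b⁻¹ ∈ F := by
  classical
  have := Fintype.ofFinite G
  by_cases hb0 : b = 0
  · convert F.zero_mem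
    funext g
    simp [hb0]
  have hne : ∀ g, b g ≠ 0 := fun g hg => hb0 <| by
    have := hz _ (htr g b hb) (by simpa using hg)
    funext h
    simpa using congrFun this (g⁻¹ * h)
  have hN : (fun h => ∏ g, b (g * h)) ∈ F := by
    have := F.prod_mem (t := Finset.univ) (f := fun g => fun h => b (g * h))
      (fun g _ => htr g b hb)
    convert this using 1
    funext h; simp
  have hNE := hc _ hN (fun g => by
    simp only [mul_one]
    exact Fintype.prod_equiv (Equiv.mulRight g) _ _ (fun _ => rfl))
  have hr : (fun h => ∏ g ∈ Finset.univ.erase (1 : G), b (g * h)) ∈ F := by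
    have := F.prod_mem (t := Finset.univ.erase 1) (f := fun g => fun h => b (g * h))
      (fun g _ => htr g b hb)
    convert this using 1
    funext h; simp
  have := F.mul_mem hr (hE _ (E.inv_mem hNE))
  convert this using 1
  funext h
  have hprod : ∏ g, b (g * 1) = ∏ g, b (g * h) := by
    simp only [mul_one]
    exact (Fintype.prod_equiv (Equiv.mulRight h) _ _ (fun _ => rfl)).symm
  rw [Pi.inv_apply, Pi.mul_apply, hprod, ← Finset.mul_prod_erase _ _ (Finset.mem_univ (1 : G)),
    one_mul]
  have : ∏ g ∈ Finset.univ.erase (1 : G), b (g * h) ≠ 0 :=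
    Finset.prod_ne_zero_iff.2 fun g _ => hne _
  field_simp [hne h]

theorem Polynomial.mem_lifts_of_coeff_const (hc : ∀ b ∈ F, (∀ g, b g = b 1) → b 1 ∈ E)
    (P : F[X]) (p : K[X])
    (hP : ∀ h, P.map ((Pi.evalRingHom (fun _ : G => K) h).comp F.subtype) = p) :
    p ∈ lifts (algebraMap E K) := by
  rw [lifts_iff_coeff_lifts]
  intro n
  have hcoeff : ∀ h, (P.coeff n).1 h = p.coeff n := fun h => by
    rw [← hP h, coeff_map]; rfl
  refine ⟨⟨p.coeff n, ?_⟩, rfl⟩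
  rw [← hcoeff 1]
  exact hc _ (P.coeff n).2 (fun g => by rw [hcoeff, hcoeff])

theorem exists_eq_aeval_of_mem [Finite G] (hE : ∀ e ∈ E, (fun _ => e) ∈ F)
    (htr : ∀ k, ∀ b ∈ F, (fun h => b (k * h)) ∈ F)
    (hz : ∀ b ∈ F, b 1 = 0 → b = 0)
    (hc : ∀ b ∈ F, (∀ g, b g = b 1) → b 1 ∈ E) {θ f : G → K} (hθ : θ ∈ F)
    (hinj : Function.Injective θ) (hf : f ∈ F) : ∃ p : E[X], ∀ g, f g = aeval (θ g) p := by
  classical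
  have := Fintype.ofFinite G
  let tr : (b : G → K) → b ∈ F → G → F := fun b hb g => ⟨_, htr g b hb⟩
  let iv : F → F := fun b => ⟨_, Subring.inv_mem_of_translate hE htr hz hc b.2⟩
  let P : F[X] := ∑ g, C (tr f hf g) * ∏ g' ∈ Finset.univ.erase g,
    (C (iv (tr θ hθ g - tr θ hθ g')) * (X - C (tr θ hθ g')))
  have hinjOn : ∀ h : G, Set.InjOn (fun g => θ (g * h)) (Finset.univ : Finset G) :=
    fun h a _ b _ hab => by simpa using hinj hab
  have hP : ∀ h, P.map ((Pi.evalRingHom (fun _ : G => K) h).comp F.subtype)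
      = Lagrange.interpolate Finset.univ θ f := by
    intro h
    have : P.map ((Pi.evalRingHom (fun _ : G => K) h).comp F.subtype)
        = Lagrange.interpolate Finset.univ (fun g => θ (g * h)) (fun g => f (g * h)) := by
      simp only [P, Lagrange.interpolate_apply, Lagrange.basis, Lagrange.basisDivisor,
        Polynomial.map_sum, Polynomial.map_mul, Polynomial.map_prod, map_C, Polynomial.map_sub,
        map_X]
      rfl
    rw [this]
    refine Lagrange.eq_interpolate_of_eval_eq _ hinj.injOn
      (Lagrange.degree_interpolate_lt _ (hinjOn h)) (fun g _ => ?_)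
    have := Lagrange.eval_interpolate_at_node (fun g => f (g * h)) (hinjOn h)
      (Finset.mem_univ (g * h⁻¹))
    simpa using this
  obtain ⟨p, hp⟩ := (mem_lifts _).1 (Polynomial.mem_lifts_of_coeff_const hc P _ hP)
  refine ⟨p, fun g => ?_⟩
  rw [← eval_map_algebraMap, hp, Lagrange.eval_interpolate_at_node _ hinj.injOn
    (Finset.mem_univ g)]

theorem GaloisFamily.of_subring [Finite G] (hE : ∀ e ∈ E, (fun _ => e) ∈ F)
    (htr : ∀ k, ∀ b ∈ F, (fun h => b (k * h)) ∈ F)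
    (hz : ∀ b ∈ F, b 1 = 0 → b = 0)
    (hc : ∀ b ∈ F, (∀ g, b g = b 1) → b 1 ∈ E) {θ : G → K} (hθ : θ ∈ F)
    (hinj : Function.Injective θ) : GaloisFamily E θ := by
  classical
  have := Fintype.ofFinite G
  refine ⟨hinj, fun k => exists_eq_aeval_of_mem hE htr hz hc hθ hinj (htr k θ hθ), ?_, ?_⟩
  · intro p hp
    have hmem := F.aeval_mem hE hθ p
    have := hz _ hmem hp
    exact fun g => congrFun this g
  · let P : F[X] := ∏ g, (X - C ⟨_, htr g θ hθ⟩)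
    have hP : ∀ h, P.map ((Pi.evalRingHom (fun _ : G => K) h).comp F.subtype)
        = ∏ g, (X - C (θ g)) := by
      intro h
      simp only [P, Polynomial.map_prod, map_C, Polynomial.map_sub, map_X]
      exact Fintype.prod_equiv (Equiv.mulRight h) _ _ (fun _ => rfl)
    obtain ⟨q, hq, hqd, hqm⟩ := lifts_and_natDegree_eq_and_monic
      (Polynomial.mem_lifts_of_coeff_const hc P _ hP)
      (monic_prod_of_monic _ _ fun g _ => monic_X_sub_C _)
    refine ⟨q, hqm, ?_, fun g => ?_⟩
    · rw [hqd, natDegree_finsetProd_X_sub_C_eq_card, Finset.card_univ, Nat.card_eq_fintype_card]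
    · rw [← eval_map_algebraMap, hq, eval_prod]
      exact Finset.prod_eq_zero (Finset.mem_univ g) (by simp)

end SubringFamily

section Transport

variable {K Q : Type*} [Field K] [Field Q] (j : K →+* Q) (E : Subfield K) {G : Type*} [Group G]
  {θ : G → K}

theorem Subfield.exists_map_aeval (p : E[X]) :
    ∃ p' : (E.map j)[X], p'.natDegree = p.natDegree ∧ (p.Monic → p'.Monic) ∧
      ∀ x, aeval (j x) p' = j (aeval x p) := by
  let φ : E →+* E.map j := (j.comp E.subtype).codRestrict _ fun x => ⟨x, x.2, rfl⟩
  refine ⟨p.map φ, natDegree_map _, fun h => h.map _, fun x => ?_⟩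
  rw [aeval_def, eval₂_map, aeval_def, hom_eval₂]
  rfl

theorem Subfield.exists_aeval_of_map (p' : (E.map j)[X]) :
    ∃ p : E[X], p.natDegree = p'.natDegree ∧ (p'.Monic → p.Monic) ∧
      ∀ x, aeval (j x) p' = j (aeval x p) := by
  let φ : E →+* E.map j := (j.comp E.subtype).codRestrict _ fun x => ⟨x, x.2, rfl⟩
  have hφ : Function.Surjective φ := by
    rintro ⟨_, x, hx, rfl⟩
    exact ⟨⟨x, hx⟩, rfl⟩
  obtain ⟨p, rfl⟩ := map_surjective φ hφ p'
  refine ⟨p, (natDegree_map _).symm, fun h => monic_of_injective φ.injective h, fun x => ?_⟩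
  rw [aeval_def, eval₂_map, aeval_def, hom_eval₂]
  rfl

variable {E}

theorem GaloisFamily.map (h : GaloisFamily E θ) :
    GaloisFamily (E.map j) (fun g => j (θ g)) := by
  refine ⟨j.injective.comp h.injective, fun k => ?_, fun p' hp' g => ?_, ?_⟩
  · obtain ⟨p, hp⟩ := h.translate k
    obtain ⟨p', -, -, hp'⟩ := E.exists_map_aeval j p
    exact ⟨p', fun g => by rw [hp', hp]⟩
  · obtain ⟨p, -, -, hp⟩ := E.exists_aeval_of_map j p'
    rw [hp] at hp' ⊢
    rw [h.conj p ((map_eq_zero j).1 hp') g, map_zero]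
  · obtain ⟨q, hq, hqd, hq0⟩ := h.charpoly
    obtain ⟨q', hd, hm, hq'⟩ := E.exists_map_aeval j q
    exact ⟨q', hm hq, hd.trans hqd, fun g => by rw [hq', hq0, map_zero]⟩

theorem GaloisFamily.of_map (h : GaloisFamily (E.map j) (fun g => j (θ g))) :
    GaloisFamily E θ := by
  refine ⟨fun a b hab => h.injective (congrArg j hab), fun k => ?_, fun p hp g => ?_, ?_⟩
  · obtain ⟨p', hp'⟩ := h.translate k
    obtain ⟨p, -, -, hp⟩ := E.exists_aeval_of_map j p'
    exact ⟨p, fun g => j.injective (by rw [hp', hp])⟩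
  · obtain ⟨p', -, -, hp'⟩ := E.exists_map_aeval j p
    have := h.conj p' (by rw [hp', hp, map_zero]) g
    rw [hp'] at this
    exact (map_eq_zero j).1 this
  · obtain ⟨q', hq, hqd, hq0⟩ := h.charpoly
    obtain ⟨q, hd, hm, hq'⟩ := E.exists_aeval_of_map j q'
    exact ⟨q, hm hq, hd.trans hqd, fun g => (map_eq_zero j).1 (by rw [← hq', hq0])⟩

/-- Reindexing a Galois family along a group isomorphism. -/
theorem GaloisFamily.comp_mulEquiv {G' : Type*} [Group G'] (h : GaloisFamily E θ) (e : G' ≃* G) :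
    GaloisFamily E (fun g => θ (e g)) := by
  refine ⟨h.injective.comp e.injective, fun k => ?_, fun p hp g => ?_, ?_⟩
  · obtain ⟨p, hp⟩ := h.translate (e k)
    exact ⟨p, fun g => by rw [map_mul, hp]⟩
  · exact h.conj p (by simpa using hp) _
  · obtain ⟨q, hq, hqd, hq0⟩ := h.charpoly
    exact ⟨q, hq, hqd.trans (Nat.card_congr e.toEquiv.symm), fun g => hq0 _⟩

end Transport

section Patching

variable {Q : Type*} [Field Q] {E Q₁ Q₂ : Subfield Q}

theorem Subfield.exists_aeval_eq_of_le (h : E ≤ Q₁) (p : E[X]) :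
    ∃ p' : Q₁[X], p'.natDegree = p.natDegree ∧ (p.Monic → p'.Monic) ∧
      ∀ x : Q, aeval x p' = aeval x p := by
  refine ⟨p.map (Subfield.inclusion h), natDegree_map _, fun hp => hp.map _, fun x => ?_⟩
  rw [aeval_def, eval₂_map, aeval_def]
  rfl

/-- Linear disjointness: a Galois family over `E = Q₁ ∩ Q₂` with values in `Q₂` remains a family of
conjugates over `Q₁`. -/
theorem GaloisFamily.conj_of_inf {G : Type*} [Group G] [Finite G] {θ : G → Q}
    (hE : Q₁ ⊓ Q₂ = E) (h : GaloisFamily E θ) (hθ : ∀ g, θ g ∈ Q₂) (p : Q₁[X])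
    (hp : aeval (θ 1) p = 0) (g : G) : aeval (θ g) p = 0 := by
  have := Fintype.ofFinite G
  have hE₁ : E ≤ Q₁ := hE ▸ inf_le_left
  obtain ⟨q, hq, hqd, hq0⟩ := h.charpoly
  obtain ⟨q', hq'd, hq'm, hq'⟩ := Subfield.exists_aeval_eq_of_le hE₁ q
  replace hq'm := hq'm hq
  have hmon : (∏ g, (X - C (θ g))).Monic := monic_prod_of_monic _ _ fun g _ => monic_X_sub_C _
  have hprod : q'.map (algebraMap Q₁ Q) = ∏ g, (X - C (θ g)) := by
    refine eq_of_monic_of_dvd_of_natDegree_le hmon (hq'm.map (algebraMap Q₁ Q)) ?_ ?_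
    · refine Finset.prod_dvd_of_coprime (fun a _ b _ hab =>
        pairwise_coprime_X_sub_C h.injective hab) fun g _ => ?_
      rw [dvd_iff_isRoot, IsRoot, eval_map_algebraMap, hq', hq0]
    · rw [natDegree_map, hq'd, hqd, natDegree_finsetProd_X_sub_C_eq_card, Finset.card_univ,
        Nat.card_eq_fintype_card]
  have hint : IsIntegral Q₁ (θ 1) := ⟨q', hq'm, by rw [← aeval_def, hq', hq0]⟩
  set μ := minpoly Q₁ (θ 1) with hμ
  have hμm : μ.Monic := minpoly.monic hint
  have hμq : μ.map (algebraMap Q₁ Q) ∣ ∏ g, (X - C (θ g)) := by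
    rw [← hprod]
    exact Polynomial.map_dvd _ (minpoly.dvd _ _ (by rw [hq', hq0]))
  have hsplit : (μ.map (algebraMap Q₁ Q)).Splits :=
    Splits.of_dvd (Splits.prod fun g _ => Splits.X_sub_C _) hmon.ne_zero hμq
  have hμ2 : μ.map (algebraMap Q₁ Q) ∈ lifts (algebraMap Q₂ Q) := by
    rw [hsplit.eq_prod_roots_of_monic (hμm.map _)]
    refine Subsemiring.multiset_prod_mem _ _ fun f hf => ?_
    obtain ⟨r, hr, rfl⟩ := Multiset.mem_map.1 hf
    have hroot : IsRoot (∏ g, (X - C (θ g))) r := ((mem_roots'.1 hr).2).dvd hμq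
    rw [IsRoot, eval_prod, Finset.prod_eq_zero_iff] at hroot
    obtain ⟨g, -, hg⟩ := hroot
    rw [eval_sub, eval_X, eval_C, sub_eq_zero] at hg
    exact ⟨X - C ⟨θ g, hθ g⟩, by simp [hg]; rfl⟩
  rw [lifts_iff_coeff_lifts] at hμ2
  have hμE : μ.map (algebraMap Q₁ Q) ∈ lifts (algebraMap E Q) := by
    rw [lifts_iff_coeff_lifts]
    intro n
    obtain ⟨y, hy⟩ := hμ2 n
    have hmem : (μ.map (algebraMap Q₁ Q)).coeff n ∈ E := by
      rw [← hE]
      refine ⟨?_, ?_⟩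
      · rw [coeff_map]; exact (μ.coeff n).2
      · rw [← hy]; exact y.2
    exact ⟨⟨_, hmem⟩, rfl⟩
  obtain ⟨ν, hν⟩ := (mem_lifts _).1 hμE
  have key : ∀ x : Q, aeval x ν = aeval x μ := fun x => by
    rw [← eval_map_algebraMap, hν, eval_map_algebraMap]
  have hz := h.conj ν (by rw [key, hμ, minpoly.aeval]) g
  rw [key] at hz
  obtain ⟨s, hs⟩ := minpoly.dvd _ _ hp
  rw [hs, map_mul, ← hμ, hz, zero_mul]

/-- Functions on `G` which on each left coset of `G₁` are polynomials over `Q₁` in `θ`. -/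
def inducedSubring (Q₁ : Subfield Q) {G : Type*} [Group G] {G₁ : Subgroup G} (θ : G₁ → Q) :
    Subring (G → Q) where
  carrier := {b | ∀ g, ∃ p : Q₁[X], ∀ τ : G₁, b (g * τ) = aeval (θ τ) p}
  mul_mem' := fun ha hb g => by
    obtain ⟨p, hp⟩ := ha g
    obtain ⟨q, hq⟩ := hb g
    exact ⟨p * q, fun τ => by rw [Pi.mul_apply, hp, hq, map_mul]⟩
  one_mem' := fun g => ⟨1, fun τ => by simp⟩
  add_mem' := fun ha hb g => by
    obtain ⟨p, hp⟩ := ha g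
    obtain ⟨q, hq⟩ := hb g
    exact ⟨p + q, fun τ => by rw [Pi.add_apply, hp, hq, map_add]⟩
  zero_mem' := fun g => ⟨0, fun τ => by simp⟩
  neg_mem' := fun ha g => by
    obtain ⟨p, hp⟩ := ha g
    exact ⟨-p, fun τ => by rw [Pi.neg_apply, hp, map_neg]⟩

variable {G : Type*} [Group G] {G₁ : Subgroup G} {θ : G₁ → Q}

theorem const_mem_inducedSubring {e : Q} (he : e ∈ Q₁) :
    (fun _ => e) ∈ inducedSubring Q₁ θ :=
  fun _ => ⟨C ⟨e, he⟩, fun τ => by rw [aeval_C]; rfl⟩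

theorem translate_mem_inducedSubring (k : G) {b : G → Q} (hb : b ∈ inducedSubring Q₁ θ) :
    (fun h => b (k * h)) ∈ inducedSubring Q₁ θ := fun g => by
  obtain ⟨p, hp⟩ := hb (k * g)
  exact ⟨p, fun τ => by rw [← hp, mul_assoc]⟩

theorem mul_eq_zero_of_mem_inducedSubring [Finite G] (hE : Q₁ ⊓ Q₂ = E) (h : GaloisFamily E θ)
    (hθ : ∀ g, θ g ∈ Q₂) {b : G → Q} (hb : b ∈ inducedSubring Q₁ θ) {g : G} (hg : b g = 0)
    {τ : G} (hτ : τ ∈ G₁) : b (g * τ) = 0 := by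
  obtain ⟨p, hp⟩ := hb g
  have := h.conj_of_inf hE hθ p (by rw [← hp, OneMemClass.coe_one, mul_one, hg]) ⟨τ, hτ⟩
  rwa [← hp] at this

theorem mem_of_const_mem_inducedSubring [Finite G] (hE : E ≤ Q₁) (h : GaloisFamily E θ)
    {v : Q} (hb : (fun _ => v) ∈ inducedSubring Q₁ θ) : v ∈ Q₁ := by
  obtain ⟨p, hp⟩ := hb 1
  obtain ⟨q, hq, hqd, hq0⟩ := h.charpoly
  obtain ⟨q', hq'd, hq'm, hq'⟩ := Subfield.exists_aeval_eq_of_le hE q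
  exact mem_of_aeval_eq_const Q₁ h.injective (hq'm hq) (hq'd.trans hqd)
    (fun g => by rw [hq', hq0]) p (fun g => (hp g).symm)

/-- Algebraic patching of two Galois families. -/
theorem GaloisFamily.patch [Finite G] {G₂ : Subgroup G} (hG : G₁ ⊔ G₂ = ⊤) (hE : Q₁ ⊓ Q₂ = E)
    (h₁ : GaloisFamily E θ) (hθ₁ : ∀ g, θ g ∈ Q₂) {θ₂ : G₂ → Q} (h₂ : GaloisFamily E θ₂)
    (hθ₂ : ∀ g, θ₂ g ∈ Q₁) {a : G → Q} (ha : Function.Injective a)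
    (ha₁ : a ∈ inducedSubring Q₁ θ) (ha₂ : a ∈ inducedSubring Q₂ θ₂) : GaloisFamily E a := by
  have hE' : Q₂ ⊓ Q₁ = E := by rw [inf_comm, hE]
  have hE₁ : E ≤ Q₁ := hE ▸ inf_le_left
  have hE₂ : E ≤ Q₂ := hE ▸ inf_le_right
  refine GaloisFamily.of_subring (F := inducedSubring Q₁ θ ⊓ inducedSubring Q₂ θ₂)
    (fun e he => ⟨const_mem_inducedSubring (hE₁ he), const_mem_inducedSubring (hE₂ he)⟩)
    (fun k b hb => ⟨translate_mem_inducedSubring k hb.1, translate_mem_inducedSubring k hb.2⟩)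
    (fun b hb hb1 => ?_) (fun b hb hconst => ?_) ⟨ha₁, ha₂⟩ ha
  · have : ∀ τ ∈ G₁ ⊔ G₂, ∀ g, b g = 0 → b (g * τ) = 0 := by
      intro τ hτ
      rw [Subgroup.sup_eq_closure] at hτ
      induction hτ using Subgroup.closure_induction'' with
      | mem x hx =>
        intro g hg
        rcases hx with hx | hx
        · exact mul_eq_zero_of_mem_inducedSubring hE h₁ hθ₁ hb.1 hg hx
        · exact mul_eq_zero_of_mem_inducedSubring hE' h₂ hθ₂ hb.2 hg hx
      | inv_mem x hx =>
        intro g hg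
        rcases hx with hx | hx
        · exact mul_eq_zero_of_mem_inducedSubring hE h₁ hθ₁ hb.1 hg (G₁.inv_mem hx)
        · exact mul_eq_zero_of_mem_inducedSubring hE' h₂ hθ₂ hb.2 hg (G₂.inv_mem hx)
      | one => simp
      | mul x y _ _ hx hy => intro g hg; rw [← mul_assoc]; exact hy _ (hx _ hg)
    funext g
    have := this g (hG ▸ Subgroup.mem_top g) 1 hb1
    simpa using this
  · have hb' : b = fun _ => b 1 := funext hconst
    rw [hb'] at hb
    rw [← hE]
    exact ⟨mem_of_const_mem_inducedSubring hE₁ h₁ hb.1,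
      mem_of_const_mem_inducedSubring hE₂ h₂ hb.2⟩

end Patching

section RealAdjoin

variable {K Q : Type*} [Field K] [Field Q]

/-- The subfield `ℝ(x)` generated by an element `x` and the image of the reals. -/
def realAdjoin (ρ : ℝ →+* K) (x : K) : Subfield K :=
  Subfield.closure (Set.range ρ ∪ {x})

theorem const_mem_realAdjoin (ρ : ℝ →+* K) (x : K) (r : ℝ) : ρ r ∈ realAdjoin ρ x :=
  Subfield.subset_closure (Or.inl ⟨r, rfl⟩)

theorem self_mem_realAdjoin (ρ : ℝ →+* K) (x : K) : x ∈ realAdjoin ρ x :=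
  Subfield.subset_closure (Or.inr rfl)

theorem realAdjoin_le {ρ : ℝ →+* K} {x : K} {S : Subfield K} (h : ∀ r, ρ r ∈ S) (hx : x ∈ S) :
    realAdjoin ρ x ≤ S := by
  refine Subfield.closure_le.2 ?_
  rintro _ (⟨r, rfl⟩ | rfl)
  · exact h r
  · exact hx

theorem realAdjoin_eq_of_mem {ρ : ℝ →+* K} {x y : K} (hx : x ∈ realAdjoin ρ y)
    (hy : y ∈ realAdjoin ρ x) : realAdjoin ρ x = realAdjoin ρ y :=
  le_antisymm (realAdjoin_le (const_mem_realAdjoin ρ y) hx)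
    (realAdjoin_le (const_mem_realAdjoin ρ x) hy)

theorem map_realAdjoin (j : K →+* Q) (ρ : ℝ →+* K) (x : K) :
    (realAdjoin ρ x).map j = realAdjoin (j.comp ρ) (j x) := by
  rw [realAdjoin, RingHom.map_field_closure, Set.image_union, Set.image_singleton,
    ← Set.range_comp]
  rfl

theorem eval₂_mem_realAdjoin (ρ : ℝ →+* K) (x : K) (p : ℝ[X]) :
    p.eval₂ ρ x ∈ realAdjoin ρ x := by
  rw [eval₂_eq_sum_range]
  exact sum_mem fun n _ => mul_mem (const_mem_realAdjoin ρ x _)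
    (pow_mem (self_mem_realAdjoin ρ x) n)

end RealAdjoin

section DiscRing

open Filter Metric Topology

/-- Functions which are holomorphic on the disc of radius `R` and real on the real axis. -/
def realHolo (R : ℝ) : Subring (ℂ → ℂ) where
  carrier := {f | DifferentiableOn ℂ f (ball 0 R) ∧
    ∀ x : ℝ, (x : ℂ) ∈ ball (0 : ℂ) R → (f x).im = 0}
  mul_mem' := fun ha hb => ⟨ha.1.mul hb.1, fun x hx => by
    rw [Pi.mul_apply, Complex.mul_im, ha.2 x hx, hb.2 x hx]; simp⟩
  one_mem' := ⟨differentiableOn_const _, fun x _ => by simp⟩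
  add_mem' := fun ha hb => ⟨ha.1.add hb.1, fun x hx => by
    rw [Pi.add_apply, Complex.add_im, ha.2 x hx, hb.2 x hx, add_zero]⟩
  zero_mem' := ⟨differentiableOn_const _, fun x _ => by simp⟩
  neg_mem' := fun ha => ⟨ha.1.neg, fun x hx => by
    rw [Pi.neg_apply, Complex.neg_im, ha.2 x hx, neg_zero]⟩

/-- The ring of restrictions to the disc of radius `R` of the functions in `realHolo R`. -/
def DiscRing (R : ℝ) : Subring (Germ (𝓟 (ball (0 : ℂ) R)) ℂ) :=
  (realHolo R).map (Germ.coeRingHom _)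

namespace DiscRing

variable {R : ℝ}

/-- Restriction to the disc. -/
def mk : realHolo R →+* DiscRing R :=
  ((Germ.coeRingHom _).comp (realHolo R).subtype).codRestrict _ fun f => ⟨f, f.2, rfl⟩

theorem mk_surjective : Function.Surjective (mk : realHolo R →+* DiscRing R) := by
  rintro ⟨_, f, hf, rfl⟩
  exact ⟨⟨f, hf⟩, rfl⟩

theorem mk_eq_mk {f g : realHolo R} : mk f = mk g ↔ Set.EqOn f.1 g.1 (ball 0 R) := by
  rw [Subtype.ext_iff]
  exact Germ.coe_eq.trans eventuallyEq_principal

/-- Composition with a chart. -/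
def comp {ι : Type*} {W : Filter ι} (c : ι → ℂ) (hc : Tendsto c W (𝓟 (ball 0 R))) :
    DiscRing R →+* Germ W ℂ where
  toFun f := f.1.compTendsto c hc
  map_one' := rfl
  map_zero' := rfl
  map_mul' := by
    rintro ⟨f, _⟩ ⟨g, _⟩
    induction f using Germ.inductionOn
    induction g using Germ.inductionOn
    rfl
  map_add' := by
    rintro ⟨f, _⟩ ⟨g, _⟩
    induction f using Germ.inductionOn
    induction g using Germ.inductionOn
    rfl

theorem comp_mk {ι : Type*} {W : Filter ι} (c : ι → ℂ) (hc : Tendsto c W (𝓟 (ball 0 R)))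
    (f : realHolo R) : comp c hc (mk f) = ((f.1 ∘ c : ι → ℂ) : Germ W ℂ) := rfl

theorem eqOn_zero_of_frequently {f : ℂ → ℂ} (hf : DifferentiableOn ℂ f (ball 0 R)) {z₀ : ℂ}
    (hz₀ : z₀ ∈ ball (0 : ℂ) R) (h : ∃ᶠ z in 𝓝[≠] z₀, f z = 0) :
    Set.EqOn f 0 (ball 0 R) :=
  (hf.analyticOnNhd isOpen_ball).eqOn_zero_of_preconnected_of_frequently_eq_zero
    (convex_ball _ _).isPreconnected hz₀ h

theorem comp_injective {ι : Type*} {W : Filter ι} [W.NeBot] {c : ι → ℂ} {z₀ : ℂ}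
    (hz₀ : z₀ ∈ ball (0 : ℂ) R) (hc : Tendsto c W (𝓝[≠] z₀))
    (hc' : Tendsto c W (𝓟 (ball 0 R))) : Function.Injective (comp c hc') := by
  rw [injective_iff_map_eq_zero]
  intro f hf
  obtain ⟨f, rfl⟩ := mk_surjective f
  rw [comp_mk, ← Germ.coe_zero, Germ.coe_eq] at hf
  rw [← map_zero mk, mk_eq_mk]
  exact eqOn_zero_of_frequently f.2.1 hz₀ (hc.frequently hf.frequently)

theorem tendsto_principal {ι : Type*} {W : Filter ι} {c : ι → ℂ} {z₀ : ℂ}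
    (hz₀ : z₀ ∈ ball (0 : ℂ) R) (hc : Tendsto c W (𝓝[≠] z₀)) :
    Tendsto c W (𝓟 (ball 0 R)) :=
  Filter.tendsto_principal.2 ((hc.mono_right nhdsWithin_le_nhds).eventually
    (isOpen_ball.eventually_mem hz₀))

instance [hR : Fact (0 < R)] : IsDomain (DiscRing R) := by
  have h0 : (0 : ℂ) ∈ ball (0 : ℂ) R := mem_ball_self hR.out
  have hle : ((Ultrafilter.of (𝓝[≠] (0 : ℂ)) : Ultrafilter ℂ) : Filter ℂ) ≤ 𝓝[≠] 0 :=
    Ultrafilter.of_le _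
  exact (comp_injective h0 (tendsto_id.mono_left hle)
    (tendsto_principal h0 (tendsto_id.mono_left hle))).isDomain

/-- The field of real meromorphic functions on a disc. -/
abbrev Frac (R : ℝ) : Type := FractionRing (DiscRing R)

/-- The function `f` as an element of the field of meromorphic functions on the disc. -/
noncomputable def toFrac : realHolo R →+* Frac R := (algebraMap _ _).comp mk

theorem toFrac_eq_zero {f : realHolo R} : toFrac f = 0 ↔ Set.EqOn f.1 0 (ball 0 R) := by
  have := mk_eq_mk (f := f) (g := 0)
  rw [map_zero] at this
  exact (map_eq_zero_iff _ (IsFractionRing.injective (DiscRing R) _)).trans this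

variable [hR : Fact (0 < R)]

/-- Real constants as holomorphic functions. -/
def const (R : ℝ) : ℝ →+* realHolo R where
  toFun r := ⟨fun _ => (r : ℂ), differentiableOn_const _, fun _ _ => by simp⟩
  map_one' := by ext; simp
  map_zero' := by ext; simp
  map_mul' _ _ := by ext; simp
  map_add' _ _ := by ext; simp

/-- The coordinate function. -/
def coord (R : ℝ) : realHolo R := ⟨id, differentiableOn_id, fun _ _ => by simp⟩

/-- The field of real rational functions inside the meromorphic functions on the disc. -/
noncomputable def ratSubfield (R : ℝ) [Fact (0 < R)] : Subfield (Frac R) :=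
  realAdjoin (toFrac.comp (const R)) (toFrac (coord R))

/-- Real constants in a ring of germs. -/
def germConst {ι : Type*} (W : Filter ι) : ℝ →+* Germ W ℂ :=
  (Germ.coeRingHom W).comp (Pi.constRingHom ι ℂ |>.comp Complex.ofRealHom)

theorem exists_chart {ι : Type*} (W : Ultrafilter ι) {c : ι → ℂ} {z₀ : ℂ}
    (hz₀ : z₀ ∈ ball (0 : ℂ) R) (hc : Tendsto c W (𝓝[≠] z₀)) :
    ∃ j : Frac R →+* Germ (W : Filter ι) ℂ,
      (∀ f : realHolo R, j (toFrac f) = ((f.1 ∘ c : ι → ℂ) : Germ (W : Filter ι) ℂ)) ∧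
      (ratSubfield R).map j =
        realAdjoin (germConst (W : Filter ι)) (c : Germ (W : Filter ι) ℂ) := by
  have hinj := comp_injective hz₀ hc (tendsto_principal hz₀ hc)
  have hj : ∀ f : realHolo R, IsFractionRing.lift hinj (toFrac f)
      = ((f.1 ∘ c : ι → ℂ) : Germ (W : Filter ι) ℂ) := fun f =>
    IsFractionRing.lift_algebraMap hinj (mk f)
  refine ⟨IsFractionRing.lift hinj, hj, ?_⟩
  rw [ratSubfield, map_realAdjoin, hj]
  congr 1
  ext r
  exact hj _

theorem exists_eq_div (x : Frac R) :
    ∃ f g : realHolo R, toFrac g ≠ 0 ∧ x = toFrac f / toFrac g := by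
  obtain ⟨a, b, hb, rfl⟩ := IsFractionRing.div_surjective (A := DiscRing R) x
  obtain ⟨f, rfl⟩ := mk_surjective a
  obtain ⟨g, rfl⟩ := mk_surjective b
  refine ⟨f, g, ?_, rfl⟩
  exact (map_ne_zero_iff _ (IsFractionRing.injective (DiscRing R) _)).2 (nonZeroDivisors.ne_zero hb)

end DiscRing

end DiscRing

section Rationality

open Filter Metric Topology DiscRing

theorem finite_zeros_closedBall {f : ℂ → ℂ} {r R : ℝ} (hr : r < R)
    (hf : DifferentiableOn ℂ f (ball 0 R)) (h0 : ¬ Set.EqOn f 0 (ball 0 R)) :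
    {z | z ∈ closedBall (0 : ℂ) r ∧ f z = 0}.Finite := by
  by_contra hinf
  obtain ⟨z, hz, hacc⟩ := Set.Infinite.exists_accPt_of_subset_isCompact hinf
    (isCompact_closedBall (0 : ℂ) r) (fun z hz => hz.1)
  refine h0 (eqOn_zero_of_frequently hf (closedBall_subset_ball hr hz) ?_)
  rw [accPt_iff_frequently_nhdsNE] at hacc
  exact hacc.mono fun y hy => hy.2

theorem exists_eq_pow_mul {f : ℂ → ℂ} {R : ℝ} (hf : DifferentiableOn ℂ f (ball 0 R))
    (h0 : ¬ Set.EqOn f 0 (ball 0 R)) {z₀ : ℂ} (hz₀ : z₀ ∈ ball (0 : ℂ) R) :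
    ∃ (n : ℕ) (g : ℂ → ℂ), DifferentiableOn ℂ g (ball 0 R) ∧ g z₀ ≠ 0 ∧
      ∀ z, z ≠ z₀ ∨ z ∈ ball (0 : ℂ) R → f z = (z - z₀) ^ n * g z := by
  have hev : ¬ ∀ᶠ z in 𝓝 z₀, f z = 0 := fun h =>
    h0 (eqOn_zero_of_frequently hf hz₀ (h.filter_mono nhdsWithin_le_nhds).frequently)
  obtain ⟨n, g, hg, hg0, hfg⟩ := ((hf.analyticOnNhd isOpen_ball) z₀
    hz₀).exists_eventuallyEq_pow_smul_nonzero_iff.2 hev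
  refine ⟨n, fun z => if z = z₀ then g z₀ else f z / (z - z₀) ^ n, ?_, by simpa using hg0, ?_⟩
  · intro z hz
    refine DifferentiableAt.differentiableWithinAt ?_
    rcases eq_or_ne z z₀ with rfl | hne
    · refine hg.differentiableAt.congr_of_eventuallyEq ?_
      filter_upwards [hfg] with w hw
      by_cases hwz : w = z
      · simp [hwz]
      · rw [if_neg hwz, hw, smul_eq_mul, mul_div_cancel_left₀]
        exact pow_ne_zero _ (sub_ne_zero.2 hwz)
    · have hd : DifferentiableAt ℂ (fun z => f z / (z - z₀) ^ n) z :=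
        (hf.differentiableAt (isOpen_ball.mem_nhds hz)).div (by fun_prop)
          (pow_ne_zero _ (sub_ne_zero.2 hne))
      refine hd.congr_of_eventuallyEq ?_
      filter_upwards [isOpen_ne.mem_nhds hne] with w hw
      rw [if_neg hw]
  · intro z hz
    by_cases hzz : z = z₀
    · subst hzz
      simpa using hfg.self_of_nhds
    · simp only [if_neg hzz]
      rw [mul_div_cancel₀]
      exact pow_ne_zero _ (sub_ne_zero.2 hzz)

theorem exists_polynomial_mul_eq {r R : ℝ} (hr : r < R) (n : ℕ) : ∀ f : ℂ → ℂ,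
    DifferentiableOn ℂ f (ball 0 R) → ¬ Set.EqOn f 0 (ball 0 R) →
    {z | z ∈ closedBall (0 : ℂ) r ∧ f z = 0}.ncard = n →
    ∃ (p : ℂ[X]) (u : ℂ → ℂ), p ≠ 0 ∧ DifferentiableOn ℂ u (ball 0 R) ∧
      (∀ z ∈ closedBall (0 : ℂ) r, u z ≠ 0) ∧ Set.EqOn f (fun z => p.eval z * u z) (ball 0 R) := by
  induction n using Nat.strong_induction_on with
  | _ n ih =>
  intro f hf h0 hcard
  have hfin := finite_zeros_closedBall hr hf h0
  by_cases hz : ∃ z₀ ∈ closedBall (0 : ℂ) r, f z₀ = 0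
  · obtain ⟨z₀, hz₀, hfz₀⟩ := hz
    have hz₀' := closedBall_subset_ball hr hz₀
    obtain ⟨m, g, hg, hg0, hfg⟩ := exists_eq_pow_mul hf h0 hz₀'
    have hsub : {z | z ∈ closedBall (0 : ℂ) r ∧ g z = 0} ⊂
        {z | z ∈ closedBall (0 : ℂ) r ∧ f z = 0} := by
      refine ⟨fun z hz => ⟨hz.1, ?_⟩, fun hle => hg0 (hle ⟨hz₀, hfz₀⟩).2⟩
      rw [hfg z (Or.inr (closedBall_subset_ball hr hz.1)), hz.2, mul_zero]
    obtain ⟨p, u, hp, hu, hu0, hgu⟩ := ih _ (hcard ▸ Set.ncard_lt_ncard hsub hfin) g hg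
      (fun h => hg0 (h hz₀')) rfl
    refine ⟨(X - C z₀) ^ m * p, u, mul_ne_zero (pow_ne_zero _ (X_sub_C_ne_zero _)) hp, hu, hu0,
      fun z hz => ?_⟩
    rw [hfg z (Or.inr hz), hgu hz]
    simp [mul_assoc]
  · push Not at hz
    exact ⟨1, f, one_ne_zero, hf, hz, fun z _ => by simp⟩

theorem exists_polynomial_of_growth {h : ℂ → ℂ} (hh : Differentiable ℂ h) {C : ℝ} {N : ℕ}
    (hb : ∀ z, 1 ≤ ‖z‖ → ‖h z‖ ≤ C * ‖z‖ ^ N) : ∃ P : ℂ[X], ∀ z, h z = P.eval z := by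
  have hzero : ∀ n, N < n → iteratedDeriv n h 0 = 0 := by
    intro n hn
    have hle : ∀ r : ℝ, 1 ≤ r → ‖iteratedDeriv n h 0‖ ≤ n.factorial * C * r⁻¹ := by
      intro r hr
      have h0 : 0 < r := by linarith
      have := Complex.norm_iteratedDeriv_le_of_forall_mem_sphere_norm_le (c := 0) n h0
        hh.diffContOnCl (C := C * r ^ N) (fun z hz => by
          rw [mem_sphere_zero_iff_norm] at hz
          rw [← hz]; exact hb z (hz ▸ hr))
      have hC : 0 ≤ C := by
        have := hb 1 (by simp)
        simp only [norm_one, one_pow, mul_one] at this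
        exact (norm_nonneg _).trans this
      refine this.trans ?_
      rw [mul_div_assoc, mul_div_assoc, mul_assoc]
      gcongr
      rw [div_le_iff₀ (by positivity), inv_mul_eq_div, le_div_iff₀ h0, ← pow_succ]
      exact pow_le_pow_right₀ hr hn
    have ht : Tendsto (fun r : ℝ => n.factorial * C * r⁻¹) atTop (𝓝 (n.factorial * C * 0)) :=
      tendsto_inv_atTop_zero.const_mul _
    rw [mul_zero] at ht
    exact norm_le_zero_iff.1 (ge_of_tendsto ht ((eventually_ge_atTop 1).mono hle))
  refine ⟨∑ n ∈ Finset.range (N + 1),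
      Polynomial.C ((n.factorial : ℂ)⁻¹ * iteratedDeriv n h 0) * X ^ n,
    fun z => ?_⟩
  have hs := Complex.hasSum_taylorSeries_of_entire hh 0 z
  have hs' := hasSum_sum_of_ne_finset_zero (L := .unconditional ℕ) (f := fun n : ℕ =>
    (n.factorial : ℂ)⁻¹ • (z - 0) ^ n • iteratedDeriv n h 0) (s := Finset.range (N + 1))
    (fun n hn => by
      rw [hzero n (by simpa using hn)]; simp)
  rw [hs.unique hs', eval_finsetSum]
  refine Finset.sum_congr rfl fun n _ => ?_
  simp only [smul_eq_mul, sub_zero, eval_mul, eval_C, eval_pow, eval_X]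
  ring

theorem isPreconnected_annulus : IsPreconnected {z : ℂ | 2⁻¹ < ‖z‖ ∧ ‖z‖ < 2} := by
  have : {z : ℂ | 2⁻¹ < ‖z‖ ∧ ‖z‖ < 2} =
      Complex.exp '' (Complex.re ⁻¹' Set.Ioo (Real.log 2⁻¹) (Real.log 2)) := by
    ext z
    constructor
    · rintro ⟨h1, h2⟩
      have hz : 0 < ‖z‖ := lt_trans (by norm_num) h1
      refine ⟨Complex.log z, ?_, Complex.exp_log (norm_pos_iff.1 hz)⟩
      rw [Set.mem_preimage, Complex.log_re]
      exact ⟨Real.log_lt_log (by norm_num) h1, Real.log_lt_log hz h2⟩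
    · rintro ⟨w, ⟨h1, h2⟩, rfl⟩
      rw [Set.mem_ofPred_eq, Complex.norm_exp, ← Real.log_lt_iff_lt_exp (by norm_num),
        ← Real.lt_log_iff_exp_lt (by norm_num)]
      exact ⟨h1, h2⟩
  rw [this]
  exact ((convex_Ioo _ _).linear_preimage Complex.reLm).isPreconnected.image _
    Complex.continuous_exp.continuousOn

theorem norm_eval_le_of_one_le (p : ℂ[X]) : ∃ C : ℝ, ∀ z : ℂ, 1 ≤ ‖z‖ →
    ‖p.eval z‖ ≤ C * ‖z‖ ^ p.natDegree := by
  refine ⟨∑ i ∈ Finset.range (p.natDegree + 1), ‖p.coeff i‖, fun z hz => ?_⟩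
  rw [eval_eq_sum_range, Finset.sum_mul]
  refine (norm_sum_le _ _).trans (Finset.sum_le_sum fun i hi => ?_)
  rw [norm_mul, norm_pow]
  gcongr
  exact Nat.lt_succ_iff.1 (Finset.mem_range.1 hi)

theorem eval_reverse_of_ne_zero (q : ℂ[X]) {z : ℂ} (hz : z ≠ 0) :
    q.reverse.eval z = z ^ q.natDegree * q.eval z⁻¹ := by
  let : Invertible z⁻¹ := ⟨z, mul_inv_cancel₀ hz, inv_mul_cancel₀ hz⟩
  have : q.reverse.eval z * z⁻¹ ^ q.natDegree = q.eval z⁻¹ :=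
    eval₂_reverse_mul_pow (RingHom.id ℂ) z⁻¹ q
  rw [← this, inv_pow]
  field_simp

/-- A meromorphic function on the disc `|z| < 2` which is also meromorphic on `|z| > 1 / 2`
(including infinity) is rational. -/
theorem exists_rational_of_meromorphic {f₁ f₂ g₁ g₂ : ℂ → ℂ}
    (hf₁ : DifferentiableOn ℂ f₁ (ball 0 2)) (hf₂ : DifferentiableOn ℂ f₂ (ball 0 2))
    (hg₁ : DifferentiableOn ℂ g₁ (ball 0 2)) (hg₂ : DifferentiableOn ℂ g₂ (ball 0 2))
    (hf₂0 : ¬ Set.EqOn f₂ 0 (ball 0 2)) (hg₂0 : ¬ Set.EqOn g₂ 0 (ball 0 2))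
    (h : ∃ᶠ z in 𝓝[≠] (1 : ℂ), f₁ z * g₂ z⁻¹ - g₁ z⁻¹ * f₂ z = 0) :
    ∃ P D : ℂ[X], D ≠ 0 ∧ ∀ z ∈ ball (0 : ℂ) 2, f₁ z * D.eval z = f₂ z * P.eval z := by
  obtain ⟨p, u, hp, hu, hu0, hpu⟩ :=
    exists_polynomial_mul_eq (by norm_num : (3 / 2 : ℝ) < 2) _ f₂ hf₂ hf₂0 rfl
  obtain ⟨q, v, hq, hv, hv0, hqv⟩ :=
    exists_polynomial_mul_eq (by norm_num : (3 / 2 : ℝ) < 2) _ g₂ hg₂ hg₂0 rfl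
  have hopen : IsOpen {z : ℂ | 2⁻¹ < ‖z‖ ∧ ‖z‖ < 2} :=
    (isOpen_lt continuous_const continuous_norm).inter (isOpen_lt continuous_norm continuous_const)
  have hinv : Set.MapsTo (fun z : ℂ => z⁻¹) {z : ℂ | 2⁻¹ < ‖z‖} (ball 0 2) := by
    intro z hz
    rw [mem_ball_zero_iff, norm_inv]
    exact inv_lt_of_inv_lt₀ (by norm_num) hz
  have hdinv : DifferentiableOn ℂ (fun z : ℂ => z⁻¹) {z : ℂ | 2⁻¹ < ‖z‖} :=
    differentiableOn_inv.mono fun z hz h0 => by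
      rw [Set.mem_ofPred_eq, h0, norm_zero] at hz; norm_num at hz
  have hann : ∀ z : ℂ, 2⁻¹ < ‖z‖ → ‖z‖ < 2 → f₁ z * g₂ z⁻¹ = g₁ z⁻¹ * f₂ z := by
    have hd : DifferentiableOn ℂ (fun z => f₁ z * g₂ z⁻¹ - g₁ z⁻¹ * f₂ z)
        {z : ℂ | 2⁻¹ < ‖z‖ ∧ ‖z‖ < 2} := by
      have hs1 : {z : ℂ | 2⁻¹ < ‖z‖ ∧ ‖z‖ < 2} ⊆ ball 0 2 := fun z hz => by
        rw [mem_ball_zero_iff]; exact hz.2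
      have hs2 : {z : ℂ | 2⁻¹ < ‖z‖ ∧ ‖z‖ < 2} ⊆ {z : ℂ | 2⁻¹ < ‖z‖} := fun z hz => hz.1
      exact ((hf₁.mono hs1).mul ((hg₂.comp hdinv hinv).mono hs2)).sub
        (((hg₁.comp hdinv hinv).mono hs2).mul (hf₂.mono hs1))
    have := (hd.analyticOnNhd hopen).eqOn_zero_of_preconnected_of_frequently_eq_zero
      isPreconnected_annulus (z₀ := 1) (by norm_num [Set.mem_ofPred_eq]) h
    exact fun z h1 h2 => sub_eq_zero.1 (this ⟨h1, h2⟩)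
  let A : ℂ → ℂ := fun z => f₁ z * q.reverse.eval z / u z
  let B : ℂ → ℂ := fun z => z ^ q.natDegree * p.eval z * (g₁ z⁻¹ / v z⁻¹)
  have hAB : ∀ z : ℂ, 2 / 3 < ‖z‖ → ‖z‖ < 3 / 2 → A z = B z := by
    intro z h1 h2
    have hz0 : z ≠ 0 := fun h => by rw [h, norm_zero] at h1; norm_num at h1
    have hzi : ‖z⁻¹‖ < 3 / 2 := by
      rw [norm_inv]; exact inv_lt_of_inv_lt₀ (by norm_num) (by norm_num; linarith)
    have huz : u z ≠ 0 := hu0 z (by rw [mem_closedBall_zero_iff]; exact h2.le)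
    have hvz : v z⁻¹ ≠ 0 := hv0 z⁻¹ (by rw [mem_closedBall_zero_iff]; exact hzi.le)
    have := hann z (by linarith) (by linarith)
    rw [hpu (by rw [mem_ball_zero_iff]; linarith),
      hqv (by rw [mem_ball_zero_iff]; linarith)] at this
    simp only [A, B]
    rw [eval_reverse_of_ne_zero q hz0, mul_div_assoc', div_eq_div_iff huz hvz]
    linear_combination z ^ q.natDegree * this
  have hdA : ∀ z : ℂ, ‖z‖ < 3 / 2 → DifferentiableAt ℂ A z := fun z hz =>
    ((hf₁.differentiableAt (isOpen_ball.mem_nhds (by rw [mem_ball_zero_iff]; linarith))).mul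
      (by fun_prop)).div (hu.differentiableAt (isOpen_ball.mem_nhds
        (by rw [mem_ball_zero_iff]; linarith)))
        (hu0 z (by rw [mem_closedBall_zero_iff]; exact hz.le))
  have hdiv : ∀ w : ℂ, ‖w‖ < 3 / 2 → DifferentiableAt ℂ (fun w => g₁ w / v w) w := fun w hw =>
    (hg₁.differentiableAt (isOpen_ball.mem_nhds (by rw [mem_ball_zero_iff]; linarith))).div
      (hv.differentiableAt (isOpen_ball.mem_nhds (by rw [mem_ball_zero_iff]; linarith)))
      (hv0 w (by rw [mem_closedBall_zero_iff]; exact hw.le))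
  have hdB : ∀ z : ℂ, 2 / 3 < ‖z‖ → DifferentiableAt ℂ B z := fun z hz => by
    have hz0 : z ≠ 0 := fun h => by rw [h, norm_zero] at hz; norm_num at hz
    have hzi : ‖z⁻¹‖ < 3 / 2 := by
      rw [norm_inv]; exact inv_lt_of_inv_lt₀ (by norm_num) (by norm_num; linarith)
    have : DifferentiableAt ℂ (fun z : ℂ => g₁ z⁻¹ / v z⁻¹) z :=
      DifferentiableAt.comp z (hdiv z⁻¹ hzi) (differentiableAt_inv hz0)
    exact DifferentiableAt.mul (by fun_prop) this
  let E : ℂ → ℂ := fun z => if ‖z‖ < 1 then A z else B z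
  have hEA : ∀ z : ℂ, ‖z‖ < 3 / 2 → E z = A z := fun z hz => by
    by_cases h1 : ‖z‖ < 1
    · simp only [E, if_pos h1]
    · simp only [E, if_neg h1]
      exact (hAB z (by linarith) hz).symm
  have hEB : ∀ z : ℂ, 2 / 3 < ‖z‖ → E z = B z := fun z hz => by
    by_cases h1 : ‖z‖ < 1
    · simp only [E, if_pos h1]
      exact hAB z hz (by linarith)
    · simp only [E, if_neg h1]
  have hE : Differentiable ℂ E := by
    intro z
    by_cases hz : ‖z‖ < 3 / 2
    · refine (hdA z hz).congr_of_eventuallyEq ?_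
      filter_upwards [(isOpen_lt continuous_norm continuous_const).mem_nhds hz] with w hw
      exact hEA w hw
    · have hz' : 2 / 3 < ‖z‖ := by linarith
      refine (hdB z hz').congr_of_eventuallyEq ?_
      filter_upwards [(isOpen_lt continuous_const continuous_norm).mem_nhds hz'] with w hw
      exact hEB w hw
  obtain ⟨C₁, hC₁⟩ := norm_eval_le_of_one_le p
  obtain ⟨C₂, hC₂⟩ := (isCompact_closedBall (0 : ℂ) 1).exists_bound_of_continuousOn
    (f := fun w => g₁ w / v w) (fun w hw => (hdiv w (by
      rw [mem_closedBall_zero_iff] at hw; linarith)).continuousAt.continuousWithinAt)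
  obtain ⟨P, hP⟩ := exists_polynomial_of_growth hE (C := C₁ * C₂)
    (N := q.natDegree + p.natDegree) (fun z hz => by
      rw [hEB z (by linarith), norm_mul, norm_mul, norm_pow, pow_add]
      have h1 := hC₁ z hz
      have h2 := hC₂ z⁻¹ (by
        rw [mem_closedBall_zero_iff, norm_inv]; exact inv_le_one_of_one_le₀ hz)
      have h3 : 0 ≤ C₁ * ‖z‖ ^ p.natDegree := (norm_nonneg _).trans h1
      calc _ ≤ ‖z‖ ^ q.natDegree * (C₁ * ‖z‖ ^ p.natDegree) * C₂ := by gcongr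
        _ = _ := by ring)
  refine ⟨P, q.reverse * p, mul_ne_zero (by rwa [Ne, reverse_eq_zero]) hp, ?_⟩
  have hd : DifferentiableOn ℂ (fun z => f₁ z * (q.reverse * p).eval z - f₂ z * P.eval z)
      (ball 0 2) :=
    (hf₁.mul (q.reverse * p).differentiable.differentiableOn).sub
      (hf₂.mul P.differentiable.differentiableOn)
  have := eqOn_zero_of_frequently hd (z₀ := 0) (by simp) (by
    refine Eventually.frequently (Eventually.filter_mono nhdsWithin_le_nhds ?_)
    filter_upwards [ball_mem_nhds (0 : ℂ) (by norm_num : (0 : ℝ) < 3 / 2)] with z hz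
    rw [mem_ball_zero_iff] at hz
    have h1 := hP z
    have huz : u z ≠ 0 := hu0 z (by rw [mem_closedBall_zero_iff]; exact hz.le)
    rw [hEA z hz, div_eq_iff huz] at h1
    rw [hpu (by rw [mem_ball_zero_iff]; linarith), eval_mul]
    linear_combination p.eval z * h1)
  exact fun z hz => sub_eq_zero.1 (this hz)

end Rationality

section RealRationality

open Filter Metric Topology DiscRing

theorem Polynomial.exists_eq_map_add_I_mul (D : ℂ[X]) : ∃ A B : ℝ[X],
    D = A.map Complex.ofRealHom + C Complex.I * B.map Complex.ofRealHom := by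
  induction D using Polynomial.induction_on' with
  | add p q hp hq =>
    obtain ⟨A, B, rfl⟩ := hp
    obtain ⟨A', B', rfl⟩ := hq
    refine ⟨A + A', B + B', ?_⟩
    simp only [Polynomial.map_add]
    ring
  | monomial n a =>
    refine ⟨monomial n a.re, monomial n a.im, ?_⟩
    rw [map_monomial, map_monomial, C_mul_monomial, ← map_add]
    congr 1
    simp [mul_comm Complex.I]

theorem frequently_real_nhdsNE (x : ℝ) {s : Set ℂ} (hs : s ∈ 𝓝 (x : ℂ)) :
    ∃ᶠ z in 𝓝[≠] (x : ℂ), z ∈ s ∧ ∃ y : ℝ, z = y := by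
  have ht : Tendsto (fun y : ℝ => (y : ℂ)) (𝓝[≠] x) (𝓝[≠] (x : ℂ)) := by
    refine tendsto_nhdsWithin_iff.2 ⟨(Complex.continuous_ofReal.tendsto x).mono_left
      nhdsWithin_le_nhds, ?_⟩
    filter_upwards [self_mem_nhdsWithin] with y hy h
    exact hy (Complex.ofReal_injective h)
  refine ht.frequently (Eventually.frequently ?_)
  exact ((ht.mono_right nhdsWithin_le_nhds).eventually hs).mono fun y hy => ⟨hy, y, rfl⟩

theorem eqOn_zero_of_real {R : ℝ} (hR : 0 < R) {f : ℂ → ℂ}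
    (hf : DifferentiableOn ℂ f (ball 0 R)) (h : ∀ x : ℝ, (x : ℂ) ∈ ball (0 : ℂ) R → f x = 0) :
    Set.EqOn f 0 (ball 0 R) := by
  have h0 : ((0 : ℝ) : ℂ) ∈ ball (0 : ℂ) R := by simpa using hR
  refine eqOn_zero_of_frequently hf h0 ?_
  refine (frequently_real_nhdsNE 0 (isOpen_ball.mem_nhds h0)).mono ?_
  rintro z ⟨hz, y, rfl⟩
  exact h y hz

theorem eval_map_ofReal_im (A : ℝ[X]) (x : ℝ) :
    ((A.map Complex.ofRealHom).eval (x : ℂ)).im = 0 := by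
  rw [eval_map, ← Complex.ofRealHom_eq_coe, eval₂_at_apply]
  simp

/-- A real polynomial as a holomorphic function. -/
noncomputable def polyHolo (R : ℝ) (A : ℝ[X]) : realHolo R :=
  ⟨fun z => (A.map Complex.ofRealHom).eval z, (Polynomial.differentiable _).differentiableOn,
    fun x _ => eval_map_ofReal_im A x⟩

theorem polyHolo_eq (R : ℝ) (A : ℝ[X]) : polyHolo R A = A.eval₂ (const R) (coord R) := by
  apply Subtype.ext
  funext z
  have : (A.eval₂ (const R) (coord R) : realHolo R).1 z =
      ((Pi.evalRingHom (fun _ : ℂ => ℂ) z).comp (realHolo R).subtype)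
        (A.eval₂ (const R) (coord R)) := rfl
  rw [this, hom_eval₂]
  exact eval_map _ _

theorem toFrac_polyHolo_mem {R : ℝ} [Fact (0 < R)] (A : ℝ[X]) :
    toFrac (polyHolo R A) ∈ ratSubfield R := by
  rw [polyHolo_eq, hom_eval₂]
  exact eval₂_mem_realAdjoin _ _ _

theorem toFrac_polyHolo_ne_zero {R : ℝ} [hR : Fact (0 < R)] {A : ℝ[X]} (hA : A ≠ 0) :
    toFrac (polyHolo R A) ≠ 0 := by
  rw [Ne, toFrac_eq_zero]
  intro h
  have hA' : A.map Complex.ofRealHom ≠ 0 :=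
    (Polynomial.map_ne_zero_iff Complex.ofRealHom.injective).2 hA
  refine hA' (Polynomial.eq_zero_of_infinite_isRoot _ (Set.Infinite.mono (s := ball (0 : ℂ) R)
    (fun z hz => h hz) ?_))
  exact infinite_of_mem_nhds (0 : ℂ) (ball_mem_nhds _ hR.out)

theorem mem_ratSubfield_of_mul_eq {R : ℝ} [hR : Fact (0 < R)] {f₁ f₂ : realHolo R}
    (hf₂ : toFrac f₂ ≠ 0) {P D : ℂ[X]} (hD : D ≠ 0)
    (h : ∀ z ∈ ball (0 : ℂ) R, f₁.1 z * D.eval z = f₂.1 z * P.eval z) :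
    toFrac f₁ / toFrac f₂ ∈ ratSubfield R := by
  obtain ⟨A, B, rfl⟩ := D.exists_eq_map_add_I_mul
  obtain ⟨A', B', rfl⟩ := P.exists_eq_map_add_I_mul
  have key : ∀ a a' : ℝ[X], a ≠ 0 → (∀ x : ℝ, (x : ℂ) ∈ ball (0 : ℂ) R →
      f₁.1 x * (polyHolo R a).1 x = f₂.1 x * (polyHolo R a').1 x) →
      toFrac f₁ / toFrac f₂ ∈ ratSubfield R := by
    intro a a' ha hx
    have h1 : toFrac (f₁ * polyHolo R a - f₂ * polyHolo R a') = 0 :=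
      toFrac_eq_zero.2 (eqOn_zero_of_real hR.out (f₁ * polyHolo R a - f₂ * polyHolo R a').2.1
        fun x hxR => sub_eq_zero.2 (hx x hxR))
    rw [map_sub, map_mul, map_mul, sub_eq_zero] at h1
    have ha0 := toFrac_polyHolo_ne_zero (R := R) ha
    have : toFrac f₁ / toFrac f₂ = toFrac (polyHolo R a') / toFrac (polyHolo R a) := by
      rw [div_eq_div_iff hf₂ ha0, h1, mul_comm]
    rw [this]
    exact div_mem (toFrac_polyHolo_mem _) (toFrac_polyHolo_mem _)
  have hparts : ∀ x : ℝ, (x : ℂ) ∈ ball (0 : ℂ) R →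
      f₁.1 x * (polyHolo R A).1 x = f₂.1 x * (polyHolo R A').1 x ∧
      f₁.1 x * (polyHolo R B).1 x = f₂.1 x * (polyHolo R B').1 x := by
    intro x hx
    have h1 := f₁.2.2 x hx
    have h2 := f₂.2.2 x hx
    have hA := (polyHolo R A).2.2 x hx
    have hB := (polyHolo R B).2.2 x hx
    have hA' := (polyHolo R A').2.2 x hx
    have hB' := (polyHolo R B').2.2 x hx
    have h3 : f₁.1 x * ((polyHolo R A).1 x + Complex.I * (polyHolo R B).1 x)
        = f₂.1 x * ((polyHolo R A').1 x + Complex.I * (polyHolo R B').1 x) := by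
      have := h x hx
      simpa [polyHolo] using this
    have h4 := congrArg Complex.re h3
    have h5 := congrArg Complex.im h3
    simp only [Complex.mul_re, Complex.mul_im, Complex.add_re, Complex.add_im, Complex.I_re,
      Complex.I_im, h1, h2, hA, hB, hA', hB'] at h4 h5
    constructor
    · apply Complex.ext
      · simp only [Complex.mul_re, h1, h2]; linarith
      · simp only [Complex.mul_im, h1, h2, hA, hA']; simp
    · apply Complex.ext
      · simp only [Complex.mul_re, h1, h2]; linarith
      · simp only [Complex.mul_im, h1, h2, hB, hB']; simp
  by_cases hA : A = 0
  · have hB : B ≠ 0 := by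
      rintro rfl
      exact hD (by simp [hA])
    exact key B B' hB fun x hx => (hparts x hx).2
  · exact key A A' hA fun x hx => (hparts x hx).1

instance : Fact ((0 : ℝ) < 2) := ⟨by norm_num⟩

/-- Meromorphic functions on `|z| < 2` and on `|z| > 1 / 2` have only the rational functions in
common. -/
theorem fieldRange_inf_fieldRange {W : Ultrafilter ℂ} (hW : (W : Filter ℂ) ≤ 𝓝[≠] 1)
    {j₁ j₂ : Frac 2 →+* Germ (W : Filter ℂ) ℂ}
    (hj₁ : ∀ f : realHolo 2, j₁ (toFrac f) = (f.1 : Germ (W : Filter ℂ) ℂ))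
    (hj₂ : ∀ f : realHolo 2, j₂ (toFrac f) =
      ((f.1 ∘ fun z : ℂ => z⁻¹ : ℂ → ℂ) : Germ (W : Filter ℂ) ℂ)) :
    j₁.fieldRange ⊓ j₂.fieldRange ≤ (ratSubfield 2).map j₁ := by
  rintro _ ⟨⟨x, rfl⟩, ⟨y, hy⟩⟩
  refine ⟨x, ?_, rfl⟩
  obtain ⟨f₁, f₂, hf₂, rfl⟩ := exists_eq_div x
  obtain ⟨g₁, g₂, hg₂, rfl⟩ := exists_eq_div y
  have hf₂' := (map_ne_zero_iff j₁ j₁.injective).2 hf₂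
  have hg₂' := (map_ne_zero_iff j₂ j₂.injective).2 hg₂
  rw [map_div₀, map_div₀, div_eq_div_iff hg₂' hf₂', hj₁, hj₁, hj₂, hj₂, ← Germ.coe_mul,
    ← Germ.coe_mul, Germ.coe_eq] at hy
  obtain ⟨P, D, hD, hPD⟩ := exists_rational_of_meromorphic f₁.2.1 f₂.2.1 g₁.2.1 g₂.2.1
    (fun h => hf₂ (toFrac_eq_zero.2 h)) (fun h => hg₂ (toFrac_eq_zero.2 h))
    ((hy.mono fun z hz => by
      have : g₁.1 z⁻¹ * f₂.1 z = f₁.1 z * g₂.1 z⁻¹ := hz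
      rw [this, sub_self]).frequently.filter_mono hW)
  exact mem_ratSubfield_of_mul_eq hf₂ hD hPD

end RealRationality

section PowerSeriesHolo

open Filter Metric Topology DiscRing

theorem summable_ofReal_mul_pow {a : ℕ → ℝ} {r : ℝ} (ha : Summable fun n => |a n| * r ^ n) {z : ℂ}
    (hz : ‖z‖ ≤ r) : Summable fun n => (a n : ℂ) * z ^ n := by
  refine Summable.of_norm_bounded ha fun n => ?_
  rw [norm_mul, norm_pow, Complex.norm_real, Real.norm_eq_abs]
  gcongr

theorem tsum_mem_realHolo {a : ℕ → ℝ} {r : ℝ} (ha : Summable fun n => |a n| * r ^ n) :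
    (fun z : ℂ => ∑' n, (a n : ℂ) * z ^ n) ∈ realHolo r := by
  refine ⟨Complex.differentiableOn_tsum_of_summable_norm ha (fun n => by fun_prop) isOpen_ball
    fun n z hz => ?_, fun x hx => ?_⟩
  · rw [mem_ball_zero_iff] at hz
    rw [norm_mul, norm_pow, Complex.norm_real, Real.norm_eq_abs]
    gcongr
  · have : ∀ n, (a n : ℂ) * (x : ℂ) ^ n = ((a n * x ^ n : ℝ) : ℂ) := fun n => by push_cast; rfl
    simp only [this, ← Complex.ofReal_tsum, Complex.ofReal_im]

theorem exists_real_power_series {R r : ℝ} (hr : 0 < r) (hrR : r < R) (f : realHolo R) :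
    ∃ a : ℕ → ℝ, (Summable fun n => |a n| * r ^ n) ∧
      ∀ z : ℂ, ‖z‖ < r → f.1 z = ∑' n, (a n : ℂ) * z ^ n := by
  set c : ℕ → ℂ := fun n => (n.factorial : ℂ)⁻¹ * iteratedDeriv n f.1 0 with hc
  have hsum : ∀ z : ℂ, ‖z‖ < R → HasSum (fun n => c n * z ^ n) (f.1 z) := fun z hz => by
    have := Complex.hasSum_taylorSeries_on_ball f.2.1 (mem_ball_zero_iff.2 hz)
    have he : (fun n => c n * z ^ n)
        = fun n : ℕ => (n.factorial : ℂ)⁻¹ • (z - 0) ^ n • iteratedDeriv n f.1 0 := by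
      funext n
      simp only [hc, sub_zero, smul_eq_mul]
      ring
    rw [he]
    exact this
  have hcs : Summable fun n => |(c n).re| * r ^ n := by
    have hn : ‖(r : ℂ)‖ = r := by rw [Complex.norm_real, Real.norm_eq_abs, abs_of_pos hr]
    have := (hsum (r : ℂ) (hn.symm ▸ hrR)).summable.norm
    refine Summable.of_nonneg_of_le (fun n => by positivity) (fun n => ?_) this
    rw [norm_mul, norm_pow, hn]
    gcongr
    exact Complex.abs_re_le_norm _
  refine ⟨fun n => (c n).re, hcs, fun z hz => ?_⟩
  have hsub : ball (0 : ℂ) r ⊆ ball 0 R := ball_subset_ball hrR.le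
  have key := eqOn_zero_of_real hr (f := fun z => f.1 z - ∑' n, ((c n).re : ℂ) * z ^ n)
    ((f.2.1.mono hsub).sub (tsum_mem_realHolo hcs).1) (fun x hx => by
      have h1 := Complex.hasSum_re (hsum (x : ℂ) (mem_ball_zero_iff.1 (hsub hx)))
      have h2 : ∀ n, (c n * (x : ℂ) ^ n).re = (c n).re * x ^ n := fun n => by
        rw [← Complex.ofReal_pow, Complex.re_mul_ofReal]
      simp only [h2] at h1
      have h3 : f.1 x = ((f.1 x).re : ℂ) :=
        Complex.ext rfl (by simpa using f.2.2 x (hsub hx))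
      rw [sub_eq_zero, h3, ← h1.tsum_eq, Complex.ofReal_tsum]
      push_cast
      rfl)
  exact sub_eq_zero.1 (key (mem_ball_zero_iff.2 hz))

/-- After rescaling the variable, a holomorphic function is a small perturbation of a constant. -/
theorem exists_small_power_series {R : ℝ} (hR : 0 < R) (f : realHolo R) {δ : ℝ} (hδ : 0 < δ) :
    ∃ l₀ > 0, ∀ l : ℝ, 0 < l → l ≤ l₀ → ∃ a : ℕ → ℝ, (Summable fun n => |a n| * 3 ^ n) ∧
      ∑' n, |a n| * 3 ^ n ≤ δ ∧
        ∀ z : ℂ, ‖z‖ ≤ 2 → f.1 (l * z) = f.1 0 + ∑' n, (a n : ℂ) * z ^ n := by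
  obtain ⟨b, hb, hfb⟩ := exists_real_power_series (half_pos hR) (half_lt_self hR) f
  set r := R / 2 with hr
  have hr0 : 0 < r := half_pos hR
  set S := ∑' n, |b n| * r ^ n with hS
  have hS0 : 0 ≤ S := tsum_nonneg fun n => by positivity
  refine ⟨min (r / 3) (δ * r / (3 * (S + 1))), by positivity, fun l hl hle => ?_⟩
  have h1 : 3 * l ≤ r := by have := hle.trans (min_le_left _ _); linarith
  have h2 : 3 * l * (S + 1) ≤ δ * r := by
    have := hle.trans (min_le_right _ _)
    rw [le_div_iff₀ (by positivity)] at this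
    linarith
  let a : ℕ → ℝ := fun n => if n = 0 then 0 else b n * l ^ n
  have hbound : ∀ n, |a n| * 3 ^ n ≤ 3 * l / r * (|b n| * r ^ n) := by
    intro n
    rcases n with _ | n
    · simp only [a, if_true, abs_zero, zero_mul]; positivity
    · simp only [a, if_neg (Nat.succ_ne_zero n), abs_mul, abs_pow, abs_of_pos hl]
      have : (3 * l) ^ n ≤ r ^ n := pow_le_pow_left₀ (by positivity) h1 n
      calc |b (n + 1)| * l ^ (n + 1) * 3 ^ (n + 1) = |b (n + 1)| * (3 * l) * (3 * l) ^ n := by ring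
        _ ≤ |b (n + 1)| * (3 * l) * r ^ n := by gcongr
        _ = 3 * l / r * (|b (n + 1)| * r ^ (n + 1)) := by field_simp; ring
  have hsum : Summable fun n => |a n| * 3 ^ n :=
    Summable.of_nonneg_of_le (fun n => by positivity) hbound (hb.mul_left _)
  refine ⟨a, hsum, ?_, fun z hz => ?_⟩
  · refine (hsum.tsum_le_tsum hbound (hb.mul_left _)).trans ?_
    rw [tsum_mul_left, div_mul_eq_mul_div, div_le_iff₀ hr0]
    nlinarith
  · have hlz : ‖(l : ℂ) * z‖ < r := by
      rw [norm_mul, Complex.norm_real, Real.norm_eq_abs, abs_of_pos hl]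
      nlinarith
    have h0 : f.1 0 = b 0 := by
      rw [hfb 0 (by simpa using hr0), tsum_eq_single 0 (fun n hn => by simp [hn])]
      simp
    have hs := summable_ofReal_mul_pow hb hlz.le
    rw [hfb _ hlz, h0, hs.tsum_eq_zero_add,
      (summable_ofReal_mul_pow hsum (hz.trans (by norm_num))).tsum_eq_zero_add]
    simp only [a, if_true, Nat.succ_ne_zero, if_false]
    simp [mul_pow, mul_assoc]

end PowerSeriesHolo

section LaurentSplitting

open Filter Metric Topology DiscRing

/-- Weighted bi-infinite coefficient sequences: `t` stands for the Laurent series with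
coefficients `3 ^ (-|n|) * t n`. -/
def LaurentSeq : Type := BoundedContinuousFunction ℤ ℝ

namespace LaurentSeq

noncomputable instance : NormedAddCommGroup LaurentSeq :=
  inferInstanceAs (NormedAddCommGroup (BoundedContinuousFunction ℤ ℝ))

noncomputable instance : NormedSpace ℝ LaurentSeq :=
  inferInstanceAs (NormedSpace ℝ (BoundedContinuousFunction ℤ ℝ))

instance : CompleteSpace LaurentSeq :=
  inferInstanceAs (CompleteSpace (BoundedContinuousFunction ℤ ℝ))

instance : FunLike LaurentSeq ℤ ℝ :=
  inferInstanceAs (FunLike (BoundedContinuousFunction ℤ ℝ) ℤ ℝ)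

@[ext]
theorem ext {s t : LaurentSeq} (h : ∀ n, s n = t n) : s = t := DFunLike.ext _ _ h

@[simp]
theorem add_apply (s t : LaurentSeq) (n : ℤ) : (s + t) n = s n + t n := rfl

@[simp]
theorem sub_apply (s t : LaurentSeq) (n : ℤ) : (s - t) n = s n - t n := rfl

@[simp]
theorem smul_apply (c : ℝ) (t : LaurentSeq) (n : ℤ) : (c • t) n = c * t n := rfl

theorem norm_apply_le (t : LaurentSeq) (n : ℤ) : ‖t n‖ ≤ ‖t‖ :=
  BoundedContinuousFunction.norm_coe_le_norm _ n

/-- A bounded sequence as an element of `LaurentSeq`. -/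
noncomputable def ofBound (f : ℤ → ℝ) (C : ℝ) (hf : ∀ n, ‖f n‖ ≤ C) : LaurentSeq :=
  BoundedContinuousFunction.ofNormedAddCommGroup f continuous_of_discreteTopology C hf

@[simp]
theorem ofBound_apply {f : ℤ → ℝ} {C : ℝ} (hf : ∀ n, ‖f n‖ ≤ C) (n : ℤ) :
    ofBound f C hf n = f n := rfl

theorem norm_ofBound_le {f : ℤ → ℝ} {C : ℝ} (hf : ∀ n, ‖f n‖ ≤ C) (hC : 0 ≤ C) :
    ‖ofBound f C hf‖ ≤ C :=
  BoundedContinuousFunction.norm_ofNormedAddCommGroup_le _ hC hf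

theorem norm_weight_mul_le {w : ℤ → ℝ} {e : ℤ → ℤ} {C : ℝ} (hw : ∀ n, |w n| ≤ C)
    (t : LaurentSeq) (n : ℤ) : ‖w n * t (e n)‖ ≤ C * ‖t‖ := by
  rw [norm_mul]
  exact mul_le_mul (hw n) (t.norm_apply_le _) (norm_nonneg _) ((abs_nonneg _).trans (hw n))

/-- The operator `t ↦ (n ↦ w n * t (e n))`. -/
noncomputable def weightedComp (w : ℤ → ℝ) (e : ℤ → ℤ) (C : ℝ) (hw : ∀ n, |w n| ≤ C) :
    LaurentSeq →L[ℝ] LaurentSeq :=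
  LinearMap.mkContinuous
    { toFun := fun t => ofBound (fun n => w n * t (e n)) (C * ‖t‖) (norm_weight_mul_le hw t)
      map_add' := fun s t => by ext n; simp [mul_add]
      map_smul' := fun c t => by ext n; simp [mul_left_comm] } C fun t =>
    norm_ofBound_le (norm_weight_mul_le hw t)
      (mul_nonneg ((abs_nonneg _).trans (hw 0)) (norm_nonneg _))

theorem weightedComp_apply {w : ℤ → ℝ} {e : ℤ → ℤ} {C : ℝ} (hw : ∀ n, |w n| ≤ C) (t : LaurentSeq)
    (n : ℤ) : weightedComp w e C hw t n = w n * t (e n) := rfl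

theorem norm_weightedComp_le {w : ℤ → ℝ} {e : ℤ → ℤ} {C : ℝ} (hw : ∀ n, |w n| ≤ C) :
    ‖weightedComp w e C hw‖ ≤ C :=
  LinearMap.mkContinuous_norm_le _ ((abs_nonneg _).trans (hw 0)) fun t =>
    norm_ofBound_le (norm_weight_mul_le hw t)
      (mul_nonneg ((abs_nonneg _).trans (hw 0)) (norm_nonneg _))

/-- Multiplication by the `k`-th power of the variable. -/
noncomputable def shift (k : ℤ) : LaurentSeq →L[ℝ] LaurentSeq :=
  weightedComp (fun n => 3 ^ (|n| - |n - k|)) (fun n => n - k) (3 ^ |k|) fun n => by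
    rw [abs_of_pos (by positivity)]
    refine zpow_le_zpow_right₀ (by norm_num) ?_
    have := abs_sub_abs_le_abs_sub n (n - k)
    rwa [sub_sub_cancel] at this

/-- The part with nonnegative exponents. -/
noncomputable def nonnegPart : LaurentSeq →L[ℝ] LaurentSeq :=
  weightedComp (fun n => if 0 ≤ n then 1 else 0) id 1 fun n => by split_ifs <;> simp

/-- The part with negative exponents. -/
noncomputable def negPart : LaurentSeq →L[ℝ] LaurentSeq :=
  weightedComp (fun n => if 0 ≤ n then 0 else 1) id 1 fun n => by split_ifs <;> simp

theorem nonnegPart_add_negPart (t : LaurentSeq) : nonnegPart t + negPart t = t := by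
  ext n
  rw [add_apply, nonnegPart, negPart, weightedComp_apply,
    weightedComp_apply]
  split_ifs <;> simp

/-- The constant Laurent series `1`. -/
noncomputable def one : LaurentSeq :=
  ofBound (fun n => if n = 0 then 1 else 0) 1 fun n => by split_ifs <;> simp

theorem one_apply (n : ℤ) : one n = if n = 0 then 1 else 0 := rfl

theorem norm_one_le : ‖one‖ ≤ 1 :=
  norm_ofBound_le _ zero_le_one

/-- The weight of the `n`-th entry in the evaluation at `z`. -/
noncomputable def evalWeight (z : ℂ) (n : ℤ) : ℂ := 3 ^ (-|n|) * z ^ n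

theorem evalWeight_natCast (z : ℂ) (n : ℕ) : evalWeight z n = 3⁻¹ ^ n * z ^ n := by
  simp [evalWeight]

theorem evalWeight_neg_natCast (z : ℂ) (n : ℕ) : evalWeight z (-n) = 3⁻¹ ^ n * z⁻¹ ^ n := by
  simp [evalWeight]

theorem summable_norm_evalWeight {z : ℂ} (h₁ : 1 / 2 < ‖z‖) (h₂ : ‖z‖ < 2) :
    Summable fun n => ‖evalWeight z n‖ := by
  refine Summable.of_nat_of_neg ?_ ?_
  · simp only [evalWeight_natCast, ← mul_pow, norm_pow]
    refine summable_geometric_of_lt_one (norm_nonneg _) ?_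
    rw [norm_mul, norm_inv, RCLike.norm_ofNat]
    linarith
  · simp only [evalWeight_neg_natCast, ← mul_pow, norm_pow]
    refine summable_geometric_of_lt_one (norm_nonneg _) ?_
    rw [norm_mul, norm_inv, norm_inv, RCLike.norm_ofNat, ← mul_inv]
    exact inv_lt_one_of_one_lt₀ (by linarith)

theorem summable_eval {z : ℂ} (h₁ : 1 / 2 < ‖z‖) (h₂ : ‖z‖ < 2) (t : LaurentSeq) :
    Summable fun n => (t n : ℂ) * evalWeight z n := by
  refine Summable.of_norm_bounded ((summable_norm_evalWeight h₁ h₂).mul_left ‖t‖) fun n => ?_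
  rw [norm_mul, Complex.norm_real]
  gcongr
  exact t.norm_apply_le n

/-- Evaluation of a Laurent series at a point of the annulus. -/
noncomputable def eval (z : ℂ) (h₁ : 1 / 2 < ‖z‖) (h₂ : ‖z‖ < 2) : LaurentSeq →L[ℝ] ℂ :=
  LinearMap.mkContinuous
    { toFun := fun t => ∑' n, (t n : ℂ) * evalWeight z n
      map_add' := fun s t => by
        rw [← (summable_eval h₁ h₂ s).tsum_add (summable_eval h₁ h₂ t)]
        simp [add_mul]
      map_smul' := fun c t => by
        rw [RingHom.id_apply, Complex.real_smul, ← tsum_mul_left]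
        simp [mul_assoc] } (∑' n, ‖evalWeight z n‖) fun t => by
    refine tsum_of_norm_bounded
      (((summable_norm_evalWeight h₁ h₂).hasSum).mul_right ‖t‖) fun n => ?_
    rw [norm_mul, Complex.norm_real, mul_comm]
    gcongr
    exact t.norm_apply_le n

variable {z : ℂ} (h₁ : 1 / 2 < ‖z‖) (h₂ : ‖z‖ < 2)

theorem eval_apply (t : LaurentSeq) : eval z h₁ h₂ t = ∑' n, (t n : ℂ) * evalWeight z n := rfl

theorem eval_one : eval z h₁ h₂ one = 1 := by
  rw [eval_apply, tsum_eq_single 0 fun n hn => by simp [one_apply, hn]]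
  simp [one_apply, evalWeight]

theorem eval_shift (k : ℤ) (t : LaurentSeq) :
    eval z h₁ h₂ (shift k t) = z ^ k * eval z h₁ h₂ t := by
  have hz : z ≠ 0 := by rintro rfl; norm_num at h₁
  rw [eval_apply, eval_apply, ← tsum_mul_left,
    ← (Equiv.subRight k).tsum_eq fun n => z ^ k * ((t n : ℂ) * evalWeight z n)]
  refine tsum_congr fun n => ?_
  rw [shift, weightedComp_apply, Equiv.subRight_apply, evalWeight, evalWeight]
  have h3 : (3 : ℂ) ^ (|n| - |n - k|) * 3 ^ (-|n|) = 3 ^ (-|n - k|) := by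
    rw [← zpow_add₀ (by norm_num)]; congr 1; ring
  have hzk : z ^ k * z ^ (n - k) = z ^ n := by rw [← zpow_add₀ hz]; congr 1; ring
  push_cast
  rw [← h3, ← hzk]
  ring

/-- Multiplication by the series `∑ a k * z ^ (σ * k)`. -/
noncomputable def mulOp (a : ℕ → ℝ) (σ : ℤˣ) : LaurentSeq →L[ℝ] LaurentSeq :=
  ∑' k : ℕ, a k • shift (σ * k)

theorem norm_smul_shift_le (a : ℕ → ℝ) (σ : ℤˣ) (k : ℕ) :
    ‖a k • shift (σ * k)‖ ≤ |a k| * 3 ^ k := by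
  rw [norm_smul, Real.norm_eq_abs]
  gcongr
  refine (norm_weightedComp_le _).trans_eq ?_
  rw [abs_mul, Int.isUnit_iff_abs_eq.1 σ.isUnit]
  simp

theorem summable_smul_shift {a : ℕ → ℝ} (ha : Summable fun n => |a n| * 3 ^ n) (σ : ℤˣ) :
    Summable fun k : ℕ => a k • shift (σ * k) :=
  Summable.of_norm_bounded ha (norm_smul_shift_le a σ)

theorem norm_mulOp_le {a : ℕ → ℝ} (ha : Summable fun n => |a n| * 3 ^ n) (σ : ℤˣ) :
    ‖mulOp a σ‖ ≤ ∑' n, |a n| * 3 ^ n :=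
  tsum_of_norm_bounded ha.hasSum (norm_smul_shift_le a σ)

theorem eval_mulOp {a : ℕ → ℝ} (ha : Summable fun n => |a n| * 3 ^ n) (σ : ℤˣ) (t : LaurentSeq) :
    eval z h₁ h₂ (mulOp a σ t) = (∑' n, (a n : ℂ) * (z ^ (σ : ℤ)) ^ n) * eval z h₁ h₂ t := by
  have h := (eval z h₁ h₂).hasSum
    ((ContinuousLinearMap.apply ℝ LaurentSeq t).hasSum (summable_smul_shift ha σ).hasSum)
  rw [← tsum_mul_right]
  refine h.tsum_eq.symm.trans (tsum_congr fun n => ?_)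
  simp only [ContinuousLinearMap.apply_apply, map_smul, eval_shift, Complex.real_smul,
    zpow_mul, zpow_natCast, mul_assoc]

/-- A Laurent series without negative exponents, as a function on the disc. -/
noncomputable def toHolo (t : LaurentSeq) : realHolo 2 :=
  ⟨fun z => ∑' n : ℕ, ((t n * 3⁻¹ ^ n : ℝ) : ℂ) * z ^ n, tsum_mem_realHolo (by
    refine Summable.of_nonneg_of_le (fun n => by positivity) (fun n => ?_)
      ((summable_geometric_of_lt_one (r := 2 / 3) (by norm_num) (by norm_num)).mul_left ‖t‖)
    rw [abs_mul, abs_of_pos (by positivity : (0 : ℝ) < 3⁻¹ ^ n), mul_assoc, ← mul_pow,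
      show (3⁻¹ * 2 : ℝ) = 2 / 3 by norm_num]
    gcongr
    exact t.norm_apply_le n)⟩

/-- The substitution of the variable by its inverse. -/
noncomputable def reflect : LaurentSeq →L[ℝ] LaurentSeq :=
  weightedComp 1 (fun n => -n) 1 fun n => by simp

theorem toHolo_eq_eval (t : LaurentSeq) (ht : ∀ n < 0, t n = 0) :
    (toHolo t).1 z = eval z h₁ h₂ t := by
  have hinj : Function.Injective ((↑) : ℕ → ℤ) := Nat.cast_injective
  rw [eval_apply, ← hinj.tsum_eq]
  · refine tsum_congr fun n => ?_
    rw [evalWeight_natCast]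
    push_cast
    ring
  · intro n hn
    obtain ⟨m, rfl⟩ | h := em (n ∈ Set.range ((↑) : ℕ → ℤ))
    · exact ⟨m, rfl⟩
    · have : n < 0 := by
        by_contra h'
        exact h ⟨n.toNat, Int.toNat_of_nonneg (not_lt.1 h')⟩
      exact absurd (by simp [ht n this]) hn

theorem toHolo_reflect_eq_eval (t : LaurentSeq) (ht : ∀ n > 0, t n = 0) :
    (toHolo (reflect t)).1 z⁻¹ = eval z h₁ h₂ t := by
  have hinv₁ : 1 / 2 < ‖z⁻¹‖ := by
    rw [norm_inv, one_div]; exact inv_strictAnti₀ (by linarith) h₂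
  have hinv₂ : ‖z⁻¹‖ < 2 := by
    rw [norm_inv]; exact inv_lt_of_inv_lt₀ (by norm_num) (by linarith)
  rw [toHolo_eq_eval hinv₁ hinv₂ _ fun n hn => by
    simp [reflect, weightedComp_apply, ht (-n) (by linarith)], eval_apply, eval_apply,
    ← (Equiv.neg ℤ).tsum_eq]
  refine tsum_congr fun n => ?_
  simp [reflect, weightedComp_apply, evalWeight]

theorem norm_nonnegPart_le (t : LaurentSeq) : ‖nonnegPart t‖ ≤ ‖t‖ := by
  simpa using nonnegPart.le_of_opNorm_le (norm_weightedComp_le _) t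

theorem norm_negPart_le (t : LaurentSeq) : ‖negPart t‖ ≤ ‖t‖ := by
  simpa using negPart.le_of_opNorm_le (norm_weightedComp_le _) t

theorem norm_mulOp_apply_le {a : ℕ → ℝ} (ha : Summable fun n => |a n| * 3 ^ n) {δ : ℝ}
    (hδ : ∑' n, |a n| * 3 ^ n ≤ δ) (σ : ℤˣ) (t : LaurentSeq) : ‖mulOp a σ t‖ ≤ δ * ‖t‖ :=
  (mulOp a σ).le_of_opNorm_le ((norm_mulOp_le ha σ).trans hδ) t

/-- Solvability of the additive splitting problem attached to two small matrices. -/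
theorem exists_fixed {G : Type*} [Fintype G] {δ : ℝ} (hδ : 0 < δ)
    (hGδ : 4 * (Fintype.card G * δ) ≤ 1) (c : G → ℝ) {N : ℝ} (hc : ∀ g, |c g| ≤ N)
    (a₁ a₂ : G → G → ℕ → ℝ)
    (h₁ : ∀ g h, Summable fun n => |a₁ g h n| * 3 ^ n) (h₁' : ∀ g h, ∑' n, |a₁ g h n| * 3 ^ n ≤ δ)
    (h₂ : ∀ g h, Summable fun n => |a₂ g h n| * 3 ^ n)
    (h₂' : ∀ g h, ∑' n, |a₂ g h n| * 3 ^ n ≤ δ) :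
    ∃ s : G → LaurentSeq, (∀ h, s h = ∑ g,
      (mulOp (a₁ g h) (-1) (c g • one - nonnegPart (s g)) -
        mulOp (a₂ g h) 1 (c g • one + negPart (s g)))) ∧
      ∀ h, ‖s h‖ ≤ 4 * (Fintype.card G * (N * δ)) := by
  let Φ : (G → LaurentSeq) → G → LaurentSeq := fun s h => ∑ g,
      (mulOp (a₁ g h) (-1) (c g • one - nonnegPart (s g)) -
        mulOp (a₂ g h) 1 (c g • one + negPart (s g)))
  have hdiff : ∀ s s', dist (Φ s) (Φ s') ≤ (1 / 2 : NNReal) * dist s s' := by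
    intro s s'
    rw [dist_eq_norm, dist_eq_norm]
    refine (pi_norm_le_iff_of_nonneg (by positivity)).2 fun h => ?_
    have hterm : ∀ g ∈ Finset.univ, ‖(mulOp (a₁ g h) (-1) (c g • one - nonnegPart (s g)) -
        mulOp (a₂ g h) 1 (c g • one + negPart (s g))) -
        (mulOp (a₁ g h) (-1) (c g • one - nonnegPart (s' g)) -
        mulOp (a₂ g h) 1 (c g • one + negPart (s' g)))‖ ≤ 2 * δ * ‖s - s'‖ := by
      intro g _
      have he : (mulOp (a₁ g h) (-1) (c g • one - nonnegPart (s g)) -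
        mulOp (a₂ g h) 1 (c g • one + negPart (s g))) -
        (mulOp (a₁ g h) (-1) (c g • one - nonnegPart (s' g)) -
        mulOp (a₂ g h) 1 (c g • one + negPart (s' g))) =
        -(mulOp (a₁ g h) (-1) (nonnegPart (s g - s' g)) +
          mulOp (a₂ g h) 1 (negPart (s g - s' g))) := by
        simp only [map_sub, map_add]
        abel
      rw [he, norm_neg]
      have hg : ‖s g - s' g‖ ≤ ‖s - s'‖ := norm_le_pi_norm (s - s') g
      have e₁ := (norm_mulOp_apply_le (h₁ g h) (h₁' g h) (-1) (nonnegPart (s g - s' g))).trans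
        (mul_le_mul_of_nonneg_left ((norm_nonnegPart_le _).trans hg) hδ.le)
      have e₂ := (norm_mulOp_apply_le (h₂ g h) (h₂' g h) 1 (negPart (s g - s' g))).trans
        (mul_le_mul_of_nonneg_left ((norm_negPart_le _).trans hg) hδ.le)
      refine (norm_add_le _ _).trans ?_
      linarith
    simp only [Φ, Pi.sub_apply]
    rw [← Finset.sum_sub_distrib]
    refine (norm_sum_le_of_le _ hterm).trans ?_
    rw [Finset.sum_const, Finset.card_univ, nsmul_eq_mul]
    push_cast
    nlinarith [norm_nonneg (s - s')]
  have hΦ : ContractingWith (1 / 2) Φ :=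
    ⟨by rw [← NNReal.coe_lt_coe]; norm_num, LipschitzWith.of_dist_le_mul hdiff⟩
  let s := ContractingWith.fixedPoint Φ hΦ
  have hs : Φ s = s := hΦ.fixedPoint_isFixedPt
  refine ⟨s, fun h => (congrFun hs h).symm, ?_⟩
  rcases isEmpty_or_nonempty G with hG | ⟨⟨g₀⟩⟩
  · exact fun h => isEmptyElim h
  have hN : 0 ≤ N := (abs_nonneg _).trans (hc g₀)
  have h0 : ‖Φ 0‖ ≤ 2 * (Fintype.card G * (N * δ)) := by
    refine (pi_norm_le_iff_of_nonneg (by positivity)).2 fun h => ?_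
    have hterm : ∀ g ∈ Finset.univ,
        ‖mulOp (a₁ g h) (-1) (c g • one - nonnegPart ((0 : G → LaurentSeq) g)) -
        mulOp (a₂ g h) 1 (c g • one + negPart ((0 : G → LaurentSeq) g))‖ ≤ 2 * (N * δ) := by
      intro g _
      rw [Pi.zero_apply, map_zero, map_zero, sub_zero, add_zero]
      have hcn : ‖c g • one‖ ≤ N := by
        rw [norm_smul]
        simpa using mul_le_mul (hc g) norm_one_le (norm_nonneg _) hN
      have e₁ := (norm_mulOp_apply_le (h₁ g h) (h₁' g h) (-1) (c g • one)).trans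
        (mul_le_mul_of_nonneg_left hcn hδ.le)
      have e₂ := (norm_mulOp_apply_le (h₂ g h) (h₂' g h) 1 (c g • one)).trans
        (mul_le_mul_of_nonneg_left hcn hδ.le)
      refine (norm_sub_le _ _).trans ?_
      linarith
    refine (norm_sum_le_of_le _ hterm).trans ?_
    rw [Finset.sum_const, Finset.card_univ, nsmul_eq_mul]
    linarith
  have h3 : ‖s‖ ≤ 4 * (Fintype.card G * (N * δ)) := by
    have h4 := hdiff s 0
    rw [hs, dist_eq_norm, dist_eq_norm, sub_zero] at h4
    have h5 := norm_le_norm_add_norm_sub' s (Φ 0)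
    push_cast at h4
    linarith
  exact fun h => (norm_le_pi_norm s h).trans h3

/-- Small matrices over the two discs covering the sphere split additively on the overlap. -/
theorem exists_splitting (G : Type*) [Fintype G] :
    ∃ δ > 0, ∀ a₁ a₂ : G → G → ℕ → ℝ,
      (∀ g h, Summable fun n => |a₁ g h n| * 3 ^ n) → (∀ g h, ∑' n, |a₁ g h n| * 3 ^ n ≤ δ) →
      (∀ g h, Summable fun n => |a₂ g h n| * 3 ^ n) → (∀ g h, ∑' n, |a₂ g h n| * 3 ^ n ≤ δ) →
      ∃ Z W : G → realHolo 2,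
        (∀ z : ℂ, 1 / 2 < ‖z‖ → ‖z‖ < 2 → ∀ h,
          (W h).1 z⁻¹ + ∑ g, (W g).1 z⁻¹ * ∑' n, (a₂ g h n : ℂ) * z ^ n =
            (Z h).1 z + ∑ g, (Z g).1 z * ∑' n, (a₁ g h n : ℂ) * z⁻¹ ^ n) ∧
        Function.Injective fun h =>
          (Z h).1 1 + ∑ g, (Z g).1 1 * ∑' n, (a₁ g h n : ℂ) * (1 : ℂ)⁻¹ ^ n := by
  have h11 : 1 / 2 < ‖(1 : ℂ)‖ := by norm_num
  have h12 : ‖(1 : ℂ)‖ < 2 := by norm_num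
  set K := ‖eval 1 h11 h12‖ with hK
  have hK0 : 0 ≤ K := norm_nonneg _
  set N : ℝ := Fintype.card G + 1 with hN
  have hN1 : 1 ≤ N := by simp [hN]
  set δ : ℝ := 1 / (100 * (N * N) * (K + 1)) with hδ
  have hδ0 : 0 < δ := by positivity
  have hδK : N * N * δ * (K + 1) = 1 / 100 := by rw [hδ]; field_simp
  have hδN : N * N * δ ≤ 1 / 100 := by
    have : 0 ≤ N * N * δ * K := by positivity
    linarith
  have hδN' : N * δ ≤ 1 / 100 := by
    have : N * δ ≤ N * (N * δ) := le_mul_of_one_le_left (by positivity) hN1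
    linarith
  refine ⟨δ, hδ0, fun a₁ a₂ h₁ h₁' h₂ h₂' => ?_⟩
  let c : G → ℝ := fun g => ((Fintype.equivFin G g : ℕ) : ℝ)
  have hc : ∀ g, |c g| ≤ N := fun g => by
    rw [abs_of_nonneg (by positivity)]
    have : ((Fintype.equivFin G g : ℕ) : ℝ) ≤ (Fintype.card G : ℕ) :=
      Nat.cast_le.2 (Fintype.equivFin G g).2.le
    simp only [c, hN]
    linarith
  have hcard : (Fintype.card G : ℝ) ≤ N := by simp [hN]
  obtain ⟨s, hs, hsn⟩ := exists_fixed hδ0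
    (by have := mul_le_mul_of_nonneg_right hcard hδ0.le; linarith) c hc a₁ a₂ h₁ h₁' h₂ h₂'
  have hsn' : ∀ h, ‖s h‖ ≤ 4 * (N * N * δ) := fun h => by
    have := mul_le_mul_of_nonneg_right hcard (by positivity : 0 ≤ N * δ)
    linarith [hsn h]
  let zs : G → LaurentSeq := fun g => c g • one - nonnegPart (s g)
  let ws : G → LaurentSeq := fun g => c g • one + negPart (s g)
  have hzs : ∀ g, ∀ n < 0, zs g n = 0 := fun g n hn => by
    simp [zs, one_apply, nonnegPart, weightedComp_apply, hn.ne, hn]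
  have hws : ∀ g, ∀ n > 0, ws g n = 0 := fun g n hn => by
    simp [ws, one_apply, negPart, weightedComp_apply, hn.ne', hn.le]
  have hz : ∀ h, ws h + ∑ g, mulOp (a₂ g h) 1 (ws g) = zs h + ∑ g, mulOp (a₁ g h) (-1) (zs g) := by
    intro h
    have e₁ := hs h
    rw [Finset.sum_sub_distrib, ← nonnegPart_add_negPart (s h)] at e₁
    have e₂ : ws h - zs h = nonnegPart (s h) + negPart (s h) := by simp only [ws, zs]; abel
    rw [← e₂, sub_eq_sub_iff_add_eq_add] at e₁
    rw [e₁]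
    exact add_comm _ _
  have hev : ∀ z (k₁ : 1 / 2 < ‖z‖) (k₂ : ‖z‖ < 2) h,
      eval z k₁ k₂ (zs h + ∑ g, mulOp (a₁ g h) (-1) (zs g)) = (toHolo (zs h)).1 z +
        ∑ g, (toHolo (zs g)).1 z * ∑' n, (a₁ g h n : ℂ) * z⁻¹ ^ n := by
    intro z k₁ k₂ h
    rw [map_add, map_sum, toHolo_eq_eval k₁ k₂ _ (hzs h)]
    congr 1
    refine Finset.sum_congr rfl fun g _ => ?_
    rw [eval_mulOp k₁ k₂ (h₁ g h), toHolo_eq_eval k₁ k₂ _ (hzs g), mul_comm]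
    simp
  refine ⟨fun g => toHolo (zs g), fun g => toHolo (reflect (ws g)), fun z k₁ k₂ h => ?_, ?_⟩
  · rw [← hev z k₁ k₂, ← hz h, map_add, map_sum, toHolo_reflect_eq_eval k₁ k₂ _ (hws h)]
    congr 1
    refine Finset.sum_congr rfl fun g _ => ?_
    rw [eval_mulOp k₁ k₂ (h₂ g h), toHolo_reflect_eq_eval k₁ k₂ _ (hws g), mul_comm]
    simp
  · have hclose : ∀ h, ‖eval 1 h11 h12 (zs h + ∑ g, mulOp (a₁ g h) (-1) (zs g)) - (c h : ℂ)‖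
        < 1 / 2 := by
      intro h
      have e₁ : (c h : ℂ) = eval 1 h11 h12 (c h • one) := by
        rw [map_smul, eval_one, Complex.real_smul, mul_one]
      rw [e₁, ← map_sub]
      have hzn : ∀ g ∈ Finset.univ, ‖mulOp (a₁ g h) (-1) (zs g)‖ ≤ δ * (2 * N) := by
        intro g _
        refine (norm_mulOp_apply_le (h₁ g h) (h₁' g h) (-1) (zs g)).trans
          (mul_le_mul_of_nonneg_left ?_ hδ0.le)
        refine (norm_sub_le _ _).trans ?_
        have i₁ : ‖c g • one‖ ≤ N := by
          rw [norm_smul]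
          simpa using mul_le_mul (hc g) norm_one_le (norm_nonneg _) (by linarith)
        have i₂ := (norm_nonnegPart_le (s g)).trans (hsn' g)
        linarith
      have hsum := norm_sum_le_of_le _ hzn
      rw [Finset.sum_const, Finset.card_univ, nsmul_eq_mul] at hsum
      have hb : ‖zs h + ∑ g, mulOp (a₁ g h) (-1) (zs g) - c h • one‖ ≤ 6 * (N * N * δ) := by
        have e₂ : zs h + ∑ g, mulOp (a₁ g h) (-1) (zs g) - c h • one =
            ∑ g, mulOp (a₁ g h) (-1) (zs g) - nonnegPart (s h) := by
          simp only [zs]; abel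
        rw [e₂]
        refine (norm_sub_le _ _).trans ?_
        have i₂ := (norm_nonnegPart_le (s h)).trans (hsn' h)
        have i₃ := mul_le_mul_of_nonneg_right hcard (by positivity : 0 ≤ δ * (2 * N))
        linarith
      refine ((eval 1 h11 h12).le_opNorm _).trans_lt ?_
      rw [← hK]
      have i₄ := mul_le_mul_of_nonneg_left hb hK0
      nlinarith
    intro h h' hh
    simp only at hh
    rw [← hev 1 h11 h12, ← hev 1 h11 h12] at hh
    have e₁ := hclose h
    have e₂ := hclose h'
    rw [← hh] at e₂
    have e₃ : ‖(c h : ℂ) - (c h' : ℂ)‖ < 1 := by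
      have := norm_sub_le_norm_sub_add_norm_sub (c h : ℂ)
        (eval 1 h11 h12 (zs h + ∑ g, mulOp (a₁ g h) (-1) (zs g))) (c h' : ℂ)
      rw [norm_sub_rev (c h : ℂ) (eval _ _ _ _)] at this
      linarith
    rw [← Complex.ofReal_sub, Complex.norm_real, Real.norm_eq_abs] at e₃
    have e₄ : |((Fintype.equivFin G h : ℕ) : ℤ) - ((Fintype.equivFin G h' : ℕ) : ℤ)| < 1 := by
      have e₅ : |((((Fintype.equivFin G h : ℕ) : ℤ) - ((Fintype.equivFin G h' : ℕ) : ℤ) : ℤ) : ℝ)|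
          < 1 := by
        push_cast
        exact e₃
      rw [← Int.cast_abs] at e₅
      exact_mod_cast e₅
    rw [Int.abs_lt_one_iff, sub_eq_zero] at e₄
    exact (Fintype.equivFin G).injective (Fin.ext (by exact_mod_cast e₄))

end LaurentSeq

end LaurentSplitting

section PatchAssembly

open Filter Metric Topology DiscRing

/-- `G` occurs as the group of a Galois family over the real rational functions which consists of
functions holomorphic around the origin with distinct values there. -/
def HasRealFamily (G : Type*) [Group G] : Prop :=
  ∃ (R : ℝ) (_ : Fact (0 < R)) (θ : G → realHolo R),
    (Function.Injective fun g => (θ g).1 0) ∧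
      GaloisFamily (ratSubfield R) fun g => toFrac (θ g)

variable {G : Type*} [Group G]

/-- Galois families may be transported between discs along charts. -/
theorem GaloisFamily.of_charts {R R' : ℝ} [Fact (0 < R)] [Fact (0 < R')] {θ : G → realHolo R}
    (h : GaloisFamily (ratSubfield R) fun g => toFrac (θ g)) (θ' : G → realHolo R')
    {ι : Type*} (W : Ultrafilter ι) {c c' : ι → ℂ} {z₀ z₀' : ℂ} (hz₀ : z₀ ∈ ball (0 : ℂ) R)
    (hz₀' : z₀' ∈ ball (0 : ℂ) R') (hc : Tendsto c W (𝓝[≠] z₀)) (hc' : Tendsto c' W (𝓝[≠] z₀'))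
    (hθ : ∀ g, (θ g).1 ∘ c =ᶠ[W] (θ' g).1 ∘ c')
    (hcc : realAdjoin (germConst (W : Filter ι)) (c : Germ (W : Filter ι) ℂ) =
      realAdjoin (germConst (W : Filter ι)) (c' : Germ (W : Filter ι) ℂ)) :
    GaloisFamily (ratSubfield R') fun g => toFrac (θ' g) := by
  obtain ⟨j, hj, hjE⟩ := exists_chart W hz₀ hc
  obtain ⟨j', hj', hjE'⟩ := exists_chart W hz₀' hc'
  refine GaloisFamily.of_map j' ?_
  have := h.map j
  rw [hjE, hcc, ← hjE'] at this
  convert this using 2 with g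
  rw [hj, hj', Germ.coe_eq]
  exact (hθ g).symm

theorem GaloisFamily.rescale {R : ℝ} [hR : Fact (0 < R)] {θ : G → realHolo R}
    (h : GaloisFamily (ratSubfield R) fun g => toFrac (θ g)) {l : ℝ} (hl : 0 < l)
    (hlR : 2 * l ≤ R) : ∃ θ' : G → realHolo 2, (∀ g z, (θ' g).1 z = (θ g).1 (l * z)) ∧
      GaloisFamily (ratSubfield 2) fun g => toFrac (θ' g) := by
  have hmem : ∀ z ∈ ball (0 : ℂ) 2, (l : ℂ) * z ∈ ball (0 : ℂ) R := fun z hz => by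
    rw [mem_ball_zero_iff] at hz ⊢
    rw [norm_mul, Complex.norm_real, Real.norm_eq_abs, abs_of_pos hl]
    nlinarith
  let θ' : G → realHolo 2 := fun g => ⟨fun z => (θ g).1 (l * z),
    (θ g).2.1.comp (by fun_prop) hmem, fun x hx => by
      have := (θ g).2.2 (l * x) (by push_cast; exact hmem _ hx)
      push_cast at this
      exact this⟩
  refine ⟨θ', fun g z => rfl, ?_⟩
  have hl0 : (l : ℂ) ≠ 0 := by exact_mod_cast hl.ne'
  let W : Ultrafilter ℂ := Ultrafilter.of (𝓝[≠] 0)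
  have hW : (W : Filter ℂ) ≤ 𝓝[≠] 0 := Ultrafilter.of_le _
  refine h.of_charts θ' W (c := fun z => l * z) (c' := id) (z₀ := 0) (z₀' := 0)
    (mem_ball_self hR.out) (mem_ball_self two_pos) ?_ hW (fun g => Filter.EventuallyEq.rfl) ?_
  · refine tendsto_nhdsWithin_iff.2 ⟨?_, ?_⟩
    · have : Tendsto (fun z : ℂ => (l : ℂ) * z) (𝓝 0) (𝓝 ((l : ℂ) * 0)) :=
        (continuous_const_mul (l : ℂ)).tendsto 0
      rw [mul_zero] at this
      exact this.mono_left (hW.trans nhdsWithin_le_nhds)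
    · filter_upwards [hW self_mem_nhdsWithin] with z hz
      exact mul_ne_zero hl0 hz
  · refine realAdjoin_eq_of_mem ?_ ?_
    · exact mul_mem (const_mem_realAdjoin (germConst (W : Filter ℂ)) _ l)
        (self_mem_realAdjoin _ ((id : ℂ → ℂ) : Germ (W : Filter ℂ) ℂ))
    · have := mul_mem (const_mem_realAdjoin (germConst (W : Filter ℂ)) _ l⁻¹)
        (self_mem_realAdjoin (germConst (W : Filter ℂ))
          ((fun z => (l : ℂ) * z : ℂ → ℂ) : Germ (W : Filter ℂ) ℂ))
      convert this using 1
      refine congrArg _ (funext fun z => ?_)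
      simp [hl0]

/-- After rescaling, a polynomial in a Galois family is a small perturbation of the indicator
function of the identity. -/
theorem HasRealFamily.exists_small [Finite G] [DecidableEq G] (h : HasRealFamily G) {δ : ℝ}
    (hδ : 0 < δ) : ∃ (θ : G → realHolo 2) (F : ℝ[X]) (a : G → ℕ → ℝ),
      GaloisFamily (ratSubfield 2) (fun g => toFrac (θ g)) ∧
      (∀ g, Summable fun n => |a g n| * 3 ^ n) ∧ (∀ g, ∑' n, |a g n| * 3 ^ n ≤ δ) ∧
      ∀ g (z : ℂ), ‖z‖ < 2 → (F.eval₂ (const 2) (θ g)).1 z =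
        (if g = 1 then 1 else 0) + ∑' n, (a g n : ℂ) * z ^ n := by
  classical
  have := Fintype.ofFinite G
  obtain ⟨R, hR, θ, hθ0, hθ⟩ := h
  have hre : ∀ g, (θ g).1 0 = (((θ g).1 0).re : ℂ) := fun g =>
    Complex.ext rfl (by simpa using (θ g).2.2 0 (by simpa using hR.out))
  have hv : Function.Injective fun g => ((θ g).1 0).re := fun g g' hgg => hθ0 (by
    simp only at hgg ⊢
    rw [hre g, hre g', hgg])
  let F : ℝ[X] := Lagrange.interpolate Finset.univ (fun g => ((θ g).1 0).re)
    fun g => if g = 1 then 1 else 0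
  have hev : ∀ {R : ℝ} (f : realHolo R) (z : ℂ),
      (F.eval₂ (const R) f).1 z = F.eval₂ Complex.ofRealHom (f.1 z) := by
    intro R f z
    exact hom_eval₂ F (const R) ((Pi.evalRingHom (fun _ : ℂ => ℂ) z).comp (realHolo R).subtype) f
  choose l₀ hl₀ hsmall using fun g => exists_small_power_series hR.out
    (F.eval₂ (const R) (θ g)) hδ
  let l : ℝ := min (R / 2) (Finset.univ.inf' ⟨1, Finset.mem_univ _⟩ l₀)
  have hl : 0 < l := lt_min (half_pos hR.out) ((Finset.lt_inf'_iff _).2 fun g _ => hl₀ g)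
  have hlg : ∀ g, l ≤ l₀ g := fun g =>
    (min_le_right _ _).trans (Finset.inf'_le _ (Finset.mem_univ g))
  choose a ha ha' hae using fun g => hsmall g l hl (hlg g)
  obtain ⟨θ', hθ', hfam⟩ := hθ.rescale hl (by
    have : l ≤ R / 2 := min_le_left _ _
    linarith)
  refine ⟨θ', F, a, hfam, ha, ha', fun g z hz => ?_⟩
  rw [hev, hθ', ← hev, hae g z hz.le, hev, hre g, ← Complex.ofRealHom_eq_coe, eval₂_at_apply,
    Lagrange.eval_interpolate_at_node _ hv.injOn (Finset.mem_univ g)]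
  split_ifs <;> simp

theorem indicator_mem_inducedSubring {Q : Type*} [Field Q] {E Q₁ : Subfield Q} (hE : E ≤ Q₁)
    {G₁ : Subgroup G} [DecidablePred (· ∈ G₁)] {θ : G₁ → Q} (h : GaloisFamily E θ) (F : E[X]) :
    (fun g => if hg : g ∈ G₁ then aeval (θ ⟨g, hg⟩) F else 0) ∈ inducedSubring Q₁ θ := by
  intro k
  by_cases hk : k ∈ G₁
  · obtain ⟨p, hp⟩ := h.translate ⟨k, hk⟩
    obtain ⟨q, -, -, hq⟩ := Subfield.exists_aeval_eq_of_le hE (F.comp p)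
    refine ⟨q, fun τ => ?_⟩
    have := hp τ
    simp only [Subgroup.mul_mem _ hk τ.2, dif_pos] at this ⊢
    rw [hq, aeval_comp, ← this]
    rfl
  · refine ⟨0, fun τ => ?_⟩
    rw [map_zero]
    exact dif_neg fun hkτ => hk ((Subgroup.mul_mem_cancel_right _ τ.2).1 hkτ)

theorem sum_mul_indicator_mem_inducedSubring [Fintype G] {Q : Type*} [Field Q]
    {E Q₁ : Subfield Q} (hE : E ≤ Q₁) {G₁ : Subgroup G} [DecidablePred (· ∈ G₁)] {θ : G₁ → Q}
    (h : GaloisFamily E θ) (F : E[X]) {y : G → Q} (hy : ∀ g, y g ∈ Q₁) :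
    (fun k => ∑ g, y g * if hg : g⁻¹ * k ∈ G₁ then aeval (θ ⟨g⁻¹ * k, hg⟩) F else 0) ∈
      inducedSubring Q₁ θ := by
  have := (inducedSubring Q₁ θ).sum_mem (t := Finset.univ) fun g _ =>
    (inducedSubring Q₁ θ).mul_mem (const_mem_inducedSubring (θ := θ) (hy g))
      (translate_mem_inducedSubring g⁻¹ (indicator_mem_inducedSubring hE h F))
  convert this using 1
  funext k
  simp

/-- Extension by zero of a family on a subgroup, as a matrix indexed by the group. -/
def Subgroup.inducedMatrix {A : Type*} [Zero A] (G₁ : Subgroup G) [DecidablePred (· ∈ G₁)]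
    (e : G₁ → A) (g h : G) : A :=
  if hg : g⁻¹ * h ∈ G₁ then e ⟨g⁻¹ * h, hg⟩ else 0

theorem Subgroup.inducedMatrix_map {A B : Type*} [Zero A] [Zero B] (G₁ : Subgroup G)
    [DecidablePred (· ∈ G₁)] (e : G₁ → A) (φ : A → B) (hφ : φ 0 = 0) (g h : G) :
    φ (G₁.inducedMatrix e g h) = G₁.inducedMatrix (fun τ => φ (e τ)) g h := by
  unfold Subgroup.inducedMatrix
  split_ifs
  · rfl
  · exact hφ

theorem Subgroup.sum_mul_inducedMatrix [Fintype G] [DecidableEq G] (G₁ : Subgroup G)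
    [DecidablePred (· ∈ G₁)] (v : G → ℂ) (e : G₁ → ℂ) (a : G₁ → ℕ → ℝ) (z : ℂ)
    (he : ∀ τ, e τ = (if τ = 1 then 1 else 0) + ∑' n, (a τ n : ℂ) * z ^ n) (h : G) :
    ∑ g, v g * G₁.inducedMatrix e g h =
      v h + ∑ g, v g * ∑' n, (G₁.inducedMatrix a g h n : ℂ) * z ^ n := by
  have : ∀ g, v g * G₁.inducedMatrix e g h = (if g = h then v g else 0) +
      v g * ∑' n, (G₁.inducedMatrix a g h n : ℂ) * z ^ n := by
    intro g
    unfold Subgroup.inducedMatrix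
    split_ifs with hg hgh hgh
    · subst hgh
      rw [he, if_pos (Subtype.ext (by simp)), mul_add, mul_one]
    · rw [he, if_neg, mul_add, mul_zero]
      exact fun h1 => hgh (inv_mul_eq_one.1 (congrArg Subtype.val h1))
    · subst hgh
      exact absurd (by simp) hg
    · simp
  rw [Finset.sum_congr rfl fun g _ => this g, Finset.sum_add_distrib,
    Finset.sum_ite_eq' Finset.univ h v, if_pos (Finset.mem_univ h)]

theorem aeval_map_eq_chart {Q : Type*} [Field Q] {E : Subfield Q} (j : Frac 2 →+* Q)
    {ρ : ℝ →+* Q} (hρ : ∀ r, ρ r ∈ E) (hjρ : ∀ r, j (toFrac (const 2 r)) = ρ r) (F : ℝ[X])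
    (f : realHolo 2) :
    aeval (j (toFrac f)) (F.map (ρ.codRestrict E hρ)) = j (toFrac (F.eval₂ (const 2) f)) := by
  rw [aeval_def, eval₂_map, ← RingHom.comp_apply, ← RingHom.comp_apply, hom_eval₂]
  congr 1
  ext r
  exact (hjρ r).symm

/-- The Galois groups of real families over the line are closed under generation. -/
theorem HasRealFamily.sup [Finite G] {G₁ G₂ : Subgroup G} (hG : G₁ ⊔ G₂ = ⊤)
    (h₁ : HasRealFamily G₁) (h₂ : HasRealFamily G₂) : HasRealFamily G := by
  classical
  have := Fintype.ofFinite G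
  obtain ⟨δ, hδ, hsplit⟩ := LaurentSeq.exists_splitting G
  obtain ⟨θ₁, F₁, a₁, fam₁, s₁, b₁, e₁⟩ := h₁.exists_small hδ
  obtain ⟨θ₂, F₂, a₂, fam₂, s₂, b₂, e₂⟩ := h₂.exists_small hδ
  obtain ⟨Z, Y, heq, hinj⟩ := hsplit (G₁.inducedMatrix a₁) (G₂.inducedMatrix a₂)
    (fun g h => by
      unfold Subgroup.inducedMatrix
      split_ifs
      · exact s₁ _
      · simp)
    (fun g h => by
      unfold Subgroup.inducedMatrix
      split_ifs
      · exact b₁ _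
      · simpa using hδ.le)
    (fun g h => by
      unfold Subgroup.inducedMatrix
      split_ifs
      · exact s₂ _
      · simp)
    (fun g h => by
      unfold Subgroup.inducedMatrix
      split_ifs
      · exact b₂ _
      · simpa using hδ.le)
  let E₁ : G → G → realHolo 2 := G₁.inducedMatrix fun τ => F₁.eval₂ (const 2) (θ₁ τ)
  let E₂ : G → G → realHolo 2 := G₂.inducedMatrix fun τ => F₂.eval₂ (const 2) (θ₂ τ)
  let A : G → ℂ → ℂ := fun h => ∑ g, (Z g).1 * ((E₁ g h).1 ∘ fun z => z⁻¹)
  let B : G → ℂ → ℂ := fun h => ∑ g, ((Y g).1 ∘ fun z => z⁻¹) * (E₂ g h).1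
  have hA : ∀ h z, 1 / 2 < ‖z‖ → A h z = (Z h).1 z +
      ∑ g, (Z g).1 z * ∑' n, (G₁.inducedMatrix a₁ g h n : ℂ) * z⁻¹ ^ n := by
    intro h z hz
    have hz' : ‖z⁻¹‖ < 2 := by
      rw [norm_inv]; exact inv_lt_of_inv_lt₀ (by norm_num) (by linarith)
    rw [← G₁.sum_mul_inducedMatrix (fun g => (Z g).1 z) (fun τ => (F₁.eval₂ (const 2) (θ₁ τ)).1 z⁻¹)
      a₁ z⁻¹ (fun τ => e₁ τ _ hz') h]
    simp only [A, Finset.sum_apply, Pi.mul_apply, Function.comp_apply, E₁]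
    refine Finset.sum_congr rfl fun g _ => ?_
    rw [G₁.inducedMatrix_map _ (fun f : realHolo 2 => f.1 z⁻¹) rfl]
  have hB : ∀ h z, ‖z‖ < 2 → B h z = (Y h).1 z⁻¹ +
      ∑ g, (Y g).1 z⁻¹ * ∑' n, (G₂.inducedMatrix a₂ g h n : ℂ) * z ^ n := by
    intro h z hz
    rw [← G₂.sum_mul_inducedMatrix (fun g => (Y g).1 z⁻¹) (fun τ => (F₂.eval₂ (const 2) (θ₂ τ)).1 z)
      a₂ z (fun τ => e₂ τ _ hz) h]
    simp only [B, Finset.sum_apply, Pi.mul_apply, Function.comp_apply, E₂]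
    refine Finset.sum_congr rfl fun g _ => ?_
    rw [G₂.inducedMatrix_map _ (fun f : realHolo 2 => f.1 z) rfl]
  have hA1 : Function.Injective fun h => A h 1 := by
    convert hinj using 2 with h
    exact hA h 1 (by norm_num)
  have hball : ∀ z ∈ ball (0 : ℂ) (1 / 2), 1 / 2 < ‖1 + z‖ ∧ ‖1 + z‖ < 2 := by
    intro z hz
    rw [mem_ball_zero_iff] at hz
    have i₁ := norm_add_le 1 z
    have i₂ := norm_sub_norm_le 1 (-z)
    rw [norm_neg, sub_neg_eq_add] at i₂
    rw [norm_one] at i₁ i₂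
    constructor <;> linarith
  have hball' : ∀ z ∈ ball (0 : ℂ) (1 / 2), 1 + z ∈ ball (0 : ℂ) 2 := fun z hz =>
    mem_ball_zero_iff.2 (hball z hz).2
  have hball'' : ∀ z ∈ ball (0 : ℂ) (1 / 2), (1 + z)⁻¹ ∈ ball (0 : ℂ) 2 := fun z hz => by
    rw [mem_ball_zero_iff, norm_inv]
    exact inv_lt_of_inv_lt₀ (by norm_num) (by linarith [(hball z hz).1])
  have hne : ∀ z ∈ ball (0 : ℂ) (1 / 2), 1 + z ≠ 0 := fun z hz h0 => by
    have := (hball z hz).1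
    rw [h0, norm_zero] at this
    linarith
  let f : G → realHolo (1 / 2) := fun h => ∑ g,
    (⟨fun z => (Z g).1 (1 + z), (Z g).2.1.comp (by fun_prop) hball', fun x hx => by
        have := (Z g).2.2 (1 + x) (by push_cast; exact hball' _ hx)
        push_cast at this
        exact this⟩ : realHolo (1 / 2)) *
      ⟨fun z => (E₁ g h).1 (1 + z)⁻¹, (E₁ g h).2.1.comp
        (DifferentiableOn.inv (by fun_prop) hne) hball'', fun x hx => by
        have := (E₁ g h).2.2 (1 + x)⁻¹ (by push_cast; exact hball'' _ hx)
        push_cast at this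
        exact this⟩
  have hf : ∀ h z, (f h).1 z = A h (1 + z) := by
    intro h z
    simp only [f, A, AddSubmonoidClass.coe_finsetSum, Finset.sum_apply]
    rfl
  have : Fact ((0 : ℝ) < 1 / 2) := ⟨by norm_num⟩
  refine ⟨1 / 2, this, f, ?_, ?_⟩
  · convert hA1 using 2 with h
    rw [hf, add_zero]
  let W : Ultrafilter ℂ := Ultrafilter.of (𝓝[≠] 1)
  have hW : (W : Filter ℂ) ≤ 𝓝[≠] 1 := Ultrafilter.of_le _
  have hW1 : (W : Filter ℂ) ≤ 𝓝 1 := hW.trans nhdsWithin_le_nhds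
  have hWne : ∀ᶠ z in (W : Filter ℂ), z ≠ 1 := hW self_mem_nhdsWithin
  have hW2 : ∀ᶠ z in (W : Filter ℂ), 1 / 2 < ‖z‖ ∧ ‖z‖ < 2 := hW1 <| by
    have : Tendsto (fun z : ℂ => ‖z‖) (𝓝 1) (𝓝 ‖(1 : ℂ)‖) := continuous_norm.tendsto 1
    rw [norm_one] at this
    exact this.eventually (Ioo_mem_nhds (by norm_num) (by norm_num))
  have h1mem : (1 : ℂ) ∈ ball (0 : ℂ) 2 := by simp
  obtain ⟨j₁, hj₁, hjE₁⟩ := exists_chart (R := 2) W (c := id) h1mem hW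
  obtain ⟨j₂, hj₂, hjE₂⟩ := exists_chart (R := 2) W (c := fun z => z⁻¹) h1mem (by
    refine tendsto_nhdsWithin_iff.2 ⟨?_, hWne.mono fun z hz => by simpa using hz⟩
    have : Tendsto (fun z : ℂ => z⁻¹) (𝓝 1) (𝓝 1⁻¹) := tendsto_inv₀ one_ne_zero
    rw [inv_one] at this
    exact this.mono_left hW1)
  obtain ⟨j₃, hj₃, hjE₃⟩ := exists_chart (R := 1 / 2) W (c := fun z => z - 1) (z₀ := 0)
    (mem_ball_self (by norm_num)) (by
      refine tendsto_nhdsWithin_iff.2 ⟨?_, hWne.mono fun z hz => by simpa [sub_eq_zero] using hz⟩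
      have : Tendsto (fun z : ℂ => z - 1) (𝓝 1) (𝓝 (1 - 1)) :=
        (continuous_sub_right (1 : ℂ)).tendsto 1
      rw [sub_self] at this
      exact this.mono_left hW1)
  set E := realAdjoin (germConst (W : Filter ℂ)) ((id : ℂ → ℂ) : Germ (W : Filter ℂ) ℂ) with hEdef
  have hE₂ : realAdjoin (germConst (W : Filter ℂ)) ((fun z => z⁻¹ : ℂ → ℂ) : Germ (W : Filter ℂ) ℂ)
      = E := by
    have hinv : ((fun z => z⁻¹ : ℂ → ℂ) : Germ (W : Filter ℂ) ℂ) =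
      ((id : ℂ → ℂ) : Germ (W : Filter ℂ) ℂ)⁻¹ := rfl
    refine realAdjoin_eq_of_mem ?_ ?_
    · rw [hinv]; exact inv_mem (self_mem_realAdjoin _ _)
    · rw [hinv, ← inv_inv ((id : ℂ → ℂ) : Germ (W : Filter ℂ) ℂ)]
      exact inv_mem (by rw [inv_inv]; exact self_mem_realAdjoin _ _)
  have hE₃ : realAdjoin (germConst (W : Filter ℂ))
      ((fun z => z - 1 : ℂ → ℂ) : Germ (W : Filter ℂ) ℂ)
      = E := by
    refine realAdjoin_eq_of_mem ?_ ?_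
    · exact sub_mem (self_mem_realAdjoin (germConst (W : Filter ℂ)) _) (one_mem E)
    · have := add_mem (self_mem_realAdjoin (germConst (W : Filter ℂ))
        ((fun z => z - 1 : ℂ → ℂ) : Germ (W : Filter ℂ) ℂ)) (one_mem _)
      convert this using 1
      refine congrArg _ (funext fun z => ?_)
      simp
  rw [hE₂] at hjE₂
  rw [hE₃] at hjE₃
  have hle : ∀ {R : ℝ} [Fact (0 < R)] (j : Frac R →+* Germ (W : Filter ℂ) ℂ),
      (ratSubfield R).map j ≤ j.fieldRange := fun j => by
    rintro _ ⟨x, -, rfl⟩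
    exact ⟨x, rfl⟩
  have hEQ₁ : E ≤ j₁.fieldRange := hjE₁ ▸ hle j₁
  have hEQ₂ : E ≤ j₂.fieldRange := hjE₂ ▸ hle j₂
  have hQ : j₁.fieldRange ⊓ j₂.fieldRange = E :=
    le_antisymm (hjE₁ ▸ fieldRange_inf_fieldRange hW hj₁ hj₂) (le_inf hEQ₁ hEQ₂)
  have hρ : ∀ r, germConst (W : Filter ℂ) r ∈ E := const_mem_realAdjoin _ _
  have hfam₁ : GaloisFamily E fun τ => j₂ (toFrac (θ₁ τ)) := hjE₂ ▸ fam₁.map j₂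
  have hfam₂ : GaloisFamily E fun τ => j₁ (toFrac (θ₂ τ)) := hjE₁ ▸ fam₂.map j₁
  have hAg : ∀ h, (A h : Germ (W : Filter ℂ) ℂ) =
      ∑ g, j₁ (toFrac (Z g)) * j₂ (toFrac (E₁ g h)) := by
    intro h
    simp only [hj₁, hj₂]
    exact map_sum (Germ.coeRingHom (W : Filter ℂ)) _ _
  have hBg : ∀ h, (A h : Germ (W : Filter ℂ) ℂ) =
      ∑ g, j₂ (toFrac (Y g)) * j₁ (toFrac (E₂ g h)) := by
    intro h
    have : (A h : Germ (W : Filter ℂ) ℂ) = (B h : Germ (W : Filter ℂ) ℂ) := by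
      refine Germ.coe_eq.2 (hW2.mono fun z hz => ?_)
      rw [hA h z hz.1, hB h z hz.2, heq z hz.1 hz.2]
    rw [this]
    simp only [hj₁, hj₂]
    exact map_sum (Germ.coeRingHom (W : Filter ℂ)) _ _
  have ha₁ : (fun h => (A h : Germ (W : Filter ℂ) ℂ)) ∈
      inducedSubring j₁.fieldRange fun τ => j₂ (toFrac (θ₁ τ)) := by
    convert sum_mul_indicator_mem_inducedSubring hEQ₁ hfam₁
      (F₁.map ((germConst (W : Filter ℂ)).codRestrict E hρ))
      (y := fun g => j₁ (toFrac (Z g))) (fun g => ⟨_, rfl⟩) using 1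
    funext h
    rw [hAg]
    refine Finset.sum_congr rfl fun g _ => ?_
    rw [G₁.inducedMatrix_map _ (fun f : realHolo 2 => j₂ (toFrac f)) (by simp)]
    simp only [aeval_map_eq_chart j₂ hρ (fun r => hj₂ _)]
    rfl
  have ha₂ : (fun h => (A h : Germ (W : Filter ℂ) ℂ)) ∈
      inducedSubring j₂.fieldRange fun τ => j₁ (toFrac (θ₂ τ)) := by
    convert sum_mul_indicator_mem_inducedSubring hEQ₂ hfam₂
      (F₂.map ((germConst (W : Filter ℂ)).codRestrict E hρ))
      (y := fun g => j₂ (toFrac (Y g))) (fun g => ⟨_, rfl⟩) using 1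
    funext h
    rw [hBg]
    refine Finset.sum_congr rfl fun g _ => ?_
    rw [G₂.inducedMatrix_map _ (fun f : realHolo 2 => j₁ (toFrac f)) (by simp)]
    simp only [aeval_map_eq_chart j₁ hρ (fun r => hj₁ _)]
    rfl
  have hfA : ∀ h, j₃ (toFrac (f h)) = (A h : Germ (W : Filter ℂ) ℂ) := by
    intro h
    rw [hj₃]
    refine congrArg _ (funext fun z => ?_)
    rw [Function.comp_apply, hf, add_sub_cancel]
  have hcont : ∀ h, Tendsto (A h) W (𝓝 (A h 1)) := by
    intro h
    have h0 : ContinuousAt (f h).1 (1 - 1) := by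
      rw [sub_self]
      exact ((f h).2.1.differentiableAt (ball_mem_nhds _ (by norm_num))).continuousAt
    have h1 : ContinuousAt ((f h).1 ∘ fun z => z - 1) 1 :=
      ContinuousAt.comp (g := (f h).1) h0 (by fun_prop)
    have h2 : (f h).1 ∘ (fun z => z - 1) = A h := funext fun z => by
      rw [Function.comp_apply, hf, add_sub_cancel]
    rw [h2] at h1
    exact h1.tendsto.mono_left hW1
  have hainj : Function.Injective fun h => (A h : Germ (W : Filter ℂ) ℂ) := fun h h' hh =>
    hA1 (tendsto_nhds_unique (hcont h) ((hcont h').congr' (Germ.coe_eq.1 hh).symm))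
  refine GaloisFamily.of_map j₃ ?_
  rw [hjE₃]
  simp only [hfA]
  exact hfam₁.patch hG hQ (fun τ => ⟨_, rfl⟩) hfam₂ (fun τ => ⟨_, rfl⟩) hainj ha₁ ha₂

end PatchAssembly

section RationalParametrization

variable {K : Type*} [Field K]

theorem isCoprime_of_roots {E : Subfield K} {G : Type*} [Finite G] {θ : G → K}
    (hθ : Function.Injective θ) {q : E[X]} (hq : q.Monic) (hdeg : q.natDegree = Nat.card G)
    (hroot : ∀ g, aeval (θ g) q = 0) {p : E[X]} (hp : ∀ g, aeval (θ g) p ≠ 0) : IsCoprime p q := by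
  classical
  have := Fintype.ofFinite G
  rw [← isCoprime_map (algebraMap E K)]
  have hprod : q.map (algebraMap E K) = ∏ g, (X - C (θ g)) := by
    refine eq_of_monic_of_dvd_of_natDegree_le (monic_prod_X_sub_C θ _) (hq.map _) ?_ ?_
    · refine Finset.prod_dvd_of_coprime (fun g _ h _ hgh => ?_) fun g _ => ?_
      · exact isCoprime_X_sub_C_of_isUnit_sub (sub_ne_zero.2 (hθ.ne hgh)).isUnit
      · rw [dvd_iff_isRoot, IsRoot, eval_map_algebraMap]
        exact hroot g
    · rw [natDegree_map, hdeg, natDegree_prod_of_monic _ _ fun g _ => monic_X_sub_C _]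
      simp
  rw [hprod]
  refine IsCoprime.prod_right fun g _ => IsCoprime.symm ?_
  rw [(irreducible_X_sub_C (θ g)).coprime_iff_not_dvd, dvd_iff_isRoot, IsRoot, eval_map_algebraMap]
  exact hp g

theorem exists_aeval_eq_ratFunc {G : Type*} [Finite G] {ρ : ℝ →+* K} {x : K}
    {ψ : G → RatFunc ℝ →+* K} (hρ : ∀ g c, ψ g (RatFunc.C c) = ρ c)
    (hinj : Function.Injective fun g => ψ g RatFunc.X)
    {q : (realAdjoin ρ x)[X]} (hq : q.Monic) (hdeg : q.natDegree = Nat.card G)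
    (hroot : ∀ g, aeval (ψ g RatFunc.X) q = 0) (β : RatFunc ℝ) :
    ∃ p : (realAdjoin ρ x)[X], ∀ g, aeval (ψ g RatFunc.X) p = ψ g β := by
  let ρE : ℝ →+* realAdjoin ρ x := ρ.codRestrict _ (const_mem_realAdjoin ρ x)
  have hpoly : ∀ (P : ℝ[X]) g, aeval (ψ g RatFunc.X) (P.map ρE) = ψ g (algebraMap _ _ P) := by
    intro P g
    induction P using Polynomial.induction_on' with
    | add p q hp hq => rw [Polynomial.map_add, map_add, hp, hq, map_add, map_add]
    | monomial n a =>
      rw [map_monomial, aeval_monomial, ← C_mul_X_pow_eq_monomial, map_mul, map_pow,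
        RatFunc.algebraMap_C, RatFunc.algebraMap_X, map_mul, map_pow, hρ]
      rfl
  obtain ⟨P, Q, hQ, rfl⟩ := IsFractionRing.div_surjective (A := ℝ[X]) β
  have hQ0 : ∀ g, aeval (ψ g RatFunc.X) (Q.map ρE) ≠ 0 := fun g => by
    rw [hpoly, map_ne_zero_iff _ (ψ g).injective]
    exact IsFractionRing.to_map_ne_zero_of_mem_nonZeroDivisors hQ
  obtain ⟨a, b, hab⟩ := isCoprime_of_roots hinj hq hdeg hroot hQ0
  refine ⟨P.map ρE * a, fun g => ?_⟩
  have h1 := congrArg (aeval (ψ g RatFunc.X)) hab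
  rw [map_add, map_mul, map_mul, hroot, mul_zero, add_zero, map_one] at h1
  rw [map_mul, hpoly, map_div₀, eq_div_iff (by rw [← hpoly]; exact hQ0 g), ← hpoly Q, mul_assoc, h1,
    mul_one]

/-- A rational parametrization by conjugate parameters yields a Galois family. -/
theorem GaloisFamily.of_ratFunc {G : Type*} [Group G] [Finite G] {ρ : ℝ →+* K} {x : K}
    {ψ : G → RatFunc ℝ →+* K} (hρ : ∀ g c, ψ g (RatFunc.C c) = ρ c)
    (hinj : Function.Injective fun g => ψ g RatFunc.X) (r : RatFunc ℝ) (hr : ∀ g, ψ g r = x)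
    (htr : ∀ k, ∃ m, ∀ g, ψ (k * g) RatFunc.X = ψ g m)
    (hchar : ∃ q : (realAdjoin ρ x)[X], q.Monic ∧ q.natDegree = Nat.card G ∧
      ∀ g, aeval (ψ g RatFunc.X) q = 0) :
    GaloisFamily (realAdjoin ρ x) fun g => ψ g RatFunc.X where
  injective := hinj
  translate := fun k => by
    obtain ⟨q, hq, hdeg, hroot⟩ := hchar
    obtain ⟨m, hm⟩ := htr k
    obtain ⟨p, hp⟩ := exists_aeval_eq_ratFunc hρ hinj hq hdeg hroot m
    exact ⟨p, fun g => by rw [hm, hp]⟩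
  conj := fun p hp => by
    have hE : ∀ e ∈ realAdjoin ρ x, ∃ β, ∀ g, ψ g β = e := by
      intro e he
      induction he using Subfield.closure_induction with
      | mem y hy =>
        rcases hy with ⟨c, rfl⟩ | rfl
        · exact ⟨RatFunc.C c, fun g => hρ g c⟩
        · exact ⟨r, hr⟩
      | one => exact ⟨1, fun g => map_one _⟩
      | add y z _ _ hy hz =>
        obtain ⟨β, hβ⟩ := hy
        obtain ⟨γ, hγ⟩ := hz
        exact ⟨β + γ, fun g => by rw [map_add, hβ, hγ]⟩
      | neg y _ hy =>
        obtain ⟨β, hβ⟩ := hy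
        exact ⟨-β, fun g => by rw [map_neg, hβ]⟩
      | inv y _ hy =>
        obtain ⟨β, hβ⟩ := hy
        exact ⟨β⁻¹, fun g => by rw [map_inv₀, hβ]⟩
      | mul y z _ _ hy hz =>
        obtain ⟨β, hβ⟩ := hy
        obtain ⟨γ, hγ⟩ := hz
        exact ⟨β * γ, fun g => by rw [map_mul, hβ, hγ]⟩
    have hP : ∃ β, ∀ g, ψ g β = aeval (ψ g RatFunc.X) p := by
      clear hp
      induction p using Polynomial.induction_on' with
      | add p q hp hq =>
        obtain ⟨β, hβ⟩ := hp
        obtain ⟨γ, hγ⟩ := hq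
        exact ⟨β + γ, fun g => by rw [map_add, hβ, hγ, map_add]⟩
      | monomial n a =>
        obtain ⟨β, hβ⟩ := hE a a.2
        exact ⟨β * RatFunc.X ^ n, fun g => by rw [map_mul, map_pow, hβ, aeval_monomial]; rfl⟩
    obtain ⟨β, hβ⟩ := hP
    have hβ0 : β = 0 := (map_eq_zero_iff _ (ψ 1).injective).1 ((hβ 1).trans hp)
    exact fun g => by rw [← hβ, hβ0, map_zero]
  charpoly := hchar

end RationalParametrization

section TangentPolynomials

/-- The pair of polynomials expressing `cos (m φ - γ)` and `sin (m φ - γ)`, divided by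
`cos φ ^ m`, in terms of `tan φ`. -/
noncomputable def tanPoly (γ : ℝ) : ℕ → ℝ[X] × ℝ[X]
  | 0 => (C (Real.cos γ), C (-Real.sin γ))
  | m + 1 => ((tanPoly γ m).1 - X * (tanPoly γ m).2, (tanPoly γ m).2 + X * (tanPoly γ m).1)

theorem tanPoly_eval (γ : ℝ) (m : ℕ) {φ : ℂ} (hφ : Complex.cos φ ≠ 0) :
    (tanPoly γ m).1.eval₂ Complex.ofRealHom (Complex.tan φ) * Complex.cos φ ^ m =
        Complex.cos (m * φ - γ) ∧
      (tanPoly γ m).2.eval₂ Complex.ofRealHom (Complex.tan φ) * Complex.cos φ ^ m =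
        Complex.sin (m * φ - γ) := by
  induction m with
  | zero => simp [tanPoly]
  | succ m ih =>
    have ht : Complex.tan φ * Complex.cos φ = Complex.sin φ := Complex.tan_mul_cos hφ
    have hm : ((m + 1 : ℕ) : ℂ) * φ - γ = (m * φ - γ) + φ := by push_cast; ring
    rw [hm, Complex.cos_add, Complex.sin_add, ← ih.1, ← ih.2]
    simp only [tanPoly, eval₂_sub, eval₂_add, eval₂_mul, eval₂_X]
    constructor <;> rw [← ht] <;> ring

theorem tanPoly_natDegree_le (γ : ℝ) (m : ℕ) :
    (tanPoly γ m).1.natDegree ≤ m ∧ (tanPoly γ m).2.natDegree ≤ m := by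
  induction m with
  | zero => simp [tanPoly]
  | succ m ih =>
    have h : ∀ p : ℝ[X], p.natDegree ≤ m → (X * p).natDegree ≤ m + 1 := fun p hp =>
      natDegree_mul_le.trans (by rw [natDegree_X]; omega)
    exact ⟨(natDegree_sub_le_of_le (ih.1.trans m.le_succ) (h _ ih.2)).trans (by simp),
      natDegree_add_le_of_degree_le (ih.2.trans m.le_succ) (h _ ih.1)⟩

theorem tanPoly_coeff (γ : ℝ) (m : ℕ) :
    (tanPoly γ m).1.coeff m ^ 2 + (tanPoly γ m).2.coeff m ^ 2 = 1 := by
  induction m with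
  | zero => simp [tanPoly]
  | succ m ih =>
    simp only [tanPoly, coeff_sub, coeff_add, coeff_X_mul]
    rw [coeff_eq_zero_of_natDegree_lt (Nat.lt_succ_of_le (tanPoly_natDegree_le γ m).1),
      coeff_eq_zero_of_natDegree_lt (Nat.lt_succ_of_le (tanPoly_natDegree_le γ m).2)]
    linarith

end TangentPolynomials

section CyclicFamily

variable {K : Type*} [Field K]

theorem eval₂_ne_zero_of_mul_eq {ρ : ℝ →+* K} {x u : K}
    (hx : ∀ P : ℝ[X], P ≠ 0 → P.eval₂ ρ x ≠ 0) {D N : ℝ[X]} (hD : D.eval₂ ρ u ≠ 0)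
    (hN : x * D.eval₂ ρ u = N.eval₂ ρ u) {P : ℝ[X]} (hP : P ≠ 0) : P.eval₂ ρ u ≠ 0 := by
  intro h
  let := ρ.toAlgebra
  have hu : IsAlgebraic ℝ u := ⟨P, hP, h⟩
  have hpoly : ∀ Q : ℝ[X], IsIntegral ℝ (Q.eval₂ ρ u) := fun Q =>
    (Algebra.adjoin_le (S := integralClosure ℝ K) (Set.singleton_subset_iff.2 hu.isIntegral)
      (aeval_mem_adjoin_singleton ℝ u) :)
  have hxi : IsIntegral ℝ x := by
    rw [eq_div_of_mul_eq hD hN, div_eq_mul_inv]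
    exact (hpoly N).mul (hpoly D).inv
  obtain ⟨Q, hQ, hQx⟩ := hxi.isAlgebraic
  exact hx Q hQ hQx

theorem exists_charpoly_of_mul_eq {G : Type*} {ρ : ℝ →+* K} {x : K} {u : G → K}
    (hx : ∀ P : ℝ[X], P ≠ 0 → P.eval₂ ρ x ≠ 0) {D N : ℝ[X]} {n : ℕ} (hDn : D.natDegree ≤ n)
    (hNn : N.natDegree ≤ n) (hDN : D.coeff n ^ 2 + N.coeff n ^ 2 = 1)
    (hN : ∀ g, x * D.eval₂ ρ (u g) = N.eval₂ ρ (u g)) :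
    ∃ q : (realAdjoin ρ x)[X], q.Monic ∧ q.natDegree = n ∧ ∀ g, aeval (u g) q = 0 := by
  let ρE : ℝ →+* realAdjoin ρ x := ρ.codRestrict _ (const_mem_realAdjoin ρ x)
  let xE : realAdjoin ρ x := ⟨x, self_mem_realAdjoin ρ x⟩
  let P : (realAdjoin ρ x)[X] := N.map ρE - C xE * D.map ρE
  have hPn : P.natDegree ≤ n := by
    refine (natDegree_sub_le _ _).trans (max_le (natDegree_map_le.trans hNn) ?_)
    exact (natDegree_C_mul_le _ _).trans (natDegree_map_le.trans hDn)
  have hlead : P.coeff n ≠ 0 := by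
    intro h
    have h0 : (C (N.coeff n) - X * C (D.coeff n)).eval₂ ρ x = 0 := by
      have := congrArg Subtype.val h
      simp only [P, coeff_sub, coeff_C_mul, coeff_map] at this
      rw [eval₂_sub, eval₂_mul, eval₂_C, eval₂_C, eval₂_X]
      exact this
    refine hx _ (fun hz => ?_) h0
    have h1 := congrArg (fun p => p.coeff 0) hz
    have h2 := congrArg (fun p => p.coeff 1) hz
    simp only [coeff_sub, coeff_C_zero, mul_coeff_zero, coeff_X_zero, zero_mul, sub_zero,
      coeff_zero] at h1
    rw [coeff_sub, coeff_X_mul, coeff_C_zero, coeff_C_of_ne_zero one_ne_zero, coeff_zero] at h2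
    rw [h1, show D.coeff n = 0 by linarith] at hDN
    norm_num at hDN
  refine ⟨C (P.coeff n)⁻¹ * P, ?_, ?_, fun g => ?_⟩
  · refine monic_of_natDegree_le_of_coeff_eq_one n ((natDegree_C_mul_le _ _).trans hPn) ?_
    rw [coeff_C_mul, inv_mul_cancel₀ hlead]
  · rw [natDegree_C_mul (inv_ne_zero hlead)]
    exact natDegree_eq_of_le_of_coeff_ne_zero hPn hlead
  · have hmap : ∀ Q : ℝ[X], aeval (u g) (Q.map ρE) = Q.eval₂ ρ (u g) := fun Q => by
      rw [aeval_def, eval₂_map]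
      rfl
    rw [map_mul, map_sub, map_mul, hmap, hmap, aeval_C, aeval_C, ← hN]
    change _ * (x * _ - x * _) = 0
    rw [sub_self, mul_zero]

theorem GaloisFamily.of_rotations {G : Type*} [Group G] [Finite G] {ρ : ℝ →+* K} {x : K}
    {u : G → K} (hx : ∀ P : ℝ[X], P ≠ 0 → P.eval₂ ρ x ≠ 0) (hu : Function.Injective u)
    {D N : ℝ[X]} (hDn : D.natDegree ≤ Nat.card G)
    (hNn : N.natDegree ≤ Nat.card G)
    (hDN : D.coeff (Nat.card G) ^ 2 + N.coeff (Nat.card G) ^ 2 = 1)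
    (hD : ∀ g, D.eval₂ ρ (u g) ≠ 0) (hN : ∀ g, x * D.eval₂ ρ (u g) = N.eval₂ ρ (u g))
    (hrot : ∀ k, ∃ α : ℝ, ∀ g, u (k * g) * (ρ (Real.cos α) - ρ (Real.sin α) * u g) =
      ρ (Real.cos α) * u g + ρ (Real.sin α)) :
    GaloisFamily (realAdjoin ρ x) u := by
  have hinj : ∀ g, Function.Injective (eval₂RingHom ρ (u g)) := fun g => by
    rw [injective_iff_map_eq_zero]
    intro P hP
    by_contra h
    exact eval₂_ne_zero_of_mul_eq hx (hD g) (hN g) h hP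
  let ψ : G → RatFunc ℝ →+* K := fun g => IsFractionRing.lift (hinj g)
  have hψ : ∀ g (P : ℝ[X]), ψ g (algebraMap _ _ P) = P.eval₂ ρ (u g) := fun g P =>
    IsFractionRing.lift_algebraMap (hinj g) P
  have hψX : ∀ g, ψ g RatFunc.X = u g := fun g => by
    rw [← RatFunc.algebraMap_X, hψ, eval₂_X]
  have hψC : ∀ g c, ψ g (RatFunc.C c) = ρ c := fun g c => by
    rw [← RatFunc.algebraMap_C, hψ, eval₂_C]
  have key : GaloisFamily (realAdjoin ρ x) fun g => ψ g RatFunc.X := by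
    refine GaloisFamily.of_ratFunc hψC (by simpa only [hψX] using hu)
      (algebraMap _ _ N / algebraMap _ _ D) (fun g => ?_) (fun k => ?_) ?_
    · rw [map_div₀, hψ, hψ, ← hN, mul_div_cancel_right₀ _ (hD g)]
    · obtain ⟨α, hα⟩ := hrot k
      refine ⟨algebraMap _ _ (C (Real.cos α) * X + C (Real.sin α)) /
        algebraMap _ _ (C (Real.cos α) - C (Real.sin α) * X), fun g => ?_⟩
      have hne : C (Real.cos α) - C (Real.sin α) * X ≠ 0 := by
        intro hz
        have h1 := congrArg (fun p => p.coeff 0) hz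
        have h2 := congrArg (fun p => p.coeff 1) hz
        simp only [coeff_sub, coeff_C_zero, mul_coeff_zero, coeff_X_zero, mul_zero, sub_zero,
          coeff_zero] at h1
        rw [coeff_sub, coeff_C_mul, coeff_X_one, coeff_C_of_ne_zero one_ne_zero, coeff_zero] at h2
        have := Real.sin_sq_add_cos_sq α
        rw [h1, show Real.sin α = 0 by linarith] at this
        norm_num at this
      have hne' := eval₂_ne_zero_of_mul_eq hx (hD g) (hN g) hne
      rw [map_div₀, hψ, hψ, hψX, eq_div_iff hne']
      simp only [eval₂_sub, eval₂_add, eval₂_mul, eval₂_C, eval₂_X]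
      exact hα g
    · simpa only [hψX] using exists_charpoly_of_mul_eq hx hDn hNn hDN hN
  simpa only [hψX] using key

end CyclicFamily

section CyclicGroups

open Filter Metric Topology DiscRing

/-- The angles whose tangents parametrize the cyclic extension of degree `n`. -/
noncomputable def phase (n k : ℕ) (z : ℂ) : ℂ :=
  (Complex.arctan z + Real.pi * k) / n + Real.pi / (3 * n)

theorem arctan_zero_complex : Complex.arctan 0 = 0 := by
  simp [Complex.arctan]

theorem phase_add {n : ℕ} (k l : ℕ) (z : ℂ) :
    phase n (k + l) z = phase n l z + ((Real.pi * k / n : ℝ) : ℂ) := by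
  unfold phase
  push_cast
  ring

theorem tan_phase_mod {n : ℕ} (hn : n ≠ 0) (k : ℕ) (z : ℂ) :
    Complex.tan (phase n (k % n) z) = Complex.tan (phase n k z) := by
  have h : phase n k z = phase n (k % n) z + (k / n : ℕ) * Real.pi := by
    have hk : (k : ℂ) = n * (k / n : ℕ) + (k % n : ℕ) := by
      exact_mod_cast (Nat.div_add_mod k n).symm
    have hn' : (n : ℂ) ≠ 0 := by exact_mod_cast hn
    unfold phase
    rw [hk]
    field_simp
    ring
  rw [h]
  exact (Complex.tan_add_nat_mul_pi _ _).symm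

theorem phase_sub {n : ℕ} (k l : ℕ) (z : ℂ) :
    phase n k z - phase n l z = Real.pi * (k - l) / n := by
  unfold phase
  ring

theorem cos_phase_zero_ne_zero {n : ℕ} (hn : n ≠ 0) (k : ℕ) : Complex.cos (phase n k 0) ≠ 0 := by
  rw [Complex.cos_ne_zero_iff]
  intro m hm
  have hn' : (n : ℂ) ≠ 0 := by exact_mod_cast hn
  have hpi : (Real.pi : ℂ) ≠ 0 := by exact_mod_cast Real.pi_ne_zero
  have h : (2 * (3 * k + 1) : ℂ) = 3 * (n * (2 * m + 1)) := by
    have h0 : phase n k 0 = Real.pi * (3 * k + 1) / (3 * n) := by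
      unfold phase
      rw [arctan_zero_complex]
      field_simp
      ring
    rw [h0, div_eq_div_iff (mul_ne_zero three_ne_zero hn') two_ne_zero] at hm
    refine mul_left_cancel₀ hpi ?_
    linear_combination hm
  have h' : (2 * (3 * k + 1) : ℤ) = 3 * (n * (2 * m + 1)) := by exact_mod_cast h
  generalize (n : ℤ) * (2 * m + 1) = t at h'
  omega

theorem eq_of_tan_phase_zero {n : ℕ} (hn : n ≠ 0) {k l : ℕ} (hk : k < n) (hl : l < n)
    (h : Complex.tan (phase n k 0) = Complex.tan (phase n l 0)) : k = l := by
  have hn' : (n : ℂ) ≠ 0 := by exact_mod_cast hn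
  have hpi : (Real.pi : ℂ) ≠ 0 := by exact_mod_cast Real.pi_ne_zero
  rw [Complex.tan_eq_sin_div_cos, Complex.tan_eq_sin_div_cos,
    div_eq_div_iff (cos_phase_zero_ne_zero hn k) (cos_phase_zero_ne_zero hn l)] at h
  have hs : Complex.sin (phase n k 0 - phase n l 0) = 0 := by
    rw [Complex.sin_sub, h]
    ring
  rw [Complex.sin_eq_zero_iff] at hs
  obtain ⟨m, hm⟩ := hs
  rw [phase_sub, div_eq_iff hn'] at hm
  have h1 : (k - l : ℂ) = n * m := by
    refine mul_left_cancel₀ hpi ?_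
    linear_combination hm
  have h2 : (k - l : ℤ) = n * m := by exact_mod_cast h1
  have h3 : (k - l : ℤ) = 0 := Int.eq_zero_of_abs_lt_dvd ⟨m, h2⟩ (by rw [abs_lt]; omega)
  omega

theorem tanPoly_eval_phase {n : ℕ} (hn : n ≠ 0) (k : ℕ) {z : ℂ} (hz : z ≠ Complex.I)
    (hz' : z ≠ -Complex.I) (hc : Complex.cos (phase n k z) ≠ 0) :
    (tanPoly (Real.pi / 3) n).1.eval₂ Complex.ofRealHom (Complex.tan (phase n k z)) ≠ 0 ∧
      z * (tanPoly (Real.pi / 3) n).1.eval₂ Complex.ofRealHom (Complex.tan (phase n k z)) =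
        (tanPoly (Real.pi / 3) n).2.eval₂ Complex.ofRealHom (Complex.tan (phase n k z)) := by
  have hn' : (n : ℂ) ≠ 0 := by exact_mod_cast hn
  have htan := Complex.tan_arctan hz hz'
  have hcos : Complex.cos (Complex.arctan z) ≠ 0 := by
    intro h
    rw [Complex.tan_eq_sin_div_cos, h, div_zero] at htan
    rw [← htan, arctan_zero_complex, Complex.cos_zero] at h
    exact one_ne_zero h
  have hphase : n * phase n k z - ((Real.pi / 3 : ℝ) : ℂ) = Complex.arctan z + k * Real.pi := by
    unfold phase
    push_cast
    field_simp
    ring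
  obtain ⟨h1, h2⟩ := tanPoly_eval (Real.pi / 3) n hc
  have hsin : Complex.sin (k * Real.pi) = 0 := Complex.sin_nat_mul_pi k
  have hcosk : Complex.cos (k * Real.pi) ≠ 0 := fun h => by
    have := Complex.sin_sq_add_cos_sq (k * Real.pi)
    rw [hsin, h] at this
    norm_num at this
  rw [hphase, Complex.cos_add, hsin, mul_zero, sub_zero] at h1
  rw [hphase, Complex.sin_add, hsin, mul_zero, add_zero] at h2
  refine ⟨fun h => ?_, mul_right_cancel₀ (pow_ne_zero n hc) ?_⟩
  · rw [h, zero_mul] at h1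
    exact mul_ne_zero hcos hcosk h1.symm
  · rw [mul_assoc, h1, h2]
    have : Complex.sin (Complex.arctan z) = z * Complex.cos (Complex.arctan z) := by
      rw [← Complex.tan_mul_cos hcos, htan]
    rw [this]
    ring

theorem eventually_phase {n : ℕ} (hn : n ≠ 0) : ∀ᶠ z in 𝓝 (0 : ℂ), z ≠ Complex.I ∧
    z ≠ -Complex.I ∧ DifferentiableAt ℂ Complex.arctan z ∧
      ∀ k < 2 * n, Complex.cos (phase n k z) ≠ 0 := by
  have hI : ∀ᶠ z in 𝓝 (0 : ℂ), z ≠ Complex.I := eventually_ne_nhds Complex.I_ne_zero.symm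
  have hI' : ∀ᶠ z in 𝓝 (0 : ℂ), z ≠ -Complex.I :=
    eventually_ne_nhds (neg_ne_zero.2 Complex.I_ne_zero).symm
  have hden : ∀ z : ℂ, z ≠ -Complex.I → 1 - z * Complex.I ≠ 0 := fun z hz h => hz (by
    have := Complex.I_mul_I
    linear_combination Complex.I * h + z * this)
  have hdiff : ∀ z : ℂ, z ≠ -Complex.I →
      (1 + z * Complex.I) / (1 - z * Complex.I) ∈ Complex.slitPlane →
      DifferentiableAt ℂ Complex.arctan z := fun z hz hs => by
    have h1 := hden z hz
    unfold Complex.arctan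
    have h2 : DifferentiableAt ℂ (fun z : ℂ => (1 + z * Complex.I) / (1 - z * Complex.I)) z :=
      DifferentiableAt.fun_div (by fun_prop) (by fun_prop) h1
    exact (h2.clog hs).const_mul _
  have hslit : ∀ᶠ z in 𝓝 (0 : ℂ),
      (1 + z * Complex.I) / (1 - z * Complex.I) ∈ Complex.slitPlane := by
    have hcont : ContinuousAt (fun z : ℂ => (1 + z * Complex.I) / (1 - z * Complex.I)) 0 :=
      ContinuousAt.div (by fun_prop) (by fun_prop) (by simp)
    refine hcont.eventually (Complex.isOpen_slitPlane.eventually_mem ?_)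
    simp
  have hcos : ∀ᶠ z in 𝓝 (0 : ℂ), ∀ k < 2 * n, Complex.cos (phase n k z) ≠ 0 := by
    have := (Set.finite_lt_nat (2 * n)).eventually_all (l := 𝓝 (0 : ℂ))
      (p := fun k z => Complex.cos (phase n k z) ≠ 0)
    refine this.2 fun k _ => ?_
    have harc : ContinuousAt Complex.arctan 0 :=
      (hdiff 0 (neg_ne_zero.2 Complex.I_ne_zero).symm hslit.self_of_nhds).continuousAt
    have : ContinuousAt (fun z => Complex.cos (phase n k z)) 0 := by
      unfold phase
      fun_prop
    exact this.eventually_ne (cos_phase_zero_ne_zero hn k)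
  filter_upwards [hI, hI', hslit, hcos] with z h1 h2 h3 h4
  exact ⟨h1, h2, hdiff z h2 h3, h4⟩

theorem hasRealFamily_zmod (n : ℕ) [NeZero n] : HasRealFamily (Multiplicative (ZMod n)) := by
  have hn : n ≠ 0 := NeZero.ne n
  obtain ⟨R, hR, hball⟩ := Metric.eventually_nhds_iff_ball.1 (eventually_phase hn)
  have : Fact (0 < R) := ⟨hR⟩
  have hcos : ∀ (k : ZMod n), ∀ z ∈ ball (0 : ℂ) R, Complex.cos (phase n k.val z) ≠ 0 :=
    fun k z hz => (hball z hz).2.2.2 _ (by have := k.val_lt; omega)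
  let θ : Multiplicative (ZMod n) → realHolo R := fun k =>
    ⟨fun z => Complex.tan (phase n k.toAdd.val z), fun z hz => by
      refine DifferentiableAt.differentiableWithinAt ?_
      refine (Complex.differentiableAt_tan.2 (hcos k.toAdd z hz)).comp z ?_
      have := (hball z hz).2.2.1
      unfold phase
      fun_prop, fun x _ => by
      have : phase n k.toAdd.val x = (((Real.arctan x + Real.pi * k.toAdd.val) / n +
          Real.pi / (3 * n) : ℝ) : ℂ) := by
        unfold phase
        push_cast
        rfl
      change (Complex.tan _).im = 0
      rw [this, ← Complex.ofReal_tan, Complex.ofReal_im]⟩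
  have hθ0 : Function.Injective fun g => (θ g).1 0 := fun k l h =>
    Multiplicative.toAdd.injective (ZMod.val_injective n
      (eq_of_tan_phase_zero hn (ZMod.val_lt _) (ZMod.val_lt _) h))
  have heval : ∀ (f : realHolo R) (P : ℝ[X]),
      P.eval₂ ((toFrac (R := R)).comp (const R)) (toFrac f) = toFrac (P.eval₂ (const R) f) :=
    fun f P => (hom_eval₂ P _ toFrac f).symm
  have heval' : ∀ (f : realHolo R) (P : ℝ[X]) (z : ℂ),
      (P.eval₂ (const R) f).1 z = P.eval₂ Complex.ofRealHom (f.1 z) := fun f P z =>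
    hom_eval₂ P (const R) ((Pi.evalRingHom (fun _ => ℂ) z).comp (realHolo R).subtype) f
  have hkey : ∀ (g : Multiplicative (ZMod n)), ∀ z ∈ ball (0 : ℂ) R, _ := fun g z hz =>
    tanPoly_eval_phase hn g.toAdd.val (hball z hz).1 (hball z hz).2.1 (hcos g.toAdd z hz)
  have hcard : Nat.card (Multiplicative (ZMod n)) = n := Nat.card_zmod n
  have heq : ∀ {f g : realHolo R}, Set.EqOn f.1 g.1 (ball 0 R) → toFrac f = toFrac g :=
    fun h => congrArg (algebraMap _ _) (mk_eq_mk.2 h)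
  refine ⟨R, ⟨hR⟩, θ, hθ0, GaloisFamily.of_rotations (D := (tanPoly (Real.pi / 3) n).1)
    (N := (tanPoly (Real.pi / 3) n).2) (fun P hP => ?_) (fun k l h => hθ0 ?_)
    (by rw [hcard]; exact (tanPoly_natDegree_le _ n).1)
    (by rw [hcard]; exact (tanPoly_natDegree_le _ n).2) (by rw [hcard]; exact tanPoly_coeff _ n)
    (fun g h => ?_) (fun g => ?_) fun k => ⟨Real.pi * k.toAdd.val / n, fun g => ?_⟩⟩
  · rw [heval, ← polyHolo_eq]
    exact toFrac_polyHolo_ne_zero hP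
  · have h' : toFrac (θ k - θ l) = 0 := by rw [map_sub]; exact sub_eq_zero.2 h
    exact sub_eq_zero.1 (toFrac_eq_zero.1 h' (mem_ball_self hR))
  · rw [heval, toFrac_eq_zero] at h
    have h0 := h (mem_ball_self hR)
    rw [heval'] at h0
    exact (hkey g 0 (mem_ball_self hR)).1 h0
  · rw [heval, heval, ← map_mul]
    refine heq fun z hz => ?_
    change z * (eval₂ _ _ _ : realHolo R).1 z = _
    rw [heval', heval']
    exact (hkey g z hz).2
  · rw [RingHom.comp_apply, RingHom.comp_apply, ← map_mul, ← map_mul, ← map_sub, ← map_add,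
      ← map_mul]
    refine heq fun z hz => ?_
    change Complex.tan (phase n (k.toAdd + g.toAdd).val z) * (((Real.cos _ : ℝ) : ℂ) -
      ((Real.sin _ : ℝ) : ℂ) * Complex.tan (phase n g.toAdd.val z)) =
      ((Real.cos _ : ℝ) : ℂ) * Complex.tan (phase n g.toAdd.val z) + ((Real.sin _ : ℝ) : ℂ)
    rw [ZMod.val_add, tan_phase_mod hn]
    have h1 := (hball z hz).2.2.2 (k.toAdd.val + g.toAdd.val)
      (by have := k.toAdd.val_lt; have := g.toAdd.val_lt; omega)
    have h2 := hcos g.toAdd z hz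
    rw [phase_add] at h1 ⊢
    generalize phase n g.toAdd.val z = a at h1 h2 ⊢
    generalize Real.pi * k.toAdd.val / n = b at h1 ⊢
    rw [Complex.ofReal_cos, Complex.ofReal_sin]
    refine mul_right_cancel₀ h2 ?_
    have e1 := Complex.tan_mul_cos h1
    have e2 := Complex.tan_mul_cos h2
    rw [Complex.cos_add, Complex.sin_add] at e1
    linear_combination e1 - (Complex.tan (a + b) * Complex.sin b + Complex.cos b) * e2

theorem HasRealFamily.of_mulEquiv {G G' : Type*} [Group G] [Group G'] (e : G' ≃* G)
    (h : HasRealFamily G) : HasRealFamily G' := by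
  obtain ⟨R, hR, θ, h0, hθ⟩ := h
  exact ⟨R, hR, fun g => θ (e g), h0.comp e.injective, hθ.comp_mulEquiv e⟩

theorem hasRealFamily_of_isCyclic (G : Type*) [Group G] [Finite G] [hG : IsCyclic G] :
    HasRealFamily G :=
  have : NeZero (Nat.card G) := ⟨Nat.card_pos.ne'⟩
  (hasRealFamily_zmod (Nat.card G)).of_mulEquiv (zmodCyclicMulEquiv hG).symm

/-- Every finite group is the group of a Galois family over the real rational functions. -/
theorem hasRealFamily (G : Type*) [Group G] [Finite G] : HasRealFamily G := by
  induction hn : Nat.card G using Nat.strong_induction_on generalizing G with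
  | _ n ih =>
    subst hn
    by_cases hG : IsCyclic G
    · exact hasRealFamily_of_isCyclic G
    have : Nontrivial (Subgroup G) := by
      rw [Subgroup.nontrivial_iff]
      by_contra h
      rw [not_nontrivial_iff_subsingleton] at h
      exact hG inferInstance
    obtain ⟨M, hM, -⟩ := (eq_top_or_exists_le_coatom (⊥ : Subgroup G)).resolve_left bot_ne_top
    obtain ⟨g, hg⟩ : ∃ g, g ∉ M := by
      by_contra! h
      exact hM.1 (eq_top_iff.2 fun g _ => h g)
    have hlt : ∀ S : Subgroup G, S ≠ ⊤ → HasRealFamily S := fun S hS =>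
      ih _ ((Subgroup.card_le_card_group S).lt_of_ne fun h =>
        hS (Subgroup.eq_top_of_card_eq S h)) S rfl
    refine HasRealFamily.sup (G₁ := M) (G₂ := Subgroup.zpowers g) ?_ (hlt M hM.1)
      (hasRealFamily_of_isCyclic _)
    exact hM.2 _ (lt_of_le_of_ne le_sup_left fun h => hg
      (h ▸ le_sup_right (a := M) (Subgroup.mem_zpowers g)))

end CyclicGroups

section OreFractions

variable {R F D : Type*} [Ring R] [DivisionRing F] [DivisionRing D] {φ : R →+* F}

theorem IsClassicalRightQuotient.exists_common_denom (hφ : IsClassicalRightQuotient φ)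
    {ι : Type*} (a : ι → F) (s : Finset ι) :
    ∃ b : R, b ≠ 0 ∧ ∀ i ∈ s, ∃ r, a i * φ b = φ r := by
  classical
  induction s using Finset.induction_on with
  | empty =>
    obtain ⟨_, b, hb, -⟩ := hφ.2 0
    exact ⟨b, hb, by simp⟩
  | insert i s _ ih =>
    obtain ⟨b, hb, h⟩ := ih
    obtain ⟨c, d, hd, hcd⟩ := hφ.2 (a i * φ b)
    have hφb : φ b ≠ 0 := (map_ne_zero_iff φ hφ.1).2 hb
    have hφd : φ d ≠ 0 := (map_ne_zero_iff φ hφ.1).2 hd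
    refine ⟨b * d, fun h0 => mul_ne_zero hφb hφd (by rw [← map_mul, h0, map_zero]),
      fun j hj => ?_⟩
    rcases Finset.mem_insert.1 hj with rfl | hj
    · exact ⟨c, by rw [map_mul, ← mul_assoc, hcd, inv_mul_cancel_right₀ hφd]⟩
    · obtain ⟨r, hr⟩ := h j hj
      exact ⟨r * d, by rw [map_mul, ← mul_assoc, hr, map_mul]⟩

/-- Injective homomorphisms to division rings extend to classical quotient rings. -/
theorem IsClassicalRightQuotient.exists_lift (hφ : IsClassicalRightQuotient φ) {ev : R →+* D}
    (hev : Function.Injective ev) : ∃ j : F →+* D, ∀ r, j (φ r) = ev r := by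
  have hφ0 : ∀ {b}, b ≠ 0 → φ b ≠ 0 := fun h => (map_ne_zero_iff φ hφ.1).2 h
  have hev0 : ∀ {b}, b ≠ 0 → ev b ≠ 0 := fun h => (map_ne_zero_iff ev hev).2 h
  have hore : ∀ a b : R, b ≠ 0 → ∃ c d, d ≠ 0 ∧ a * d = b * c := fun a b hb => by
    obtain ⟨c, d, hd, h⟩ := hφ.2 ((φ b)⁻¹ * φ a)
    refine ⟨c, d, hd, hφ.1 ?_⟩
    rw [eq_mul_inv_iff_mul_eq₀ (hφ0 hd), mul_assoc, inv_mul_eq_iff_eq_mul₀ (hφ0 hb)] at h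
    rw [map_mul, map_mul, h]
  have hmul : ∀ {a b : R}, a ≠ 0 → b ≠ 0 → a * b ≠ 0 := fun ha hb h =>
    mul_ne_zero (hφ0 ha) (hφ0 hb) (by rw [← map_mul, h, map_zero])
  choose num den hden hx using hφ.2
  have hx' : ∀ x, x * φ (den x) = φ (num x) := fun x =>
    (eq_mul_inv_iff_mul_eq₀ (hφ0 (hden x))).1 (hx x)
  let j : F → D := fun x => ev (num x) * (ev (den x))⁻¹
  have hj' : ∀ x, j x * ev (den x) = ev (num x) := fun x => inv_mul_cancel_right₀ (hev0 (hden x)) _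
  have hj : ∀ x a b, b ≠ 0 → x * φ b = φ a → j x * ev b = ev a := by
    intro x a b hb hab
    obtain ⟨c, d, hd, hcd⟩ := hore b (den x) (hden x)
    have h1 : a * d = num x * c := hφ.1 <| by
      rw [map_mul, map_mul, ← hab, ← hx', mul_assoc, mul_assoc, ← map_mul, hcd, map_mul]
    refine mul_right_cancel₀ (hev0 hd) ?_
    rw [mul_assoc, ← map_mul, ← map_mul, hcd, h1, map_mul, ← mul_assoc, hj', map_mul]
  have hu : ∀ x a b y, b ≠ 0 → x * φ b = φ a → y * ev b = ev a → j x = y :=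
    fun x a b y hb h h' => mul_right_cancel₀ (hev0 hb) ((hj x a b hb h).trans h'.symm)
  have hφj : ∀ r, j (φ r) = ev r := fun r => by
    obtain ⟨_, d, hd, -⟩ := hφ.2 0
    exact hu _ (r * d) d _ hd (map_mul _ _ _).symm (map_mul _ _ _).symm
  refine ⟨⟨⟨⟨j, ?_⟩, fun x y => ?_⟩, ?_, fun x y => ?_⟩, hφj⟩
  · rw [← map_one φ, hφj, map_one]
  · obtain ⟨c, d, hd, hcd⟩ := hore (num y) (den x) (hden x)
    refine hu _ (num x * c) (den y * d) _ (hmul (hden y) hd) ?_ ?_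
    · rw [map_mul, ← mul_assoc, mul_assoc x, hx', mul_assoc, ← map_mul, hcd, map_mul, ← mul_assoc,
        hx', map_mul]
    · rw [map_mul, ← mul_assoc, mul_assoc (j x), hj', mul_assoc, ← map_mul, hcd, map_mul,
        ← mul_assoc, hj', map_mul]
  · change j 0 = 0
    rw [← map_zero φ, hφj, map_zero]
  · obtain ⟨c, d, hd, hcd⟩ := hore (den y) (den x) (hden x)
    refine hu _ (num x * c + num y * d) (den y * d) _ (hmul (hden y) hd) ?_ ?_
    · rw [add_mul]
      conv_lhs => enter [1]; rw [hcd]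
      rw [map_mul, map_mul, ← mul_assoc, ← mul_assoc, hx', hx', map_add, map_mul, map_mul]
    · rw [add_mul]
      conv_lhs => enter [1]; rw [hcd]
      rw [map_mul, map_mul, ← mul_assoc, ← mul_assoc, hj', hj', map_add, map_mul, map_mul]

end OreFractions

section PolynomialFunctions

variable {H : Type*} [DivisionRing H]

theorem const_mem_polyFunRing (c : H) : (fun _ => c) ∈ polyFunRing H :=
  Subring.subset_closure (Or.inl ⟨c, rfl⟩)

theorem id_mem_polyFunRing : id ∈ polyFunRing H :=
  Subring.subset_closure (Or.inr rfl)

/-- The ring of additive endomorphisms generated by left and right multiplications. -/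
def multiplicationRing (H : Type*) [DivisionRing H] : Subring (AddMonoid.End H) :=
  Subring.closure (Set.range AddMonoid.End.mulLeft ∪ Set.range AddMonoid.End.mulRight)

theorem multiplicationRing_comp_mem {T : AddMonoid.End H} (hT : T ∈ multiplicationRing H) :
    ∀ f ∈ polyFunRing H, (fun h => T (f h)) ∈ polyFunRing H := by
  induction hT using Subring.closure_induction with
  | mem T hT =>
    intro f hf
    rcases hT with ⟨a, rfl⟩ | ⟨a, rfl⟩
    · exact mul_mem (const_mem_polyFunRing a) hf
    · exact mul_mem hf (const_mem_polyFunRing a)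
  | zero => exact fun f _ => zero_mem _
  | one => exact fun f hf => hf
  | add S T _ _ hS hT => exact fun f hf => add_mem (hS f hf) (hT f hf)
  | neg T _ hT => exact fun f hf => neg_mem (hT f hf)
  | mul S T _ _ hS hT => exact fun f hf => hS _ (hT f hf)

theorem multiplicationRing_map_center_mul {T : AddMonoid.End H} (hT : T ∈ multiplicationRing H)
    (c : Subring.center H) : ∀ h : H, T (c * h) = c * T h := by
  have hc : ∀ a : H, a * c = c * a := fun a => Subring.mem_center_iff.1 c.2 a
  induction hT using Subring.closure_induction with
  | mem T hT =>
    intro h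
    rcases hT with ⟨a, rfl⟩ | ⟨a, rfl⟩
    · change a * (c * h) = c * (a * h)
      rw [← mul_assoc, hc, mul_assoc]
    · exact mul_assoc _ _ _
  | zero => exact fun h => (mul_zero _).symm
  | one => exact fun h => rfl
  | add S T _ _ hS hT =>
    intro h
    change S (c * h) + T (c * h) = c * (S h + T h)
    rw [hS, hT, mul_add]
  | neg T _ hT =>
    intro h
    change -T (c * h) = c * -T h
    rw [hT, mul_neg]
  | mul S T _ _ hS hT =>
    intro h
    change S (T (c * h)) = c * S (T h)
    rw [hT, hS]

instance : IsSimpleModule (multiplicationRing H) H := by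
  rw [isSimpleModule_iff_toSpanSingleton_surjective]
  refine ⟨inferInstance, fun v hv w => ?_⟩
  refine ⟨⟨AddMonoid.End.mulLeft (w * v⁻¹), Subring.subset_closure (Or.inl ⟨_, rfl⟩)⟩, ?_⟩
  change w * v⁻¹ * v = w
  rw [inv_mul_cancel_right₀ hv]

theorem exists_center_of_multiplicationRing_end (f : Module.End (multiplicationRing H) H) :
    ∃ c : Subring.center H, ∀ h, f h = c * h := by
  have hl : ∀ a h, f (a * h) = a * f h := fun a h =>
    f.map_smul ⟨AddMonoid.End.mulLeft a, Subring.subset_closure (Or.inl ⟨_, rfl⟩)⟩ h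
  have hr : ∀ a h, f (h * a) = f h * a := fun a h =>
    f.map_smul ⟨AddMonoid.End.mulRight a, Subring.subset_closure (Or.inr ⟨_, rfl⟩)⟩ h
  have h1 : ∀ h, f h = f 1 * h := fun h => by rw [← hr, one_mul]
  refine ⟨⟨f 1, Subring.mem_center_iff.2 fun h => ?_⟩, h1⟩
  rw [← h1, ← hl, mul_one]

/-- Linear maps of a division ring which is finite over its center are polynomial functions. -/
theorem linearMap_mem_polyFunRing [FiniteDimensional (Subring.center H) H]
    (T : H →ₗ[Subring.center H] H) : (fun h => T h) ∈ polyFunRing H := by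
  classical
  let T' : Module.End (Module.End (multiplicationRing H) H) H :=
    { toFun := T
      map_add' := T.map_add
      map_smul' := fun f h => by
        obtain ⟨c, hc⟩ := exists_center_of_multiplicationRing_end f
        change T (f h) = f (T h)
        rw [hc, hc]
        exact T.map_smul c h }
  let b := Module.finBasis (Subring.center H) H
  obtain ⟨S, hS⟩ := jacobson_density T' (Finset.univ.image b)
  let S' : H →ₗ[Subring.center H] H :=
    { toFun := S.1
      map_add' := S.1.map_add
      map_smul' := fun c h => multiplicationRing_map_center_mul S.2 c h }
  have hTS : T = S' := b.ext fun i => hS (b i) (Finset.mem_image_of_mem _ (Finset.mem_univ i))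
  rw [hTS]
  exact multiplicationRing_comp_mem S.2 id id_mem_polyFunRing

theorem exists_central_coordinate [FiniteDimensional (Subring.center H) H] :
    ∃ x : H →ₗ[Subring.center H] Subring.center H, (∀ c : Subring.center H, x c = c) ∧
      (fun h => (x h : H)) ∈ polyFunRing H := by
  have hinj : Function.Injective (Algebra.linearMap (Subring.center H) H) :=
    Subtype.val_injective
  obtain ⟨x, hx⟩ := LinearMap.exists_leftInverse_of_injective _ (LinearMap.ker_eq_bot.2 hinj)
  exact ⟨x, fun c => LinearMap.congr_fun hx c,
    linearMap_mem_polyFunRing ((Algebra.linearMap (Subring.center H) H) ∘ₗ x)⟩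

theorem exists_polynomial_on_line {f : H → H} (hf : f ∈ polyFunRing H) (h : H) :
    ∃ p : H[X], ∀ t : Subring.center H, f (h + t) = p.eval (t : H) := by
  induction hf using Subring.closure_induction with
  | mem f hf =>
    rcases hf with ⟨c, rfl⟩ | rfl
    · exact ⟨C c, fun t => eval_C.symm⟩
    · exact ⟨C h + X, fun t => by rw [eval_add, eval_C, eval_X]; rfl⟩
  | zero => exact ⟨0, fun t => eval_zero.symm⟩
  | one => exact ⟨1, fun t => eval_one.symm⟩
  | add f g _ _ hf hg =>
    obtain ⟨p, hp⟩ := hf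
    obtain ⟨q, hq⟩ := hg
    exact ⟨p + q, fun t => by rw [eval_add, ← hp, ← hq]; rfl⟩
  | neg f _ hf =>
    obtain ⟨p, hp⟩ := hf
    exact ⟨-p, fun t => by rw [eval_neg, ← hp]; rfl⟩
  | mul f g _ _ hf hg =>
    obtain ⟨p, hp⟩ := hf
    obtain ⟨q, hq⟩ := hg
    refine ⟨p * q, fun t => ?_⟩
    have := eval₂_mul_noncomm (p := p) (q := q) (RingHom.id H) (t : H)
      fun k => Subring.mem_center_iff.1 t.2 _
    exact (congrArg₂ (· * ·) (hp t) (hq t)).trans this.symm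

end PolynomialFunctions

section RealFunctionals

variable {H : Type*} [DivisionRing H] [Algebra ℝ H]

/-- The real polynomial obtained by applying a functional to the coefficients. -/
noncomputable def coeffFunctional (l : Module.Dual ℝ H) (p : H[X]) : ℝ[X] :=
  ∑ i ∈ Finset.range (p.natDegree + 1), monomial i (l (p.coeff i))

theorem coeff_coeffFunctional (l : Module.Dual ℝ H) (p : H[X]) (n : ℕ) :
    (coeffFunctional l p).coeff n = l (p.coeff n) := by
  simp only [coeffFunctional, finsetSum_coeff, coeff_monomial, Finset.sum_ite_eq',
    Finset.mem_range]
  split_ifs with h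
  · rfl
  · rw [coeff_eq_zero_of_natDegree_lt (by omega), map_zero]

theorem functional_eval_mul (l : Module.Dual ℝ H) (p : H[X]) (s m : ℝ) :
    l (p.eval (algebraMap ℝ H s) * algebraMap ℝ H m) = (coeffFunctional l p).eval s * m := by
  rw [← Algebra.commutes, ← Algebra.smul_def, map_smul, smul_eq_mul, mul_comm, eval_eq_sum_range,
    map_sum, coeffFunctional, eval_finsetSum]
  congr 1
  refine Finset.sum_congr rfl fun i _ => ?_
  rw [eval_monomial, ← map_pow, ← Algebra.commutes, ← Algebra.smul_def, map_smul, smul_eq_mul,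
    mul_comm]

theorem eq_zero_of_coeffFunctional {p : H[X]} (h : ∀ l, coeffFunctional l p = 0) : p = 0 := by
  ext n
  rw [coeff_zero, ← Module.forall_dual_apply_eq_zero_iff ℝ]
  exact fun l => by rw [← coeff_coeffFunctional, h, coeff_zero]

end RealFunctionals

section RealGerms

open Filter Metric Topology DiscRing

/-- Real constants as germs. -/
def realGermConst {ι : Type*} (W : Filter ι) : ℝ →+* Germ W ℝ :=
  (Germ.coeRingHom W).comp (Pi.constRingHom ι ℝ)

/-- A ring homomorphism applied to the values of germs. -/
def germMap {ι : Type*} (W : Filter ι) {A B : Type*} [Ring A] [Ring B] (f : A →+* B) :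
    Germ W A →+* Germ W B where
  toFun := Germ.map f
  map_one' := congrArg (fun c : B => ((fun _ => c : ι → B) : Germ W B)) f.map_one
  map_zero' := congrArg (fun c : B => ((fun _ => c : ι → B) : Germ W B)) f.map_zero
  map_mul' := fun a b => by
    induction a using Germ.inductionOn
    induction b using Germ.inductionOn
    exact congrArg _ (funext fun i => f.map_mul _ _)
  map_add' := fun a b => by
    induction a using Germ.inductionOn
    induction b using Germ.inductionOn
    exact congrArg _ (funext fun i => f.map_add _ _)

/-- Every finite group is the group of a Galois family of real germs over the rational
functions. -/
theorem exists_galoisFamily_realGerms (G : Type*) [Group G] [Finite G] :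
    ∃ W : Ultrafilter ℝ, (W : Filter ℝ) ≤ 𝓝[≠] 0 ∧ ∃ θ : G → Germ (W : Filter ℝ) ℝ,
      GaloisFamily (realAdjoin (realGermConst (W : Filter ℝ))
        ((id : ℝ → ℝ) : Germ (W : Filter ℝ) ℝ)) θ := by
  obtain ⟨R, hR, θ, -, hθ⟩ := hasRealFamily G
  let W : Ultrafilter ℝ := Ultrafilter.of (𝓝[≠] 0)
  have hW : (W : Filter ℝ) ≤ 𝓝[≠] 0 := Ultrafilter.of_le _
  have hc : Tendsto (fun t : ℝ => (t : ℂ)) W (𝓝[≠] 0) := by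
    refine tendsto_nhdsWithin_iff.2 ⟨?_, ?_⟩
    · have : Tendsto (fun t : ℝ => (t : ℂ)) (𝓝 0) (𝓝 ((0 : ℝ) : ℂ)) :=
        Complex.continuous_ofReal.tendsto 0
      exact this.mono_left (hW.trans nhdsWithin_le_nhds)
    · filter_upwards [hW self_mem_nhdsWithin] with t ht
      exact Complex.ofReal_ne_zero.2 ht
  obtain ⟨j, hj, hjE⟩ := exists_chart W (mem_ball_self hR.out) hc
  refine ⟨W, hW, fun g => ((fun t : ℝ => ((θ g).1 t).re : ℝ → ℝ) : Germ (W : Filter ℝ) ℝ), ?_⟩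
  refine GaloisFamily.of_map (germMap (W : Filter ℝ) Complex.ofRealHom) ?_
  have := hθ.map j
  rw [hjE] at this
  rw [map_realAdjoin]
  convert this using 2 with g
  · rfl
  · rfl
  rw [hj]
  refine Germ.coe_eq.2 ?_
  filter_upwards [tendsto_principal (mem_ball_self hR.out) hc (mem_principal_self _)] with t ht
  exact Complex.ext rfl ((θ g).2.2 t ht).symm

end RealGerms

section GaloisGroup

open IntermediateField

variable {K : Type*} [Field K] {E : Subfield K} {G : Type*} [Group G] {θ : G → K}

theorem GaloisFamily.mem_adjoin (h : GaloisFamily E θ) (g : G) : θ g ∈ E⟮θ 1⟯ := by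
  obtain ⟨p, hp⟩ := h.translate g
  have := hp 1
  rw [mul_one] at this
  rw [this]
  exact algebra_adjoin_le_adjoin E {θ 1} (aeval_mem_adjoin_singleton E (θ 1))

theorem GaloisFamily.exists_galois [Finite G] (h : GaloisFamily E θ) :
    FiniteDimensional E E⟮θ 1⟯ ∧ IsGalois E E⟮θ 1⟯ ∧ Nonempty (Gal(E⟮θ 1⟯/E) ≃* G) := by
  classical
  have := Fintype.ofFinite G
  obtain ⟨q, hq, hdeg, hroot⟩ := h.charpoly
  have hint : IsIntegral E (θ 1) := ⟨q, hq, hroot 1⟩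
  have hfin : FiniteDimensional E E⟮θ 1⟯ := adjoin.finiteDimensional hint
  let α : G → E⟮θ 1⟯ := fun g => ⟨θ g, h.mem_adjoin g⟩
  have hα : Function.Injective α := fun g g' hg => h.injective (congrArg Subtype.val hg)
  have hαroot : ∀ (p : E[X]) g, ((aeval (α g) p : E⟮θ 1⟯) : K) = aeval (θ g) p := fun p g =>
    (aeval_algHom_apply (E⟮θ 1⟯.val) (α g) p).symm
  have hqα : ∀ g, aeval (α g) q = 0 := fun g => Subtype.ext ((hαroot q g).trans (hroot g))
  have hprod : q.map (algebraMap E E⟮θ 1⟯) = ∏ g, (X - C (α g)) := by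
    refine eq_of_monic_of_dvd_of_natDegree_le (monic_prod_X_sub_C α _) (hq.map _) ?_ ?_
    · refine Finset.prod_dvd_of_coprime (fun g _ h _ hgh => ?_) fun g _ => ?_
      · exact isCoprime_X_sub_C_of_isUnit_sub (sub_ne_zero.2 (hα.ne hgh)).isUnit
      · rw [dvd_iff_isRoot, IsRoot, eval_map_algebraMap]
        exact hqα g
    · rw [natDegree_map, hdeg, natDegree_prod_of_monic _ _ fun g _ => monic_X_sub_C _]
      simp
  have hgen₁ : (adjoin.powerBasis hint).gen = α 1 := adjoin.powerBasis_gen hint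
  have hsplit : IsSplittingField E E⟮θ 1⟯ q := by
    refine ⟨?_, ?_⟩
    · rw [hprod]
      exact Splits.prod fun g _ => Splits.X_sub_C _
    · rw [eq_top_iff, ← (adjoin.powerBasis hint).adjoin_gen_eq_top, hgen₁]
      refine Algebra.adjoin_mono (Set.singleton_subset_iff.2 ?_)
      exact (mem_rootSet_of_ne hq.ne_zero).2 (hqα 1)
  have hsep : q.Separable := by
    rw [← separable_map (algebraMap E E⟮θ 1⟯), hprod]
    exact separable_prod_X_sub_C_iff.2 hα
  have hgal : IsGalois E E⟮θ 1⟯ := IsGalois.of_separable_splitting_field hsep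
  have hcard : Nat.card G ≤ Nat.card Gal(E⟮θ 1⟯/E) := by
    rw [IsGalois.card_aut_eq_finrank, adjoin.finrank hint]
    by_contra! hlt
    refine (minpoly.monic hint).map (algebraMap E K) |>.ne_zero ?_
    refine eq_zero_of_natDegree_lt_card_of_eval_eq_zero _ h.injective (fun g => ?_) ?_
    · rw [eval_map_algebraMap]
      exact h.conj _ (minpoly.aeval E (θ 1)) g
    · rwa [natDegree_map, ← Nat.card_eq_fintype_card]
  have hσ : ∀ σ : Gal(E⟮θ 1⟯/E), ∃ g, σ (α 1) = α g := fun σ => by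
    have h0 : aeval (σ (α 1)) q = 0 := by
      rw [aeval_algHom_apply σ, hqα, map_zero]
    rw [← eval_map_algebraMap, hprod, eval_prod, Finset.prod_eq_zero_iff] at h0
    obtain ⟨g, -, hg⟩ := h0
    rw [eval_sub, eval_X, eval_C, sub_eq_zero] at hg
    exact ⟨g, hg⟩
  choose f hf using hσ
  have hgen : ∀ σ τ : Gal(E⟮θ 1⟯/E), σ (α 1) = τ (α 1) → σ = τ := fun σ τ hστ =>
    AlgEquiv.coe_toAlgHom_injective ((adjoin.powerBasis hint).algHom_ext (by rwa [hgen₁]))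
  have hfmul : ∀ σ τ, f (σ * τ) = f τ * f σ := fun σ τ => by
    obtain ⟨p, hp⟩ := h.translate (f τ)
    have hp' : ∀ g, α (f τ * g) = aeval (α g) p := fun g =>
      Subtype.ext ((hp g).trans (hαroot p g).symm)
    refine hα ?_
    have h1 := hp' 1
    rw [mul_one] at h1
    rw [← hf, AlgEquiv.mul_apply, hf τ, h1, ← aeval_algHom_apply σ, hf σ, hp']
  refine ⟨hfin, hgal, ⟨MulEquiv.ofBijective
    (MonoidHom.mk' (fun σ => (f σ)⁻¹) fun σ τ => by rw [hfmul, mul_inv_rev]) ?_⟩⟩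
  have : Fintype Gal(E⟮θ 1⟯/E) := Fintype.ofFinite _
  rw [Fintype.bijective_iff_injective_and_card]
  have hinj : Function.Injective fun σ => (f σ)⁻¹ := fun σ τ hστ =>
    hgen σ τ (by rw [hf, hf, inv_injective hστ])
  refine ⟨hinj, le_antisymm (Fintype.card_le_of_injective _ hinj) ?_⟩
  rwa [Nat.card_eq_fintype_card, Nat.card_eq_fintype_card] at hcard

end GaloisGroup

section TensorExtension

variable {F E L : Type*} [DivisionRing F] [Field E] [Field L] [Algebra E F] [Algebra E L]

theorem includeRight_central (l : L) (y : F ⊗[E] L) :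
    y * (1 ⊗ₜ[E] l) = (1 ⊗ₜ[E] l) * y := by
  induction y using TensorProduct.induction_on with
  | zero => rw [zero_mul, mul_zero]
  | tmul a l' =>
    rw [Algebra.TensorProduct.tmul_mul_tmul, Algebra.TensorProduct.tmul_mul_tmul, mul_one, one_mul,
      mul_comm]
  | add y z hy hz => rw [add_mul, mul_add, hy, hz]

theorem isUnit_or_eq_zero_of_noZeroDivisors [FiniteDimensional E L]
    [NoZeroDivisors (F ⊗[E] L)] (a : F ⊗[E] L) : IsUnit a ∨ a = 0 := by
  refine or_iff_not_imp_right.2 fun ha => ?_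
  let f : F ⊗[E] L →ₗ[F] F ⊗[E] L :=
    { toFun := fun y => y * a
      map_add' := fun y z => add_mul y z a
      map_smul' := fun c y => smul_mul_assoc c y a }
  have : FiniteDimensional F (F ⊗[E] L) := Module.Finite.base_change E F L
  have hf : Function.Injective f := fun y z h => by
    have : (y - z) * a = 0 := by rw [sub_mul, sub_eq_zero]; exact h
    exact sub_eq_zero.1 ((mul_eq_zero.1 this).resolve_right ha)
  obtain ⟨b, hb⟩ := LinearMap.injective_iff_surjective.1 hf 1
  have hb : b * a = 1 := hb
  have hb' : a * b = 1 := hf <| by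
    change a * b * a = 1 * a
    rw [mul_assoc, hb, mul_one, one_mul]
  exact ⟨⟨a, b, hb', hb⟩, rfl⟩

/-- Galois automorphisms act on the second tensor factor. -/
noncomputable def galTensor (F : Type*) [DivisionRing F] [Algebra E F] (τ : Gal(L/E)) :
    F ⊗[E] L ≃ₐ[E] F ⊗[E] L :=
  Algebra.TensorProduct.congr AlgEquiv.refl τ

theorem galTensor_tmul (τ : Gal(L/E)) (a : F) (l : L) :
    galTensor F τ (a ⊗ₜ[E] l) = a ⊗ₜ[E] τ l := rfl

theorem sum_galTensor_mem [FiniteDimensional E L] [IsGalois E L] (y : F ⊗[E] L) :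
    ∃ a : F, ∑ τ : Gal(L/E), galTensor F τ y = a ⊗ₜ[E] 1 := by
  induction y using TensorProduct.induction_on with
  | zero => exact ⟨0, by simp⟩
  | tmul a l =>
    refine ⟨Algebra.trace E L l • a, ?_⟩
    rw [TensorProduct.smul_tmul, ← Algebra.algebraMap_eq_smul_one, trace_eq_sum_automorphisms,
      TensorProduct.tmul_sum]
    rfl
  | add y z hy hz =>
    obtain ⟨a, ha⟩ := hy
    obtain ⟨b, hb⟩ := hz
    refine ⟨a + b, ?_⟩
    simp only [map_add, Finset.sum_add_distrib, ha, hb, TensorProduct.add_tmul]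

end TensorExtension

section TensorGalois

variable {F M E L : Type*} [DivisionRing F] [DivisionRing M] [Field E] [Field L] [Algebra E F]
  [Algebra E L] (e : F ⊗[E] L ≃+* M)

/-- The first factor of a tensor product decomposition. -/
noncomputable def tensorLeft : F →+* M :=
  (e : F ⊗[E] L →+* M).comp Algebra.TensorProduct.includeLeftRingHom

theorem tensorLeft_apply (a : F) : tensorLeft e a = e (a ⊗ₜ[E] 1) := rfl

/-- Galois automorphisms of the second factor of a tensor product decomposition. -/
noncomputable def galHom : Gal(L/E) →* fixingAut (tensorLeft e) where
  toFun τ := ⟨(e.symm.trans (galTensor F τ).toRingEquiv).trans e, fun a => by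
    change e (galTensor F τ (e.symm (e (a ⊗ₜ[E] 1)))) = e (a ⊗ₜ[E] 1)
    rw [e.symm_apply_apply, galTensor_tmul, map_one]⟩
  map_one' := by
    refine Subtype.ext (RingEquiv.ext fun m => ?_)
    change e (galTensor F 1 (e.symm m)) = m
    rw [galTensor]
    exact (congrArg e (AlgEquiv.congr_fun Algebra.TensorProduct.congr_refl _)).trans
      (e.apply_symm_apply m)
  map_mul' τ τ' := by
    refine Subtype.ext (RingEquiv.ext fun m => ?_)
    change e (galTensor F (τ * τ') (e.symm m)) =
      e (galTensor F τ (e.symm (e (galTensor F τ' (e.symm m)))))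
    rw [e.symm_apply_apply]
    congr 1
    induction e.symm m using TensorProduct.induction_on with
    | zero => simp only [map_zero]
    | tmul a l => rfl
    | add y z hy hz => simp only [map_add, hy, hz]

theorem galHom_apply (τ : Gal(L/E)) (y : F ⊗[E] L) :
    (galHom e τ).1 (e y) = e (galTensor F τ y) := by
  change e (galTensor F τ (e.symm (e y))) = _
  rw [e.symm_apply_apply]

theorem galHom_injective : Function.Injective (galHom e) := fun τ τ' h => by
  refine AlgEquiv.ext fun l => ?_
  have h1 : (galHom e τ).1 (e (1 ⊗ₜ[E] l)) = (galHom e τ').1 (e (1 ⊗ₜ[E] l)) := by rw [h]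
  rw [galHom_apply, galHom_apply, e.injective.eq_iff, galTensor_tmul, galTensor_tmul] at h1
  exact Algebra.TensorProduct.includeRight_injective (algebraMap E F).injective h1

theorem galHom_surjective [Normal E L] : Function.Surjective (galHom e) := by
  rintro ⟨σ, hσ⟩
  let κ : L →+* M :=
    (e : F ⊗[E] L →+* M).comp (Algebra.TensorProduct.includeRight : L →ₐ[E] F ⊗[E] L).toRingHom
  have hκ : ∀ l, κ l = e (1 ⊗ₜ[E] l) := fun l => rfl
  have hκc : ∀ l, κ l ∈ Subring.center M := fun l => Subring.mem_center_iff.2 fun m => by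
    obtain ⟨y, rfl⟩ := e.surjective m
    rw [hκ, ← map_mul, ← map_mul, includeRight_central]
  let κ' : L →+* Subring.center M := κ.codRestrict _ hκc
  let : Algebra L (Subring.center M) := κ'.toAlgebra
  let : Algebra E (Subring.center M) := (κ'.comp (algebraMap E L)).toAlgebra
  have : IsScalarTower E L (Subring.center M) := IsScalarTower.of_algebraMap_eq fun _ => rfl
  have hE : ∀ r : E, κ (algebraMap E L r) = tensorLeft e (algebraMap E F r) := fun r => by
    rw [hκ, tensorLeft_apply, Algebra.algebraMap_eq_smul_one, Algebra.algebraMap_eq_smul_one,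
      TensorProduct.smul_tmul]
  let σ' : Subring.center M ≃ₐ[E] Subring.center M :=
    AlgEquiv.ofRingEquiv (f := Subring.centerCongr σ) fun r => Subtype.ext <| by
      change σ (κ (algebraMap E L r)) = κ (algebraMap E L r)
      rw [hE, hσ]
  let τ : Gal(L/E) := σ'.restrictNormal L
  have hτ : ∀ l, κ (τ l) = σ (κ l) := fun l =>
    congrArg Subtype.val (AlgEquiv.restrictNormal_commutes σ' L l)
  refine ⟨τ, Subtype.ext (RingEquiv.ext fun m => ?_)⟩
  obtain ⟨y, rfl⟩ := e.surjective m
  rw [galHom_apply]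
  induction y using TensorProduct.induction_on with
  | zero => simp only [map_zero]
  | tmul a l =>
    have h : ∀ l : L, e (a ⊗ₜ[E] l) = tensorLeft e a * κ l := fun l => by
      rw [hκ, tensorLeft_apply, ← map_mul, Algebra.TensorProduct.tmul_mul_tmul, mul_one, one_mul]
    rw [galTensor_tmul, h, h, map_mul, hτ, hσ]
  | add y z hy hz => simp only [map_add, hy, hz]

theorem isGaloisExt_tensorLeft [CharZero F] [FiniteDimensional E L] [IsGalois E L] :
    IsGaloisExt (tensorLeft e) := fun m hm => by
  obtain ⟨y, rfl⟩ := e.surjective m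
  have hy : ∀ τ : Gal(L/E), galTensor F τ y = y := fun τ =>
    e.injective ((galHom_apply e τ y).symm.trans (hm _ (galHom e τ).2))
  obtain ⟨a, ha⟩ := sum_galTensor_mem y
  simp only [hy, Finset.sum_const] at ha
  set n := (Finset.univ : Finset Gal(L/E)).card
  have hn : (n : F) ≠ 0 := Nat.cast_ne_zero.2 (Finset.card_ne_zero.2 ⟨1, Finset.mem_univ 1⟩)
  refine ⟨(n : F)⁻¹ * a, ?_⟩
  rw [map_mul, tensorLeft_apply e a, ← ha, nsmul_eq_mul, map_mul, map_natCast, ← mul_assoc,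
    ← map_natCast (tensorLeft e), ← map_mul, inv_mul_cancel₀ hn, map_one, one_mul]

end TensorGalois

/-- Scalar extension to a Galois extension of a central subfield. -/
theorem exists_isGaloisExt_of_tensor {F : Type u} [DivisionRing F] [CharZero F] {E L : Type}
    [Field E] [Field L] [Algebra E F] [Algebra E L] [FiniteDimensional E L] [IsGalois E L]
    [NoZeroDivisors (F ⊗[E] L)] :
    ∃ (M : Type u) (instM : DivisionRing M),
      letI := instM
      ∃ ι : F →+* M, Function.Injective ι ∧ IsGaloisExt ι ∧
        Nonempty (fixingAut ι ≃* Gal(L/E)) := by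
  have : Nontrivial (F ⊗[E] L) :=
    (Algebra.TensorProduct.includeLeft_injective (S := E) (A := F) (B := L)
      (algebraMap E L).injective).nontrivial
  let instM : DivisionRing (F ⊗[E] L) :=
    DivisionRing.ofIsUnitOrEqZero isUnit_or_eq_zero_of_noZeroDivisors
  let e : F ⊗[E] L ≃+* F ⊗[E] L := RingEquiv.refl _
  exact ⟨F ⊗[E] L, instM, tensorLeft e, (tensorLeft e).injective, isGaloisExt_tensorLeft e,
    ⟨(MulEquiv.ofBijective (galHom e) ⟨galHom_injective e, galHom_surjective e⟩).symm⟩⟩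

section TensorDomain

variable {F D E L : Type*} [DivisionRing F] [DivisionRing D] [Field E] [Field L] [Algebra E F]
  [Algebra E L]

/-- A tensor product which embeds into a division ring has no zero divisors. -/
theorem noZeroDivisors_tensor_of_independent [FiniteDimensional E L] (j : F →+* D) (c : L →+* D)
    (hc : ∀ l d, Commute (c l) d) (hE : ∀ r, j (algebraMap E F r) = c (algebraMap E L r))
    (hind : ∀ (n : ℕ) (l : Fin n → L), LinearIndependent E l → ∀ a : Fin n → F,
      ∑ i, j (a i) * c (l i) = 0 → ∀ i, a i = 0) : NoZeroDivisors (F ⊗[E] L) := by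
  let : Algebra E D := (c.comp (algebraMap E L)).toAlgebra' fun r d => hc _ d
  let jA : F →ₐ[E] D := { j with commutes' := hE }
  let cA : L →ₐ[E] D := { c with commutes' := fun _ => rfl }
  let Φ : F ⊗[E] L →ₐ[E] D := Algebra.TensorProduct.lift jA cA fun a l => (hc l (j a)).symm
  have hΦ : ∀ a l, Φ (a ⊗ₜ[E] l) = j a * c l := fun a l => Algebra.TensorProduct.lift_tmul _ _ _ a l
  let b := Module.finBasis E L
  let B := Algebra.TensorProduct.basis F b
  refine Function.Injective.noZeroDivisors Φ ((injective_iff_map_eq_zero Φ).2 fun y hy => ?_)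
    (map_zero Φ) (map_mul Φ)
  have hB : ∀ i, B.repr y i • B i = B.repr y i ⊗ₜ[E] b i := fun i => by
    rw [Algebra.TensorProduct.basis_apply, TensorProduct.smul_tmul', smul_eq_mul, mul_one]
  have hsum : y = ∑ i, B.repr y i ⊗ₜ[E] b i := by
    rw [← Finset.sum_congr rfl fun i _ => hB i, B.sum_repr]
  have h0 : ∑ i, j (B.repr y i) * c (b i) = 0 := by
    rw [← hy]
    conv_rhs => rw [hsum]
    rw [map_sum]
    exact Finset.sum_congr rfl fun i _ => (hΦ _ _).symm
  rw [hsum]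
  refine Finset.sum_eq_zero fun i _ => ?_
  rw [hind _ b b.linearIndependent _ h0 i, TensorProduct.zero_tmul]

theorem exists_ringHom_of_mem_range {R : Type*} [Ring R] (j : F →+* D) (g : R →+* D)
    (h : ∀ r, ∃ y, j y = g r) : ∃ g' : R →+* F, ∀ r, j (g' r) = g r := by
  choose f hf using h
  refine ⟨⟨⟨⟨f, ?_⟩, fun r s => ?_⟩, ?_, fun r s => ?_⟩, hf⟩ <;> refine j.injective ?_
  · rw [hf, map_one, map_one]
  · change j (f (r * s)) = j (f r * f s)
    rw [hf, map_mul, map_mul, hf, hf]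
  · change j (f 0) = j 0
    rw [hf, map_zero, map_zero]
  · change j (f (r + s)) = j (f r + f s)
    rw [hf, map_add, map_add, hf, hf]

end TensorDomain

section LineGerms

open Filter Topology

variable {H : Type*} [DivisionRing H]

theorem exists_generic_ultrafilter [NoZeroDivisors (polyFunRing H)] :
    ∃ V : Ultrafilter H, ∀ f : polyFunRing H, f ≠ 0 → ∀ᶠ h in V, f.1 h ≠ 0 := by
  classical
  obtain ⟨V, hV⟩ := Ultrafilter.exists_ultrafilter_of_finite_inter_nonempty
    {s : Set H | ∃ f : polyFunRing H, f ≠ 0 ∧ s = {h | f.1 h ≠ 0}} fun T hT => by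
      have : ∃ f : polyFunRing H, f ≠ 0 ∧ ∀ h, f.1 h ≠ 0 → ∀ s ∈ T, h ∈ s := by
        induction T using Finset.induction_on with
        | empty => exact ⟨1, one_ne_zero, by simp⟩
        | insert s T _ ih =>
          rw [Finset.coe_insert, Set.insert_subset_iff] at hT
          obtain ⟨f, hf, hfT⟩ := ih hT.2
          obtain ⟨g, hg, rfl⟩ := hT.1
          refine ⟨f * g, mul_ne_zero hf hg, fun h hh s hs => ?_⟩
          have hh : f.1 h * g.1 h ≠ 0 := hh
          rcases Finset.mem_insert.1 hs with rfl | hs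
          · exact right_ne_zero_of_mul hh
          · exact hfT h (left_ne_zero_of_mul hh) s hs
      obtain ⟨f, hf, hfT⟩ := this
      obtain ⟨h, hh⟩ : ∃ h, f.1 h ≠ 0 := by
        by_contra! h0
        exact hf (Subtype.ext (funext h0))
      exact ⟨h, fun s hs => hfT h hh s hs⟩
  exact ⟨V, fun f hf => hV ⟨f, hf, rfl⟩⟩

variable {W : Ultrafilter ℝ}

theorem eq_zero_of_eventually_eval_eq_zero (hW : (W : Filter ℝ) ≤ 𝓝[≠] 0)
    {q : ℝ[X]} (h : ∀ᶠ s in W, q.eval s = 0) : q = 0 := by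
  by_contra hq
  have hfin : ∀ᶠ s in cofinite, ¬ q.eval s = 0 := by
    refine (q.rootSet_finite ℝ).subset fun s hs => ?_
    rw [mem_rootSet_of_ne hq, coe_aeval_eq_eval]
    exact not_not.1 hs
  obtain ⟨s, hs, hs'⟩ := (h.and (hfin.filter_mono (hW.trans (nhdsNE_le_cofinite 0)))).exists
  exact hs' hs

theorem coe_eval_eq_eval₂ (q : ℝ[X]) : (((fun s => q.eval s) : ℝ → ℝ) : Germ (W : Filter ℝ) ℝ) =
    q.eval₂ (realGermConst (W : Filter ℝ)) ((id : ℝ → ℝ) : Germ (W : Filter ℝ) ℝ) := by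
  have : (fun s => q.eval s) = q.eval₂ (Pi.constRingHom ℝ ℝ) id := by
    funext s
    exact (hom_eval₂ q (Pi.constRingHom ℝ ℝ) (Pi.evalRingHom _ s) id).symm
  rw [this]
  exact hom_eval₂ q (Pi.constRingHom ℝ ℝ) (Germ.coeRingHom (W : Filter ℝ)) id

theorem eq_zero_of_sum_eval_mul [Algebra ℝ H] (hW : (W : Filter ℝ) ≤ 𝓝[≠] 0) {n : ℕ}
    {l : Fin n → Germ (W : Filter ℝ) ℝ}
    (hl : LinearIndependent (realAdjoin (realGermConst (W : Filter ℝ))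
      ((id : ℝ → ℝ) : Germ (W : Filter ℝ) ℝ)) l) {p : Fin n → H[X]}
    (hp : ∑ i, (((fun s => (p i).eval (algebraMap ℝ H s)) : ℝ → H) : Germ (W : Filter ℝ) H) *
      germMap (W : Filter ℝ) (algebraMap ℝ H) (l i) = 0) (i : Fin n) : p i = 0 := by
  choose m hm using fun i => Quotient.exists_rep (l i)
  have hm : ∀ i, l i = ((m i : ℝ → ℝ) : Germ (W : Filter ℝ) ℝ) := fun i => (hm i).symm
  have hsum : ∀ᶠ s in W, ∑ i, (p i).eval (algebraMap ℝ H s) * algebraMap ℝ H (m i s) = 0 := by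
    refine Germ.coe_eq.1 (Eq.trans ?_ hp)
    have : (fun s => ∑ i, (p i).eval (algebraMap ℝ H s) * algebraMap ℝ H (m i s)) =
        ∑ i, fun s => (p i).eval (algebraMap ℝ H s) * algebraMap ℝ H (m i s) := by
      funext s
      rw [Finset.sum_apply]
    rw [this]
    refine (map_sum (Germ.coeRingHom (W : Filter ℝ)) _ _).trans ?_
    refine Finset.sum_congr rfl fun i _ => ?_
    rw [hm]
    rfl
  refine eq_zero_of_coeffFunctional fun φ => eq_zero_of_eventually_eval_eq_zero hW ?_
  let c : Fin n → realAdjoin (realGermConst (W : Filter ℝ))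
      ((id : ℝ → ℝ) : Germ (W : Filter ℝ) ℝ) := fun i =>
    ⟨_, eval₂_mem_realAdjoin _ _ (coeffFunctional φ (p i))⟩
  have hc : ∑ i, c i • l i = 0 := by
    have h0 : ∀ᶠ s in W, (∑ i, fun s => (coeffFunctional φ (p i)).eval s * m i s) s =
        (0 : ℝ → ℝ) s := by
      filter_upwards [hsum] with s hs
      have := congrArg φ hs
      rw [map_sum, map_zero] at this
      rw [Finset.sum_apply, Pi.zero_apply, ← this]
      exact Finset.sum_congr rfl fun i _ => (functional_eval_mul φ (p i) s (m i s)).symm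
    refine Eq.trans ?_ (Germ.coe_eq.2 h0)
    refine Eq.trans ?_ (map_sum (Germ.coeRingHom (W : Filter ℝ)) _ _).symm
    refine Finset.sum_congr rfl fun i _ => ?_
    rw [Subfield.smul_def, smul_eq_mul, hm]
    change eval₂ _ _ _ * _ = _
    rw [← coe_eval_eq_eval₂]
    rfl
  have := congrArg Subtype.val (Fintype.linearIndependent_iff.1 hl c hc i)
  change eval₂ _ _ _ = _ at this
  rw [← coe_eval_eq_eval₂] at this
  exact Germ.coe_eq.1 this

end LineGerms

section LineEvaluation

open Filter Topology

variable {H : Type*} [DivisionRing H] [Algebra ℝ H] (W : Ultrafilter ℝ) (V : Ultrafilter H)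

/-- Restriction of functions to the real lines through `h - x h`, as iterated germs. -/
def lineEval (x : H → H) : (H → H) →+* Germ (V : Filter H) (Germ (W : Filter ℝ) H) :=
  (Germ.coeRingHom (V : Filter H)).comp <| RingHom.pi fun h =>
    (Germ.coeRingHom (W : Filter ℝ)).comp <| RingHom.pi fun s =>
      Pi.evalRingHom (fun _ => H) (h - x h + algebraMap ℝ H s)

/-- Real germs as constant families of germs. -/
def constGerm : Germ (W : Filter ℝ) ℝ →+* Germ (V : Filter H) (Germ (W : Filter ℝ) H) :=
  ((Germ.coeRingHom (V : Filter H)).comp (Pi.constRingHom H _)).comp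
    (germMap (W : Filter ℝ) (algebraMap ℝ H))

theorem constGerm_commute (a : Germ (W : Filter ℝ) ℝ)
    (d : Germ (V : Filter H) (Germ (W : Filter ℝ) H)) : Commute (constGerm W V a) d := by
  induction d using Germ.inductionOn with | h f
  refine congrArg _ (funext fun h => ?_)
  change germMap (W : Filter ℝ) (algebraMap ℝ H) a * f h =
    f h * germMap (W : Filter ℝ) (algebraMap ℝ H) a
  induction f h using Germ.inductionOn with | h g
  induction a using Germ.inductionOn with | h m
  exact congrArg (fun f : ℝ → H => (f : Germ (W : Filter ℝ) H))
    (_root_.funext fun s => Algebra.commutes (m s) (g s))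

theorem lineEval_const (x : H → H) (r : ℝ) : lineEval W V x (fun _ => algebraMap ℝ H r) =
    constGerm W V (realGermConst (W : Filter ℝ) r) := rfl

variable {W V}

theorem algebraMap_mem_center (s : ℝ) : algebraMap ℝ H s ∈ Subring.center H :=
  Subring.mem_center_iff.2 fun _ => (Algebra.commutes _ _).symm

theorem lineEval_coordinate {x : H →ₗ[Subring.center H] Subring.center H}
    (hx : ∀ c : Subring.center H, x c = c) :
    lineEval W V (fun h => x h) (fun h => x h) =
      constGerm W V ((id : ℝ → ℝ) : Germ (W : Filter ℝ) ℝ) := by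
  refine congrArg (fun f : H → Germ (W : Filter ℝ) H => (f : Germ (V : Filter H)
    (Germ (W : Filter ℝ) H))) (_root_.funext fun h => ?_)
  refine congrArg (fun f : ℝ → H => (f : Germ (W : Filter ℝ) H)) (funext fun s => ?_)
  change (x (h - x h + algebraMap ℝ H s) : H) = algebraMap ℝ H s
  have hs := hx ⟨algebraMap ℝ H s, algebraMap_mem_center s⟩
  rw [map_add, map_sub, hx, sub_self, zero_add]
  exact congrArg Subtype.val hs

theorem eq_zero_of_sum_lineEval (hW : (W : Filter ℝ) ≤ 𝓝[≠] 0)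
    (hV : ∀ f : polyFunRing H, f ≠ 0 → ∀ᶠ h in V, f.1 h ≠ 0) (x : H → Subring.center H) {n : ℕ}
    {l : Fin n → Germ (W : Filter ℝ) ℝ}
    (hl : LinearIndependent (realAdjoin (realGermConst (W : Filter ℝ))
      ((id : ℝ → ℝ) : Germ (W : Filter ℝ) ℝ)) l) {r : Fin n → polyFunRing H}
    (hr : ∑ i, lineEval W V (fun h => x h) (r i).1 * constGerm W V (l i) = 0) (i : Fin n) :
    r i = 0 := by
  by_contra hi
  choose p hp using fun i h => exists_polynomial_on_line (r i).2 (h - x h)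
  have hsum : ∀ᶠ h in V, ∑ i, (((fun s => (p i h).eval (algebraMap ℝ H s)) : ℝ → H) :
      Germ (W : Filter ℝ) H) * germMap (W : Filter ℝ) (algebraMap ℝ H) (l i) = 0 := by
    refine Germ.coe_eq.1 (Eq.trans ?_ hr)
    have hfun : (fun h => ∑ i, (((fun s => (p i h).eval (algebraMap ℝ H s)) : ℝ → H) :
        Germ (W : Filter ℝ) H) * germMap (W : Filter ℝ) (algebraMap ℝ H) (l i)) =
        ∑ i, fun h => (((fun s => (p i h).eval (algebraMap ℝ H s)) : ℝ → H) :
          Germ (W : Filter ℝ) H) * germMap (W : Filter ℝ) (algebraMap ℝ H) (l i) := by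
      funext h
      rw [Finset.sum_apply]
    rw [hfun]
    refine (map_sum (Germ.coeRingHom (V : Filter H)) _ _).trans ?_
    refine Finset.sum_congr rfl fun i _ => ?_
    refine congrArg (fun f : H → Germ (W : Filter ℝ) H => (f : Germ (V : Filter H)
      (Germ (W : Filter ℝ) H))) (_root_.funext fun h => ?_)
    refine congrArg (fun f : ℝ → H => (f : Germ (W : Filter ℝ) H) *
      germMap (W : Filter ℝ) (algebraMap ℝ H) (l i)) (funext fun s => ?_)
    exact (hp i h ⟨algebraMap ℝ H s, algebraMap_mem_center s⟩).symm
  obtain ⟨h, h0, hne⟩ := (hsum.and (hV _ hi)).exists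
  refine hne ?_
  have := hp i h (x h)
  rwa [sub_add_cancel, eq_zero_of_sum_eval_mul hW hl h0 i, eval_zero] at this

theorem lineEval_injective (hW : (W : Filter ℝ) ≤ 𝓝[≠] 0)
    (hV : ∀ f : polyFunRing H, f ≠ 0 → ∀ᶠ h in V, f.1 h ≠ 0) (x : H → Subring.center H) :
    Function.Injective ((lineEval W V (fun h => x h)).comp (polyFunRing H).subtype) := by
  refine (injective_iff_map_eq_zero _).2 fun f hf => ?_
  refine eq_zero_of_sum_lineEval hW hV x (n := 1) (l := fun _ => 1) (r := fun _ => f) ?_ ?_ 0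
  · exact LinearIndependent.of_subsingleton 0 one_ne_zero
  · rw [Fin.sum_univ_one, map_one, mul_one]
    exact hf

end LineEvaluation

theorem exists_galoisExt_of_algebra_real {H : Type v} [DivisionRing H]
    [FiniteDimensional (Subring.center H) H] [Algebra ℝ H] {F : Type u} [DivisionRing F]
    (φ : polyFunRing H →+* F) (hφ : IsClassicalRightQuotient φ)
    (G : Type w) [Group G] [Finite G] :
    ∃ (M : Type u) (instM : DivisionRing M),
      letI := instM
      ∃ ι : F →+* M, Function.Injective ι ∧ IsGaloisExt ι ∧
        Nonempty (fixingAut ι ≃* G) := by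
  have : NoZeroDivisors (polyFunRing H) :=
    Function.Injective.noZeroDivisors φ hφ.1 (map_zero φ) (map_mul φ)
  obtain ⟨x, hx, hxmem⟩ := exists_central_coordinate (H := H)
  obtain ⟨W, hW, θ, hθ⟩ := exists_galoisFamily_realGerms G
  obtain ⟨V, hV⟩ := exists_generic_ultrafilter (H := H)
  obtain ⟨j, hj⟩ := hφ.exists_lift (lineEval_injective hW hV fun h => x h)
  have hj : ∀ r, j (φ r) = lineEval W V (fun h => x h) r.1 := hj
  set E := realAdjoin (realGermConst (W : Filter ℝ)) ((id : ℝ → ℝ) : (W : Filter ℝ).Germ ℝ)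
    with hE
  let S : Subfield ((W : Filter ℝ).Germ ℝ) :=
    { carrier := {a | ∃ y, j y = constGerm W V a}
      mul_mem' := fun ⟨y, hy⟩ ⟨z, hz⟩ => ⟨y * z, by rw [map_mul, map_mul, hy, hz]⟩
      one_mem' := ⟨1, by rw [map_one, map_one]⟩
      add_mem' := fun ⟨y, hy⟩ ⟨z, hz⟩ => ⟨y + z, by rw [map_add, map_add, hy, hz]⟩
      zero_mem' := ⟨0, by rw [map_zero, map_zero]⟩
      neg_mem' := fun ⟨y, hy⟩ => ⟨-y, by rw [map_neg, map_neg, hy]⟩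
      inv_mem' := fun a ⟨y, hy⟩ => ⟨y⁻¹, by rw [map_inv₀, map_inv₀, hy]⟩ }
  have hS : E ≤ S := realAdjoin_le
    (fun r => ⟨φ ⟨_, const_mem_polyFunRing (algebraMap ℝ H r)⟩, (hj _).trans (lineEval_const ..)⟩)
    ⟨φ ⟨_, hxmem⟩, (hj _).trans (lineEval_coordinate hx)⟩
  obtain ⟨g, hg⟩ := exists_ringHom_of_mem_range j ((constGerm W V).comp E.subtype)
    fun e => hS e.2
  have hg : ∀ e, j (g e) = constGerm W V e := hg
  let : Algebra E F := g.toAlgebra' fun e y => j.injective <| by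
    rw [map_mul, map_mul, hg]
    exact constGerm_commute W V _ _
  obtain ⟨hfin, hgal, ⟨iso⟩⟩ := hθ.exists_galois
  let L := IntermediateField.adjoin E {θ 1}
  have : CharZero F := by
    let ψ : ℝ →+* F := g.comp ((realGermConst (W : Filter ℝ)).codRestrict E
      (const_mem_realAdjoin _ _))
    exact charZero_of_injective_ringHom ψ.injective
  have : NoZeroDivisors (F ⊗[E] L) := by
    refine noZeroDivisors_tensor_of_independent j ((constGerm W V).comp L.val.toRingHom)
      (fun l d => constGerm_commute W V _ _) hg fun n l hl a ha i => ?_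
    obtain ⟨b, hb, hr⟩ := hφ.exists_common_denom a Finset.univ
    choose r hr using fun i => hr i (Finset.mem_univ i)
    have hφb : φ b ≠ 0 := (map_ne_zero_iff φ hφ.1).2 hb
    have hsum : ∑ i, lineEval W V (fun h => x h) (r i).1 * constGerm W V (l i) = 0 := by
      rw [← zero_mul (j (φ b)), ← ha, Finset.sum_mul]
      refine Finset.sum_congr rfl fun i _ => ?_
      rw [← hj, ← hr, map_mul, mul_assoc, mul_assoc]
      congr 1
      exact (constGerm_commute W V _ _).symm
    have hri := eq_zero_of_sum_lineEval hW hV (fun h => x h)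
      (l := fun i => (l i : (W : Filter ℝ).Germ ℝ))
      (hl.map' L.val.toLinearMap (LinearMap.ker_eq_bot.2 Subtype.val_injective)) hsum i
    have := hr i
    rw [hri, map_zero] at this
    exact (mul_eq_zero.1 this).resolve_right hφb
  obtain ⟨M, instM, ι, hι, hgalι, ⟨iso'⟩⟩ := exists_isGaloisExt_of_tensor (F := F) (E := E) (L := L)
  exact ⟨M, instM, ι, hι, hgalι, ⟨iso'.trans iso⟩⟩

theorem inverse_galois_over_polyFun_fractions_of_real_subfield
    {H : Type v} [DivisionRing H] [FiniteDimensional (Subring.center H) H]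
    (emb : ℝ →+* Subring.center H)
    {F : Type u} [DivisionRing F]
    (φ : polyFunRing H →+* F) (hφ : IsClassicalRightQuotient φ)
    (G : Type w) [Group G] [Finite G] :
    ∃ (M : Type u) (instM : DivisionRing M),
      letI := instM
      ∃ ι : F →+* M, Function.Injective ι ∧ IsGaloisExt ι ∧
        Nonempty (fixingAut ι ≃* G) := by
  let : Algebra ℝ H := ((Subring.center H).subtype.comp emb).toAlgebra' fun r h =>
    (Subring.mem_center_iff.1 (emb r).2 h).symm
  exact exists_galoisExt_of_algebra_real φ hφ G
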